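/- Let Ω be a Runge domain in ℂ² and let g be a holomorphic function on Ω. Let M := { z ∈ Ω : Re g(z) = 0 } and assume dg(z) ≠ 0 for all z ∈ M. Then every totally real C²-smooth disc contained in M is polynomially convex. -/

import Mathlib

noncomputable section

/-- The polynomial (convex) hull of a set `K ⊆ ℂⁿ`:
`K̂ = { z : |p(z)| ≤ sup_K |p| for every holomorphic polynomial p }`. -/
def polyHull (n : ℕ) (K : Set (Fin n → ℂ)) : Set (Fin n → ℂ) :=
  {z | ∀ p : MvPolynomial (Fin n) ℂ,
    ‖MvPolynomial.eval z p‖ ≤ sSup ((fun w => ‖MvPolynomial.eval w p‖) '' K)}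

/-- A set `K ⊆ ℂⁿ` is polynomially convex if it equals its polynomial hull. -/
def PolyConvex (n : ℕ) (K : Set (Fin n → ℂ)) : Prop := polyHull n K = K

/-- A Runge domain in `ℂⁿ`: a domain on which every holomorphic function can be
approximated uniformly on compact subsets by holomorphic polynomials. -/
def RungeDomain (n : ℕ) (Ω : Set (Fin n → ℂ)) : Prop :=
  IsOpen Ω ∧ IsConnected Ω ∧
  ∀ f : (Fin n → ℂ) → ℂ, DifferentiableOn ℂ f Ω →
    ∀ K : Set (Fin n → ℂ), K ⊆ Ω → IsCompact K → ∀ ε : ℝ, 0 < ε →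
      ∃ p : MvPolynomial (Fin n) ℂ, ∀ z ∈ K, ‖f z - MvPolynomial.eval z p‖ ≤ ε

/-- `K ⊆ ℂⁿ` is a totally real `C²`-smooth disc: the image of the closed unit
disc in `ℝ²` under a `C²` embedding `φ` (defined on an open neighborhood `U` of
the closed disc) whose image is a totally real submanifold, i.e. at each point
the tangent plane `W = range (dφ)` satisfies `W ∩ i·W = {0}`. -/
def TotallyRealDisc (n : ℕ) (K : Set (Fin n → ℂ)) : Prop :=
  ∃ (U : Set (ℝ × ℝ)) (φ : ℝ × ℝ → (Fin n → ℂ)),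
    IsOpen U ∧ Metric.closedBall (0 : ℝ × ℝ) 1 ⊆ U ∧
    ContDiffOn ℝ 2 φ U ∧ Set.InjOn φ U ∧
    (∀ x ∈ U, Function.Injective (fderiv ℝ φ x)) ∧
    (∀ x ∈ U, ∀ v w : ℝ × ℝ,
      fderiv ℝ φ x v = Complex.I • fderiv ℝ φ x w → fderiv ℝ φ x v = 0) ∧
    K = φ '' Metric.closedBall (0 : ℝ × ℝ) 1

open MeasureTheory Filter Topology Set
open scoped ContDiff ComplexConjugate

/-- `u` is a uniform limit on `X` of holomorphic polynomials. -/
def UnifApprox (X : Set (Fin 2 → ℂ)) (u : (Fin 2 → ℂ) → ℂ) : Prop :=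
  ∀ ε : ℝ, 0 < ε → ∃ p : MvPolynomial (Fin 2) ℂ, ∀ z ∈ X, ‖u z - MvPolynomial.eval z p‖ ≤ ε

theorem continuous_eval_mvPolynomial (p : MvPolynomial (Fin 2) ℂ) :
    Continuous fun z : Fin 2 → ℂ => MvPolynomial.eval z p :=
  MvPolynomial.continuous_eval p

namespace UnifApprox

variable {X : Set (Fin 2 → ℂ)} {u v : (Fin 2 → ℂ) → ℂ}

theorem eval (X : Set (Fin 2 → ℂ)) (p : MvPolynomial (Fin 2) ℂ) :
    UnifApprox X fun z => MvPolynomial.eval z p :=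
  fun ε hε => ⟨p, fun z _ => by simpa using hε.le⟩

theorem const (X : Set (Fin 2 → ℂ)) (c : ℂ) : UnifApprox X fun _ => c := by
  simpa using eval X (MvPolynomial.C c)

theorem add (hu : UnifApprox X u) (hv : UnifApprox X v) : UnifApprox X fun z => u z + v z := by
  intro ε hε
  obtain ⟨p, hp⟩ := hu (ε / 2) (half_pos hε)
  obtain ⟨q, hq⟩ := hv (ε / 2) (half_pos hε)
  refine ⟨p + q, fun z hz => ?_⟩
  have := norm_add_le (u z - MvPolynomial.eval z p) (v z - MvPolynomial.eval z q)
  rw [map_add, add_sub_add_comm]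
  linarith [hp z hz, hq z hz]

theorem bounded (hX : IsCompact X) (hu : UnifApprox X u) : ∃ B : ℝ, 0 < B ∧ ∀ z ∈ X, ‖u z‖ ≤ B := by
  obtain ⟨p, hp⟩ := hu 1 one_pos
  obtain ⟨B, hB⟩ := hX.exists_bound_of_continuousOn (continuous_eval_mvPolynomial p).continuousOn
  refine ⟨max B 0 + 1, by positivity, fun z hz => ?_⟩
  have := norm_add_le (u z - MvPolynomial.eval z p) (MvPolynomial.eval z p)
  rw [sub_add_cancel] at this
  linarith [hp z hz, hB z hz, le_max_left B 0]

theorem mul (hX : IsCompact X) (hu : UnifApprox X u) (hv : UnifApprox X v) :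
    UnifApprox X fun z => u z * v z := by
  intro ε hε
  obtain ⟨B, hB0, hB⟩ := hu.bounded hX
  obtain ⟨q, hq⟩ := hv (ε / 2 / B) (by positivity)
  obtain ⟨C, hC⟩ := hX.exists_bound_of_continuousOn (continuous_eval_mvPolynomial q).continuousOn
  have hC0 : 0 < max C 0 + 1 := by positivity
  obtain ⟨p, hp⟩ := hu (ε / 2 / (max C 0 + 1)) (by positivity)
  refine ⟨p * q, fun z hz => ?_⟩
  have e : u z * v z - MvPolynomial.eval z (p * q) =
      u z * (v z - MvPolynomial.eval z q) + (u z - MvPolynomial.eval z p) * MvPolynomial.eval z q := by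
    rw [map_mul]; ring
  have h1 : ‖u z‖ * ‖v z - MvPolynomial.eval z q‖ ≤ B * (ε / 2 / B) :=
    mul_le_mul (hB z hz) (hq z hz) (norm_nonneg _) hB0.le
  have h2 : ‖u z - MvPolynomial.eval z p‖ * ‖MvPolynomial.eval z q‖ ≤
      ε / 2 / (max C 0 + 1) * (max C 0 + 1) :=
    mul_le_mul (hp z hz) (by linarith [hC z hz, le_max_left C 0]) (norm_nonneg _) (by positivity)
  rw [mul_div_cancel₀ _ hB0.ne'] at h1
  rw [div_mul_cancel₀ _ hC0.ne'] at h2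
  rw [e]
  refine (norm_add_le _ _).trans ?_
  rw [norm_mul, norm_mul]
  linarith

theorem congr (hu : UnifApprox X u) (h : ∀ z ∈ X, u z = v z) : UnifApprox X v := by
  intro ε hε
  obtain ⟨p, hp⟩ := hu ε hε
  exact ⟨p, fun z hz => h z hz ▸ hp z hz⟩

theorem const_mul (hX : IsCompact X) (c : ℂ) (hu : UnifApprox X u) : UnifApprox X fun z => c * u z :=
  (const X c).mul hX hu

theorem sub (hX : IsCompact X) (hu : UnifApprox X u) (hv : UnifApprox X v) :
    UnifApprox X fun z => u z - v z :=
  (hu.add (hv.const_mul hX (-1))).congr fun z _ => by ring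

theorem sum {ι : Type*} (s : Finset ι) {w : ι → (Fin 2 → ℂ) → ℂ} (hw : ∀ i ∈ s, UnifApprox X (w i)) :
    UnifApprox X fun z => ∑ i ∈ s, w i z := by
  classical
  induction s using Finset.induction_on with
  | empty => simpa using const X 0
  | insert i s hi ih =>
    refine ((hw i (by simp)).add (ih fun j hj => hw j (by simp [hj]))).congr fun z _ => ?_
    rw [Finset.sum_insert hi]

theorem pow (hX : IsCompact X) (hu : UnifApprox X u) (n : ℕ) : UnifApprox X fun z => u z ^ n := by
  induction n with
  | zero => simpa using const X 1
  | succ n ih => exact (ih.mul hX hu).congr fun z _ => (pow_succ _ _).symm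

theorem of_forall_exists (h : ∀ ε : ℝ, 0 < ε → ∃ v, UnifApprox X v ∧ ∀ z ∈ X, ‖u z - v z‖ ≤ ε) :
    UnifApprox X u := by
  intro ε hε
  obtain ⟨v, hv, huv⟩ := h (ε / 2) (half_pos hε)
  obtain ⟨p, hp⟩ := hv (ε / 2) (half_pos hε)
  refine ⟨p, fun z hz => ?_⟩
  have := norm_add_le (u z - v z) (v z - MvPolynomial.eval z p)
  rw [sub_add_sub_cancel] at this
  linarith [hp z hz, huv z hz]

theorem inv_one_sub (hX : IsCompact X) (hu : UnifApprox X u) {r : ℝ} (hr : r < 1)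
    (h : ∀ z ∈ X, ‖u z‖ ≤ r) : UnifApprox X fun z => (1 - u z)⁻¹ := by
  refine of_forall_exists fun ε hε => ?_
  have h1r : 0 < 1 - r := by linarith
  obtain ⟨n, hn⟩ := exists_pow_lt_of_lt_one (mul_pos hε h1r) hr
  refine ⟨fun z => ∑ k ∈ Finset.range n, u z ^ k, sum _ fun k _ => hu.pow hX k, fun z hz => ?_⟩
  have hlow : 1 - r ≤ ‖1 - u z‖ := by
    have := norm_sub_norm_le (1 : ℂ) (u z)
    rw [norm_one] at this
    linarith [h z hz]
  have hne : 1 - u z ≠ 0 := norm_pos_iff.mp (h1r.trans_le hlow)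
  have e : (1 - u z)⁻¹ - ∑ k ∈ Finset.range n, u z ^ k = u z ^ n / (1 - u z) := by
    have := mul_neg_geom_sum (u z) n
    field_simp
    linear_combination -this
  rw [e, norm_div, norm_pow, div_le_iff₀ (h1r.trans_le hlow)]
  calc ‖u z‖ ^ n ≤ r ^ n := pow_le_pow_left₀ (norm_nonneg _) (h z hz) n
    _ ≤ ε * (1 - r) := hn.le
    _ ≤ ε * ‖1 - u z‖ := by gcongr

theorem norm_le_of_forall {K : Set (Fin 2 → ℂ)} (hu : UnifApprox X u) (hKX : K ⊆ X) {z : Fin 2 → ℂ}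
    (hz : z ∈ X) (hull : ∀ p : MvPolynomial (Fin 2) ℂ, ∃ y ∈ K,
      ‖MvPolynomial.eval z p‖ ≤ ‖MvPolynomial.eval y p‖) {B : ℝ} (hB : ∀ y ∈ K, ‖u y‖ ≤ B) :
    ‖u z‖ ≤ B := by
  refine le_of_forall_pos_le_add fun ε hε => ?_
  obtain ⟨p, hp⟩ := hu (ε / 2) (half_pos hε)
  obtain ⟨y, hy, hzy⟩ := hull p
  have h1 := norm_sub_norm_le (u z) (MvPolynomial.eval z p)
  have h2 := norm_sub_norm_le (MvPolynomial.eval y p) (u y)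
  rw [norm_sub_rev] at h2
  linarith [hp z hz, hp y (hKX hy), hB y hy]

theorem integral (hX : IsCompact X) {T : Set (Fin 2 → ℂ)} (hT : IsCompact T)
    {k : (Fin 2 → ℂ) → (Fin 2 → ℂ) → ℂ}
    (hk : Continuous fun q : (Fin 2 → ℂ) × X => k q.1 q.2)
    (hkT : ∀ ζ, ζ ∉ T → ∀ z ∈ X, k ζ z = 0) (hkX : ∀ ζ, UnifApprox X (k ζ)) :
    UnifApprox X fun z => ∫ ζ, k ζ z := by
  have : CompactSpace X := isCompact_iff_compactSpace.mp hX
  let pc : MvPolynomial (Fin 2) ℂ →ₗ[ℂ] C(X, ℂ) :=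
    { toFun := fun p => ⟨fun z => MvPolynomial.eval z.1 p,
        (continuous_eval_mvPolynomial p).comp continuous_subtype_val⟩
      map_add' := fun p q => by ext; simp
      map_smul' := fun c p => by ext; simp [MvPolynomial.smul_eval] }
  let A : Submodule ℂ C(X, ℂ) := (LinearMap.range pc).topologicalClosure
  have hAc : IsClosed (A : Set C(X, ℂ)) := Submodule.isClosed_topologicalClosure _
  have : CompleteSpace A := hAc.completeSpace_coe
  let Φ : C(Fin 2 → ℂ, C(X, ℂ)) := ContinuousMap.curry ⟨fun q => k q.1 q.2, hk⟩
  have hmem : ∀ F : C(X, ℂ), F ∈ A ↔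
      ∀ ε : ℝ, 0 < ε → ∃ p : MvPolynomial (Fin 2) ℂ, ∀ z : X, ‖F z - MvPolynomial.eval z.1 p‖ ≤ ε := by
    intro F
    change F ∈ closure (LinearMap.range pc : Set C(X, ℂ)) ↔ _
    rw [Metric.mem_closure_iff]
    constructor
    · intro h ε hε
      obtain ⟨_, ⟨p, rfl⟩, hp⟩ := h ε hε
      refine ⟨p, fun z => ?_⟩
      have := (ContinuousMap.dist_apply_le_dist (f := F) (g := pc p) z).trans hp.le
      rwa [dist_eq_norm] at this
    · intro h ε hε
      obtain ⟨p, hp⟩ := h (ε / 2) (half_pos hε)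
      refine ⟨pc p, ⟨p, rfl⟩, lt_of_le_of_lt ?_ (half_lt_self hε)⟩
      rw [ContinuousMap.dist_le (half_pos hε).le]
      intro z
      rw [dist_eq_norm]
      exact hp z
  have hΦA : ∀ ζ, Φ ζ ∈ A := fun ζ => (hmem _).2 fun ε hε => by
    obtain ⟨p, hp⟩ := hkX ζ ε hε
    exact ⟨p, fun z => hp z.1 z.2⟩
  let Ψ : (Fin 2 → ℂ) → A := fun ζ => ⟨Φ ζ, hΦA ζ⟩
  have hΨc : Continuous Ψ := Φ.continuous.subtype_mk _
  have hΨs : HasCompactSupport Ψ := by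
    refine HasCompactSupport.intro hT fun ζ hζ => ?_
    ext z
    exact hkT ζ hζ z.1 z.2
  have hint : Integrable Ψ := hΨc.integrable_of_hasCompactSupport hΨs
  intro ε hε
  obtain ⟨p, hp⟩ := (hmem _).1 (∫ ζ, Ψ ζ).2 ε hε
  refine ⟨p, fun z hz => ?_⟩
  have := hp ⟨z, hz⟩
  let ev : A →L[ℂ] ℂ := (ContinuousMap.evalCLM ℂ (⟨z, hz⟩ : X)).comp A.subtypeL
  have h2 : ev (∫ ζ, Ψ ζ) = ∫ ζ, k ζ z := (ev.integral_comp_comm hint).symm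
  change ‖(∫ ζ, k ζ z) - _‖ ≤ ε
  rw [← h2]
  exact this

end UnifApprox

/-- The Wirtinger derivative `∂/∂z̄ⱼ`. -/
def dbar (j : Fin 2) (u : (Fin 2 → ℂ) → ℂ) (z : Fin 2 → ℂ) : ℂ :=
  2⁻¹ * (fderiv ℝ u z (Pi.single j 1) + Complex.I * fderiv ℝ u z (Pi.single j Complex.I))

section dbar

variable {u v : (Fin 2 → ℂ) → ℂ} {z : Fin 2 → ℂ} (j : Fin 2)

theorem dbar_congr (h : u =ᶠ[𝓝 z] v) : dbar j u z = dbar j v z := by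
  rw [dbar, dbar, h.fderiv_eq]

theorem dbar_const (c : ℂ) : dbar j (fun _ => c) z = 0 := by simp [dbar]

theorem dbar_add (hu : DifferentiableAt ℝ u z) (hv : DifferentiableAt ℝ v z) :
    dbar j (fun ζ => u ζ + v ζ) z = dbar j u z + dbar j v z := by
  simp only [dbar, fderiv_fun_add hu hv, add_apply]
  ring

theorem dbar_sub (hu : DifferentiableAt ℝ u z) (hv : DifferentiableAt ℝ v z) :
    dbar j (fun ζ => u ζ - v ζ) z = dbar j u z - dbar j v z := by
  simp only [dbar, fderiv_fun_sub hu hv, sub_apply]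
  ring

theorem dbar_mul (hu : DifferentiableAt ℝ u z) (hv : DifferentiableAt ℝ v z) :
    dbar j (fun ζ => u ζ * v ζ) z = dbar j u z * v z + u z * dbar j v z := by
  simp only [dbar, fderiv_fun_mul hu hv, add_apply, smul_apply, smul_eq_mul]
  ring

theorem dbar_of_mul_eq_one (hu : DifferentiableAt ℝ u z) (hv : DifferentiableAt ℝ v z)
    (h : ∀ᶠ ζ in 𝓝 z, u ζ * v ζ = 1) : dbar j v z = - dbar j u z * v z ^ 2 := by
  have h1 : dbar j (fun ζ => u ζ * v ζ) z = 0 := by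
    rw [dbar_congr (v := fun _ => 1) j h, dbar_const]
  rw [dbar_mul j hu hv] at h1
  have h2 := h.self_of_nhds
  linear_combination v z * h1 - dbar j v z * h2

theorem dbar_inv (hu : DifferentiableAt ℝ u z) (h0 : u z ≠ 0) :
    dbar j (fun ζ => (u ζ)⁻¹) z = - dbar j u z * (u z)⁻¹ ^ 2 :=
  dbar_of_mul_eq_one j hu (hu.inv h0)
    ((hu.continuousAt.eventually_ne h0).mono fun _ => mul_inv_cancel₀)

theorem dbar_of_differentiableAt (hu : DifferentiableAt ℂ u z) : dbar j u z = 0 := by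
  have h : (Pi.single j Complex.I : Fin 2 → ℂ) = Complex.I • Pi.single j (1 : ℂ) := by
    rw [← Pi.single_smul, smul_eq_mul, mul_one]
  rw [dbar, hu.fderiv_restrictScalars ℝ, ContinuousLinearMap.coe_restrictScalars', h, map_smul,
    smul_eq_mul, ← mul_assoc, Complex.I_mul_I]
  ring

theorem dbar_pow_eq_zero (hu : DifferentiableAt ℝ u z) (h : dbar j u z = 0) (m : ℕ) :
    dbar j (fun ζ => u ζ ^ m) z = 0 := by
  induction m with
  | zero => simpa using dbar_const j 1
  | succ m ih => simp only [pow_succ]; rw [dbar_mul j (hu.fun_pow m) hu, ih, h]; ring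

theorem dbar_conj_coord (k : Fin 2) (w : Fin 2 → ℂ) :
    dbar j (fun ζ => conj (ζ k - w k)) z = if j = k then 1 else 0 := by
  have h : HasFDerivAt (fun ζ : Fin 2 → ℂ => conj (ζ k - w k))
      ((Complex.conjCLE : ℂ →L[ℝ] ℂ).comp (ContinuousLinearMap.proj k)) z :=
    (Complex.conjCLE : ℂ →L[ℝ] ℂ).hasFDerivAt.comp z
      (((ContinuousLinearMap.proj (R := ℝ) (φ := fun _ : Fin 2 => ℂ) k).hasFDerivAt).sub_const (w k))
  rw [dbar, h.fderiv]
  by_cases hjk : j = k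
  · subst hjk; simp; norm_num
  · simp [hjk, Ne.symm hjk]

theorem ContDiff.dbar (hu : ContDiff ℝ ∞ u) : ContDiff ℝ ∞ (dbar j u) := by
  have h : ContDiff ℝ ∞ (fderiv ℝ u) := hu.fderiv_right (by simp)
  exact contDiff_const.mul ((h.clm_apply contDiff_const).add
    (contDiff_const.mul (h.clm_apply contDiff_const)))

theorem ContDiff.continuous_dbar (hu : ContDiff ℝ 1 u) : Continuous (_root_.dbar j u) := by
  have h : Continuous (fderiv ℝ u) := hu.continuous_fderiv one_ne_zero
  exact continuous_const.mul ((h.clm_apply continuous_const).add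
    (continuous_const.mul (h.clm_apply continuous_const)))

theorem dbar_eq_zero_of_notMem (h : z ∉ tsupport u) : dbar j u z = 0 := by
  rw [dbar_congr (v := fun _ => 0) j, dbar_const]
  rw [notMem_tsupport_iff_eventuallyEq] at h
  exact h

theorem tsupport_dbar_subset : tsupport (dbar j u) ⊆ tsupport u :=
  closure_minimal (fun _ hz => by_contra fun h => hz (dbar_eq_zero_of_notMem j h))
    (isClosed_tsupport u)

theorem dbar_comm (hu : ContDiff ℝ ∞ u) : dbar 0 (dbar 1 u) z = dbar 1 (dbar 0 u) z := by
  have h : ContDiff ℝ ∞ (fderiv ℝ u) := hu.fderiv_right (by simp)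
  have hd : DifferentiableAt ℝ (fderiv ℝ u) z := h.differentiable (by simp) z
  have hs : IsSymmSndFDerivAt ℝ u z := by
    refine hu.contDiffAt.isSymmSndFDerivAt ?_
    rw [minSmoothness_of_isRCLikeNormedField]
    exact WithTop.coe_le_coe.2 (le_top : (2 : ℕ∞) ≤ ⊤)
  have key : ∀ i k : Fin 2, dbar i (dbar k u) z = 4⁻¹ *
      (fderiv ℝ (fderiv ℝ u) z (Pi.single i 1) (Pi.single k 1) +
        Complex.I * fderiv ℝ (fderiv ℝ u) z (Pi.single i 1) (Pi.single k Complex.I) +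
        Complex.I * (fderiv ℝ (fderiv ℝ u) z (Pi.single i Complex.I) (Pi.single k 1) +
        Complex.I * fderiv ℝ (fderiv ℝ u) z (Pi.single i Complex.I) (Pi.single k Complex.I))) := by
    intro i k
    have e : HasFDerivAt (dbar k u) ((2⁻¹ : ℂ) • ((fderiv ℝ (fderiv ℝ u) z).flip (Pi.single k 1) +
        Complex.I • (fderiv ℝ (fderiv ℝ u) z).flip (Pi.single k Complex.I))) z := by
      have h1 : ∀ w, HasFDerivAt (fun ζ => fderiv ℝ u ζ w) ((fderiv ℝ (fderiv ℝ u) z).flip w) z := by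
        intro w
        have := hd.hasFDerivAt.clm_apply (hasFDerivAt_const w z)
        simpa using this
      exact ((h1 _).add ((h1 _).const_mul _)).const_mul _
    rw [dbar, e.fderiv]
    simp only [add_apply, smul_apply, ContinuousLinearMap.flip_apply, smul_eq_mul]
    ring
  rw [key, key, hs.eq (Pi.single 0 1) (Pi.single 1 1), hs.eq (Pi.single 0 1) (Pi.single 1 Complex.I),
    hs.eq (Pi.single 0 Complex.I) (Pi.single 1 1),
    hs.eq (Pi.single 0 Complex.I) (Pi.single 1 Complex.I)]
  ring

theorem integral_dbar_eq_zero (hu : ContDiff ℝ 1 u) (hc : HasCompactSupport u) :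
    ∫ ζ, dbar j u ζ = 0 := by
  have hcf : HasCompactSupport (fderiv ℝ u) := hc.fderiv ℝ
  have hi : ∀ w, Integrable fun ζ => fderiv ℝ u ζ w := fun w =>
    ((hu.continuous_fderiv one_ne_zero).clm_apply continuous_const).integrable_of_hasCompactSupport
      (hcf.comp_left (g := fun L : (Fin 2 → ℂ) →L[ℝ] ℂ => L w) rfl)
  have h0 : ∀ w, ∫ ζ, fderiv ℝ u ζ w = 0 := by
    intro w
    have := integral_mul_fderiv_eq_neg_fderiv_mul_of_integrable (𝕜 := ℂ)
      (μ := (volume : Measure (Fin 2 → ℂ))) (f := fun _ => (1 : ℂ)) (g := u) (v := w) (by simp) (by simpa using hi w)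
      (by simpa using hu.continuous.integrable_of_hasCompactSupport hc) (by simp)
      (fun x _ => hu.differentiable one_ne_zero x)
    simpa using this
  simp only [dbar]
  rw [integral_const_mul, integral_add (hi _) ((hi _).const_mul _), integral_const_mul, h0, h0]
  simp

end dbar

/-- The squared Euclidean norm on `ℂ²`, as a complex number. -/
def euclSq (a : Fin 2 → ℂ) : ℂ := a 0 * conj (a 0) + a 1 * conj (a 1)

theorem euclSq_eq (a : Fin 2 → ℂ) : euclSq a = ((‖a 0‖ ^ 2 + ‖a 1‖ ^ 2 : ℝ) : ℂ) := by
  simp [euclSq, Complex.mul_conj, Complex.normSq_eq_norm_sq]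

theorem norm_sq_le_euclSq (a : Fin 2 → ℂ) : ‖a‖ ^ 2 ≤ ‖a 0‖ ^ 2 + ‖a 1‖ ^ 2 := by
  have h : ‖a‖ ≤ √(‖a 0‖ ^ 2 + ‖a 1‖ ^ 2) := by
    refine (pi_norm_le_iff_of_nonneg (Real.sqrt_nonneg _)).2 fun i => Real.le_sqrt_of_sq_le ?_
    fin_cases i
    · simp
    · simp
  calc ‖a‖ ^ 2 ≤ √(‖a 0‖ ^ 2 + ‖a 1‖ ^ 2) ^ 2 := by gcongr
    _ = _ := Real.sq_sqrt (by positivity)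

theorem euclSq_ne_zero {a : Fin 2 → ℂ} (h : a ≠ 0) : euclSq a ≠ 0 := by
  rw [euclSq_eq, Complex.ofReal_ne_zero]
  have h1 := norm_sq_le_euclSq a
  have h2 : 0 < ‖a‖ := norm_pos_iff.2 h
  exact (lt_of_lt_of_le (by positivity) h1).ne'

theorem norm_euclSq_add (a : Fin 2 → ℂ) {t : ℝ} (ht : 0 ≤ t) :
    ‖euclSq a + t‖ = ‖a 0‖ ^ 2 + ‖a 1‖ ^ 2 + t := by
  rw [euclSq_eq, ← Complex.ofReal_add, Complex.norm_real, Real.norm_of_nonneg (by positivity)]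

theorem contDiff_coord (k : Fin 2) : ContDiff ℝ ∞ fun ζ : Fin 2 → ℂ => ζ k :=
  contDiff_apply ℝ ℂ k

theorem contDiff_conj_coord_sub (k : Fin 2) (z : Fin 2 → ℂ) :
    ContDiff ℝ ∞ fun ζ : Fin 2 → ℂ => conj (ζ k - z k) :=
  (Complex.conjCLE : ℂ →L[ℝ] ℂ).contDiff.comp ((contDiff_coord k).sub contDiff_const)

theorem contDiff_euclSq_sub (z : Fin 2 → ℂ) : ContDiff ℝ ∞ fun ζ : Fin 2 → ℂ => euclSq (ζ - z) :=
  (((contDiff_coord 0).sub contDiff_const).mul (contDiff_conj_coord_sub 0 z)).add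
    (((contDiff_coord 1).sub contDiff_const).mul (contDiff_conj_coord_sub 1 z))

theorem dbar_coord_sub (j k : Fin 2) (z w : Fin 2 → ℂ) :
    dbar j (fun ζ : Fin 2 → ℂ => ζ k - w k) z = 0 :=
  dbar_of_differentiableAt j (by fun_prop)

theorem dbar_euclSq_sub (j : Fin 2) (z w : Fin 2 → ℂ) :
    dbar j (fun ζ : Fin 2 → ℂ => euclSq (ζ - w)) z = z j - w j := by
  have hd (k : Fin 2) : DifferentiableAt ℝ (fun ζ : Fin 2 → ℂ => ζ k - w k) z := by fun_prop
  have hc (k : Fin 2) : DifferentiableAt ℝ (fun ζ : Fin 2 → ℂ => conj (ζ k - w k)) z :=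
    (contDiff_conj_coord_sub k w).differentiable (by simp) z
  have e : (fun ζ : Fin 2 → ℂ => euclSq (ζ - w)) =
      fun ζ => (ζ 0 - w 0) * conj (ζ 0 - w 0) + (ζ 1 - w 1) * conj (ζ 1 - w 1) := rfl
  rw [e, dbar_add j ((hd 0).fun_mul (hc 0)) ((hd 1).fun_mul (hc 1)), dbar_mul j (hd 0) (hc 0),
    dbar_mul j (hd 1) (hc 1), dbar_conj_coord, dbar_conj_coord, dbar_coord_sub, dbar_coord_sub]
  fin_cases j <;> simp

theorem finrank_real_complexPlane : Module.finrank ℝ (Fin 2 → ℂ) = 4 := by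
  rw [Module.finrank_pi_fintype]
  simp

theorem integrable_bochnerMartinelli_weight :
    Integrable fun b : Fin 2 → ℂ => 2 / (‖b 0‖ ^ 2 + ‖b 1‖ ^ 2 + 1) ^ 3 := by
  have h := integrable_rpow_neg_one_add_norm_sq (E := Fin 2 → ℂ) (μ := volume) (r := 6)
    (by rw [finrank_real_complexPlane]; norm_num)
  refine (h.const_mul 2).mono'
    (Measurable.aestronglyMeasurable (by fun_prop)) (Eventually.of_forall fun b => ?_)
  have hb := norm_sq_le_euclSq b
  rw [Real.norm_of_nonneg (by positivity), div_eq_mul_inv,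
    show (-6 / 2 : ℝ) = -(3 : ℕ) by norm_num, Real.rpow_neg (by positivity), Real.rpow_natCast]
  gcongr 2 * (?_ ^ 3)⁻¹
  linarith

theorem integral_regularized_bochnerMartinelli {Ψ : (Fin 2 → ℂ) → ℂ} (hΨ : ContDiff ℝ 1 Ψ)
    (hc : HasCompactSupport Ψ) (z : Fin 2 → ℂ) {δ : ℝ} (hδ : 0 < δ) :
    ∫ ζ, (conj (ζ 0 - z 0) * dbar 0 Ψ ζ + conj (ζ 1 - z 1) * dbar 1 Ψ ζ) /
      (euclSq (ζ - z) + (δ ^ 2 : ℝ)) ^ 2 =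
    - ∫ ζ, Ψ ζ * (2 * (δ ^ 2 : ℝ) / (euclSq (ζ - z) + (δ ^ 2 : ℝ)) ^ 3) := by
  have hs0 : ∀ ζ, euclSq (ζ - z) + (δ ^ 2 : ℝ) ≠ 0 := fun ζ => by
    rw [← norm_pos_iff, norm_euclSq_add _ (by positivity)]; positivity
  have hs : ContDiff ℝ ∞ fun ζ => euclSq (ζ - z) + ((δ ^ 2 : ℝ) : ℂ) :=
    (contDiff_euclSq_sub z).add contDiff_const
  have hsi : ContDiff ℝ ∞ fun ζ => (euclSq (ζ - z) + ((δ ^ 2 : ℝ) : ℂ))⁻¹ := hs.inv hs0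
  have hk : ∀ k, ContDiff ℝ 1 fun ζ => conj (ζ k - z k) *
      ((euclSq (ζ - z) + ((δ ^ 2 : ℝ) : ℂ))⁻¹) ^ 2 := fun k =>
    ((contDiff_conj_coord_sub k z).mul (hsi.pow 2)).of_le (by simp)
  have hΨd : ∀ ζ, DifferentiableAt ℝ Ψ ζ := hΨ.differentiable one_ne_zero
  have hprod : ∀ k, ContDiff ℝ 1 fun ζ => Ψ ζ * (conj (ζ k - z k) *
      ((euclSq (ζ - z) + ((δ ^ 2 : ℝ) : ℂ))⁻¹) ^ 2) := fun k => hΨ.mul (hk k)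
  have hcp : ∀ k, HasCompactSupport fun ζ => Ψ ζ * (conj (ζ k - z k) *
      ((euclSq (ζ - z) + ((δ ^ 2 : ℝ) : ℂ))⁻¹) ^ 2) := fun k => hc.mul_right
  have hI := fun k => integral_dbar_eq_zero k (hprod k) (hcp k)
  have hint : ∀ k, Integrable (dbar k fun ζ => Ψ ζ * (conj (ζ k - z k) *
      ((euclSq (ζ - z) + ((δ ^ 2 : ℝ) : ℂ))⁻¹) ^ 2)) := fun k =>
    ((hprod k).continuous_dbar k).integrable_of_hasCompactSupport
      ((hcp k).of_isClosed_subset (isClosed_tsupport _) (tsupport_dbar_subset k))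
  have hcdb : ∀ k, HasCompactSupport (dbar k Ψ) := fun k =>
    hc.of_isClosed_subset (isClosed_tsupport _) (tsupport_dbar_subset k)
  have hdk : ∀ k ζ, dbar k (fun ζ => conj (ζ k - z k) *
      ((euclSq (ζ - z) + ((δ ^ 2 : ℝ) : ℂ))⁻¹) ^ 2) ζ =
      ((euclSq (ζ - z) + ((δ ^ 2 : ℝ) : ℂ))⁻¹) ^ 2 - 2 * (ζ k - z k) * conj (ζ k - z k) *
      ((euclSq (ζ - z) + ((δ ^ 2 : ℝ) : ℂ))⁻¹) ^ 3 := by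
    intro k ζ
    have d1 : DifferentiableAt ℝ (fun ζ => conj (ζ k - z k)) ζ :=
      (contDiff_conj_coord_sub k z).differentiable (by simp) ζ
    have d2 : DifferentiableAt ℝ (fun ζ => (euclSq (ζ - z) + ((δ ^ 2 : ℝ) : ℂ))⁻¹) ζ :=
      hsi.differentiable (by simp) ζ
    have d3 : DifferentiableAt ℝ (fun ζ => euclSq (ζ - z)) ζ :=
      (contDiff_euclSq_sub z).differentiable (by simp) ζ
    have d4 : DifferentiableAt ℝ (fun ζ => euclSq (ζ - z) + ((δ ^ 2 : ℝ) : ℂ)) ζ :=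
      hs.differentiable (by simp) ζ
    simp only [pow_two (euclSq _ + _)⁻¹]
    rw [dbar_mul k d1 (d2.fun_mul d2), dbar_mul k d2 d2, dbar_inv k d4 (hs0 ζ),
      dbar_add k d3 (differentiableAt_const _), dbar_const, dbar_euclSq_sub, dbar_conj_coord,
      if_pos rfl]
    ring
  have hpt : ∀ ζ, dbar 0 (fun ζ => Ψ ζ * (conj (ζ 0 - z 0) *
      ((euclSq (ζ - z) + ((δ ^ 2 : ℝ) : ℂ))⁻¹) ^ 2)) ζ + dbar 1 (fun ζ => Ψ ζ * (conj (ζ 1 - z 1) *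
      ((euclSq (ζ - z) + ((δ ^ 2 : ℝ) : ℂ))⁻¹) ^ 2)) ζ =
      (conj (ζ 0 - z 0) * dbar 0 Ψ ζ + conj (ζ 1 - z 1) * dbar 1 Ψ ζ) /
      (euclSq (ζ - z) + (δ ^ 2 : ℝ)) ^ 2 +
      Ψ ζ * (2 * (δ ^ 2 : ℝ) / (euclSq (ζ - z) + (δ ^ 2 : ℝ)) ^ 3) := by
    intro ζ
    rw [dbar_mul 0 (hΨd ζ) ((hk 0).differentiable one_ne_zero ζ),
      dbar_mul 1 (hΨd ζ) ((hk 1).differentiable one_ne_zero ζ), hdk, hdk]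
    have e : euclSq (ζ - z) = (ζ 0 - z 0) * conj (ζ 0 - z 0) + (ζ 1 - z 1) * conj (ζ 1 - z 1) := rfl
    have h0 := hs0 ζ
    have e2 : ((δ ^ 2 : ℝ) : ℂ) = (euclSq (ζ - z) + (δ ^ 2 : ℝ)) -
      ((ζ 0 - z 0) * conj (ζ 0 - z 0) + (ζ 1 - z 1) * conj (ζ 1 - z 1)) := by rw [← e]; ring
    generalize euclSq (ζ - z) + ((δ ^ 2 : ℝ) : ℂ) = s at *
    rw [e2]
    field_simp
    ring
  have hcont1 : Continuous fun ζ => (conj (ζ 0 - z 0) * dbar 0 Ψ ζ + conj (ζ 1 - z 1) * dbar 1 Ψ ζ) /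
      (euclSq (ζ - z) + (δ ^ 2 : ℝ)) ^ 2 :=
    (((contDiff_conj_coord_sub 0 z).continuous.mul (hΨ.continuous_dbar 0)).add
      ((contDiff_conj_coord_sub 1 z).continuous.mul (hΨ.continuous_dbar 1))).div
      (hs.continuous.pow 2) fun ζ => pow_ne_zero _ (hs0 ζ)
  have hcs1 : HasCompactSupport fun ζ => (conj (ζ 0 - z 0) * dbar 0 Ψ ζ +
      conj (ζ 1 - z 1) * dbar 1 Ψ ζ) / (euclSq (ζ - z) + (δ ^ 2 : ℝ)) ^ 2 := by
    simp only [div_eq_mul_inv]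
    exact ((hcdb 0).mul_left.add (hcdb 1).mul_left).mul_right
  have hcont2 : Continuous fun ζ => Ψ ζ * (2 * (δ ^ 2 : ℝ) / (euclSq (ζ - z) + (δ ^ 2 : ℝ)) ^ 3) :=
    hΨ.continuous.mul (continuous_const.div (hs.continuous.pow 3) fun ζ => pow_ne_zero _ (hs0 ζ))
  rw [eq_neg_iff_add_eq_zero, ← integral_add (hcont1.integrable_of_hasCompactSupport hcs1)
    (hcont2.integrable_of_hasCompactSupport hc.mul_right), ← integral_congr_ae
    (Eventually.of_forall hpt), integral_add (hint 0) (hint 1), hI, hI, add_zero]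

theorem integral_rescaled_weight (Ψ : (Fin 2 → ℂ) → ℂ) (z : Fin 2 → ℂ) {δ : ℝ} (hδ : 0 < δ) :
    ∫ ζ, Ψ ζ * (2 * (δ ^ 2 : ℝ) / (euclSq (ζ - z) + (δ ^ 2 : ℝ)) ^ 3) =
    ∫ b : Fin 2 → ℂ, Ψ (δ • b + z) * ((2 / (‖b 0‖ ^ 2 + ‖b 1‖ ^ 2 + 1) ^ 3 : ℝ) : ℂ) := by
  rw [← integral_add_right_eq_self _ z]
  have h := Measure.integral_comp_smul (volume : Measure (Fin 2 → ℂ)) (fun a => Ψ (a + z) *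
    (2 * (δ ^ 2 : ℝ) / (euclSq (a + z - z) + (δ ^ 2 : ℝ)) ^ 3)) δ
  rw [finrank_real_complexPlane, abs_of_pos (by positivity)] at h
  refine smul_right_injective ℂ (r := (δ ^ 4)⁻¹) (by positivity) ?_
  beta_reduce
  rw [← h, ← integral_smul]
  congr 1 with b
  have e : euclSq (δ • b + z - z) + ((δ ^ 2 : ℝ) : ℂ) =
      (δ : ℂ) ^ 2 * ((‖b 0‖ ^ 2 + ‖b 1‖ ^ 2 + 1 : ℝ) : ℂ) := by
    rw [add_sub_cancel_right, euclSq_eq]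
    simp [mul_pow]
    ring
  have h1 : ((‖b 0‖ ^ 2 + ‖b 1‖ ^ 2 + 1 : ℝ) : ℂ) ≠ 0 := by
    rw [Complex.ofReal_ne_zero]; positivity
  have h2 : (δ : ℂ) ≠ 0 := by simpa using hδ.ne'
  rw [e, Complex.real_smul]
  push_cast at h1 ⊢
  field_simp

theorem exists_bochnerMartinelli : ∃ c : ℝ, 0 < c ∧ ∀ Ψ : (Fin 2 → ℂ) → ℂ, ContDiff ℝ 1 Ψ →
    HasCompactSupport Ψ → ∀ z, (∀ j, ∀ᶠ ζ in 𝓝 z, dbar j Ψ ζ = 0) →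
    ∫ ζ, (conj (ζ 0 - z 0) * dbar 0 Ψ ζ + conj (ζ 1 - z 1) * dbar 1 Ψ ζ) / euclSq (ζ - z) ^ 2 =
      - (c * Ψ z) := by
  have hw := integrable_bochnerMartinelli_weight
  refine ⟨∫ b : Fin 2 → ℂ, 2 / (‖b 0‖ ^ 2 + ‖b 1‖ ^ 2 + 1) ^ 3, ?_, fun Ψ hΨ hc z hz => ?_⟩
  · rw [integral_pos_iff_support_of_nonneg (fun b => by positivity) hw]
    have : Function.support (fun b : Fin 2 → ℂ => 2 / (‖b 0‖ ^ 2 + ‖b 1‖ ^ 2 + 1) ^ 3) = univ :=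
      eq_univ_of_forall fun b => (by positivity : (0 : ℝ) < 2 / (‖b 0‖ ^ 2 + ‖b 1‖ ^ 2 + 1) ^ 3).ne'
    rw [this]
    exact isOpen_univ.measure_pos _ univ_nonempty
  let num : (Fin 2 → ℂ) → ℂ := fun ζ =>
    conj (ζ 0 - z 0) * dbar 0 Ψ ζ + conj (ζ 1 - z 1) * dbar 1 Ψ ζ
  have hnum : Continuous num :=
    ((contDiff_conj_coord_sub 0 z).continuous.mul (hΨ.continuous_dbar 0)).add
      ((contDiff_conj_coord_sub 1 z).continuous.mul (hΨ.continuous_dbar 1))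
  have hnum0 : ∀ᶠ ζ in 𝓝 z, num ζ = 0 := by
    filter_upwards [hz 0, hz 1] with ζ h0 h1
    simp [num, h0, h1]
  have hnumc : HasCompactSupport num := by
    have hcdb : ∀ k, HasCompactSupport (dbar k Ψ) := fun k =>
      hc.of_isClosed_subset (isClosed_tsupport _) (tsupport_dbar_subset k)
    exact (hcdb 0).mul_left.add (hcdb 1).mul_left
  have hsq : Continuous fun ζ => euclSq (ζ - z) := (contDiff_euclSq_sub z).continuous
  have hG : Continuous fun ζ => num ζ / euclSq (ζ - z) ^ 2 := by
    rw [continuous_iff_continuousAt]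
    intro ζ
    by_cases h : ζ = z
    · subst h
      refine (continuousAt_const (y := (0 : ℂ))).congr ?_
      filter_upwards [hnum0] with w hw
      rw [hw, zero_div]
    · exact hnum.continuousAt.div (hsq.continuousAt.pow 2)
        (pow_ne_zero _ (euclSq_ne_zero (sub_ne_zero.2 h)))
  have hGi : Integrable fun ζ => num ζ / euclSq (ζ - z) ^ 2 := by
    refine hG.integrable_of_hasCompactSupport ?_
    simp only [div_eq_mul_inv]
    exact hnumc.mul_right
  have hid : Tendsto (fun δ : ℝ => δ) (𝓝[>] 0) (𝓝 0) := tendsto_nhdsWithin_of_tendsto_nhds tendsto_id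
  have hsqid : Tendsto (fun δ : ℝ => ((δ ^ 2 : ℝ) : ℂ)) (𝓝[>] 0) (𝓝 0) := by
    have : Tendsto (fun δ : ℝ => ((δ ^ 2 : ℝ) : ℂ)) (𝓝 0) (𝓝 (((0 : ℝ) ^ 2 : ℝ) : ℂ)) :=
      Continuous.tendsto (by fun_prop) 0
    rw [zero_pow two_ne_zero, Complex.ofReal_zero] at this
    exact this.comp hid
  have hL : Tendsto (fun δ : ℝ => ∫ ζ, num ζ / (euclSq (ζ - z) + (δ ^ 2 : ℝ)) ^ 2) (𝓝[>] 0)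
      (𝓝 (∫ ζ, num ζ / euclSq (ζ - z) ^ 2)) := by
    refine tendsto_integral_filter_of_dominated_convergence
      (fun ζ => ‖num ζ / euclSq (ζ - z) ^ 2‖) (Eventually.of_forall fun δ => ?_)
      (Eventually.of_forall fun δ => Eventually.of_forall fun ζ => ?_) hGi.norm
      (Eventually.of_forall fun ζ => ?_)
    · exact (hnum.measurable.div ((hsq.measurable.add_const _).pow_const 2)).aestronglyMeasurable
    · by_cases h : ζ = z
      · rw [h, hnum0.self_of_nhds]; simp
      · have h0 := norm_pos_iff.2 (euclSq_ne_zero (sub_ne_zero.2 h))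
        rw [norm_div, norm_div, norm_pow, norm_pow]
        refine div_le_div_of_nonneg_left (norm_nonneg _) (by positivity) ?_
        gcongr
        have h1 := norm_euclSq_add (ζ - z) le_rfl
        rw [norm_euclSq_add _ (sq_nonneg δ)]
        rw [Complex.ofReal_zero, add_zero] at h1
        nlinarith [sq_nonneg δ]
    · by_cases h : ζ = z
      · rw [h, hnum0.self_of_nhds]; simp
      · have h0 := euclSq_ne_zero (sub_ne_zero.2 h)
        refine tendsto_const_nhds.div ?_ (pow_ne_zero _ h0)
        have := (tendsto_const_nhds (x := euclSq (ζ - z))).add hsqid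
        rw [add_zero] at this
        exact this.pow 2
  obtain ⟨B, hB⟩ := hc.exists_bound_of_continuous hΨ.continuous
  have hR : Tendsto (fun δ : ℝ => ∫ b : Fin 2 → ℂ, Ψ (δ • b + z) *
      ((2 / (‖b 0‖ ^ 2 + ‖b 1‖ ^ 2 + 1) ^ 3 : ℝ) : ℂ)) (𝓝[>] 0)
      (𝓝 (∫ b : Fin 2 → ℂ, Ψ z * ((2 / (‖b 0‖ ^ 2 + ‖b 1‖ ^ 2 + 1) ^ 3 : ℝ) : ℂ))) := by
    refine tendsto_integral_filter_of_dominated_convergence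
      (fun b => B * (2 / (‖b 0‖ ^ 2 + ‖b 1‖ ^ 2 + 1) ^ 3)) (Eventually.of_forall fun δ => ?_)
      (Eventually.of_forall fun δ => Eventually.of_forall fun ζ => ?_) (hw.const_mul B)
      (Eventually.of_forall fun b => ?_)
    · exact (Measurable.mul (hΨ.continuous.measurable.comp (by fun_prop))
        (by fun_prop)).aestronglyMeasurable
    · rw [norm_mul, Complex.norm_real, Real.norm_of_nonneg (by positivity)]
      gcongr
      exact hB _
    · refine Tendsto.mul_const _ ((hΨ.continuous.tendsto z).comp ?_)
      have := (hid.smul_const b).add_const z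
      simpa using this
  have heq := tendsto_nhds_unique (hL.congr' (by
    filter_upwards [self_mem_nhdsWithin] with δ hδ
    rw [integral_regularized_bochnerMartinelli hΨ hc z hδ, integral_rescaled_weight Ψ z hδ])) hR.neg
  rw [heq, integral_const_mul, integral_complex_ofReal, mul_comm]

/-- The pairing `(ζ₀ - z₀) N₀ + (ζ₁ - z₁) N₁`. -/
def lerayDenom (N : Fin 2 → (Fin 2 → ℂ) → ℂ) (z ζ : Fin 2 → ℂ) : ℂ :=
  (ζ 0 - z 0) * N 0 ζ + (ζ 1 - z 1) * N 1 ζ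

/-- The coefficients of the Cauchy–Leray kernel attached to the section `N`. -/
def lerayKernel (N : Fin 2 → (Fin 2 → ℂ) → ℂ) (k : Fin 2) (z ζ : Fin 2 → ℂ) : ℂ :=
  (N 0 ζ * dbar k (N 1) ζ - N 1 ζ * dbar k (N 0) ζ) / lerayDenom N z ζ ^ 2

/-- The function whose `∂̄` is the difference of the Cauchy–Leray and Bochner–Martinelli kernels. -/
def lerayTransgression (N : Fin 2 → (Fin 2 → ℂ) → ℂ) (z ζ : Fin 2 → ℂ) : ℂ :=
  (conj (ζ 0 - z 0) * N 1 ζ - conj (ζ 1 - z 1) * N 0 ζ) / (euclSq (ζ - z) * lerayDenom N z ζ)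

section kernels

variable {N : Fin 2 → (Fin 2 → ℂ) → ℂ} {z ζ : Fin 2 → ℂ}

theorem contDiff_lerayDenom (hN : ∀ j, ContDiff ℝ ∞ (N j)) : ContDiff ℝ ∞ (lerayDenom N z) :=
  (((contDiff_coord 0).sub contDiff_const).mul (hN 0)).add
    (((contDiff_coord 1).sub contDiff_const).mul (hN 1))

theorem contDiffAt_lerayTransgression (hN : ∀ j, ContDiff ℝ ∞ (N j)) (hz : ζ ≠ z)
    (hD : lerayDenom N z ζ ≠ 0) : ContDiffAt ℝ ∞ (lerayTransgression N z) ζ := by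
  have h : lerayTransgression N z = fun ζ =>
      (conj (ζ 0 - z 0) * N 1 ζ - conj (ζ 1 - z 1) * N 0 ζ) *
        (euclSq (ζ - z) * lerayDenom N z ζ)⁻¹ := by
    funext ζ; exact div_eq_mul_inv _ _
  rw [h]
  exact (((contDiff_conj_coord_sub 0 z).mul (hN 1)).sub
    ((contDiff_conj_coord_sub 1 z).mul (hN 0))).contDiffAt.mul
    (((contDiff_euclSq_sub z).mul (contDiff_lerayDenom hN)).contDiffAt.inv
      (mul_ne_zero (euclSq_ne_zero (sub_ne_zero.2 hz)) hD))

theorem continuousAt_lerayKernel (hN : ∀ j, ContDiff ℝ ∞ (N j)) (k : Fin 2)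
    (hD : lerayDenom N z ζ ≠ 0) : ContinuousAt (lerayKernel N k z) ζ :=
  ((((hN 0).mul ((hN 1).dbar k)).sub ((hN 1).mul ((hN 0).dbar k))).continuous.continuousAt).div
    ((contDiff_lerayDenom hN).continuous.continuousAt.pow 2) (pow_ne_zero _ hD)

theorem dbar_lerayTransgression (hN : ∀ j, ContDiff ℝ ∞ (N j)) (hz : ζ ≠ z)
    (hD : lerayDenom N z ζ ≠ 0) :
    dbar 0 (lerayTransgression N z) ζ =
      lerayKernel N 0 z ζ + conj (ζ 1 - z 1) / euclSq (ζ - z) ^ 2 ∧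
    dbar 1 (lerayTransgression N z) ζ =
      lerayKernel N 1 z ζ - conj (ζ 0 - z 0) / euclSq (ζ - z) ^ 2 := by
  have hs : euclSq (ζ - z) ≠ 0 := euclSq_ne_zero (sub_ne_zero.2 hz)
  have dN (k : Fin 2) : DifferentiableAt ℝ (N k) ζ := (hN k).differentiable (by simp) ζ
  have da (k : Fin 2) : DifferentiableAt ℝ (fun ζ : Fin 2 → ℂ => ζ k - z k) ζ := by fun_prop
  have dc (k : Fin 2) : DifferentiableAt ℝ (fun ζ : Fin 2 → ℂ => conj (ζ k - z k)) ζ :=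
    (contDiff_conj_coord_sub k z).differentiable (by simp) ζ
  have ds : DifferentiableAt ℝ (fun ζ => euclSq (ζ - z)) ζ :=
    (contDiff_euclSq_sub z).differentiable (by simp) ζ
  have dD : DifferentiableAt ℝ (lerayDenom N z) ζ :=
    (contDiff_lerayDenom hN).differentiable (by simp) ζ
  have eD : ∀ k, dbar k (lerayDenom N z) ζ =
      (ζ 0 - z 0) * dbar k (N 0) ζ + (ζ 1 - z 1) * dbar k (N 1) ζ := fun k => by
    change dbar k (fun ζ => (ζ 0 - z 0) * N 0 ζ + (ζ 1 - z 1) * N 1 ζ) ζ = _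
    rw [dbar_add k ((da 0).fun_mul (dN 0)) ((da 1).fun_mul (dN 1)), dbar_mul k (da 0) (dN 0),
      dbar_mul k (da 1) (dN 1), dbar_coord_sub, dbar_coord_sub]
    ring
  have key : ∀ k, dbar k (lerayTransgression N z) ζ =
      ((if k = 0 then 1 else 0) * N 1 ζ + conj (ζ 0 - z 0) * dbar k (N 1) ζ -
        ((if k = 1 then 1 else 0) * N 0 ζ + conj (ζ 1 - z 1) * dbar k (N 0) ζ)) *
        (euclSq (ζ - z) * lerayDenom N z ζ)⁻¹ +
      (conj (ζ 0 - z 0) * N 1 ζ - conj (ζ 1 - z 1) * N 0 ζ) *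
      (-((ζ k - z k) * lerayDenom N z ζ + euclSq (ζ - z) * ((ζ 0 - z 0) * dbar k (N 0) ζ +
        (ζ 1 - z 1) * dbar k (N 1) ζ)) * (euclSq (ζ - z) * lerayDenom N z ζ)⁻¹ ^ 2) := fun k => by
    have e : lerayTransgression N z = fun ζ =>
      (conj (ζ 0 - z 0) * N 1 ζ - conj (ζ 1 - z 1) * N 0 ζ) *
        (euclSq (ζ - z) * lerayDenom N z ζ)⁻¹ := by
      funext ζ; exact div_eq_mul_inv _ _
    rw [e, dbar_mul k (((dc 0).fun_mul (dN 1)).fun_sub ((dc 1).fun_mul (dN 0)))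
        ((ds.fun_mul dD).fun_inv (mul_ne_zero hs hD)),
      dbar_sub k ((dc 0).fun_mul (dN 1)) ((dc 1).fun_mul (dN 0)), dbar_mul k (dc 0) (dN 1),
      dbar_mul k (dc 1) (dN 0), dbar_inv k (ds.fun_mul dD) (mul_ne_zero hs hD), dbar_mul k ds dD,
      eD, dbar_euclSq_sub, dbar_conj_coord, dbar_conj_coord]
  have e1 : euclSq (ζ - z) = (ζ 0 - z 0) * conj (ζ 0 - z 0) + (ζ 1 - z 1) * conj (ζ 1 - z 1) := rfl
  have e2 : lerayDenom N z ζ = (ζ 0 - z 0) * N 0 ζ + (ζ 1 - z 1) * N 1 ζ := rfl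
  rw [key, key, lerayKernel, lerayKernel]
  generalize lerayDenom N z ζ = D at *
  generalize euclSq (ζ - z) = s at *
  generalize conj (ζ 0 - z 0) = b0 at *
  generalize conj (ζ 1 - z 1) = b1 at *
  generalize ζ 0 - z 0 = a0 at *
  generalize ζ 1 - z 1 = a1 at *
  constructor
  · field_simp
    simp only [if_true, zero_ne_one, if_false, zero_mul, zero_add, one_mul]
    rw [e1, e2]
    ring
  · field_simp
    simp only [if_true, one_ne_zero, if_false, zero_mul, zero_add, one_mul]
    rw [e1, e2]
    ring

end kernels

theorem continuous_mul_of_continuousAt {Y : Type*} [TopologicalSpace Y] {s k : Y → ℂ} {T : Set Y}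
    (hT : IsClosed T) (hs : Continuous s) (h0 : ∀ y, y ∉ T → s y = 0)
    (hk : ∀ y ∈ T, ContinuousAt k y) : Continuous fun y => s y * k y := by
  rw [continuous_iff_continuousAt]
  intro y
  by_cases hy : y ∈ T
  · exact hs.continuousAt.mul (hk y hy)
  · refine (continuousAt_const (y := (0 : ℂ))).congr ?_
    filter_upwards [hT.isOpen_compl.mem_nhds hy] with w hw
    rw [h0 w hw, zero_mul]

theorem contDiff_mul_of_contDiffAt {s k : (Fin 2 → ℂ) → ℂ} {T : Set (Fin 2 → ℂ)}
    (hT : IsClosed T) (hs : ContDiff ℝ ∞ s) (h0 : ∀ y, y ∉ T → s y = 0)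
    (hk : ∀ y ∈ T, ContDiffAt ℝ ∞ k y) : ContDiff ℝ ∞ fun y => s y * k y := by
  rw [contDiff_iff_contDiffAt]
  intro y
  by_cases hy : y ∈ T
  · exact hs.contDiffAt.mul (hk y hy)
  · refine (contDiffAt_const (c := (0 : ℂ))).congr_of_eventuallyEq ?_
    filter_upwards [hT.isOpen_compl.mem_nhds hy] with w hw
    rw [h0 w hw, zero_mul]

/-- The normalizing constant of the Bochner–Martinelli formula in `ℂ²`. -/
def bochnerMartinelliConst : ℝ := exists_bochnerMartinelli.choose

theorem bochnerMartinelliConst_pos : 0 < bochnerMartinelliConst :=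
  exists_bochnerMartinelli.choose_spec.1

theorem leray_representation {χ η F : (Fin 2 → ℂ) → ℂ} {N : Fin 2 → (Fin 2 → ℂ) → ℂ}
    {z : Fin 2 → ℂ} (hχ : ContDiff ℝ ∞ χ) (hχc : HasCompactSupport χ) (hη : ContDiff ℝ ∞ η)
    (hF : ContDiff ℝ ∞ F) (hF0 : ∀ j, ∀ ζ ∈ tsupport χ, ζ ∈ tsupport η → dbar j F ζ = 0)
    (hχz : ∀ j, z ∉ tsupport (dbar j χ)) (hηz : ∀ j, z ∉ tsupport (dbar j η))
    (hN : ∀ j, ContDiff ℝ ∞ (N j))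
    (hD : ∀ j, ∀ ζ ∈ tsupport (dbar j χ), lerayDenom N z ζ ≠ 0) (hz : χ z = 1) :
    -(bochnerMartinelliConst * (η z * F z)) =
      (∫ ζ, F ζ * η ζ * (dbar 0 χ ζ * lerayKernel N 1 z ζ - dbar 1 χ ζ * lerayKernel N 0 z ζ)) +
      (∫ ζ, F ζ * (dbar 0 χ ζ * (dbar 1 η ζ * lerayTransgression N z ζ) -
        dbar 1 χ ζ * (dbar 0 η ζ * lerayTransgression N z ζ))) +
      ∫ ζ, F ζ * (dbar 0 η ζ * (χ ζ * conj (ζ 0 - z 0) / euclSq (ζ - z) ^ 2) +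
        dbar 1 η ζ * (χ ζ * conj (ζ 1 - z 1) / euclSq (ζ - z) ^ 2)) := by
  have hχd (ζ) : DifferentiableAt ℝ χ ζ := hχ.differentiable (by simp) ζ
  have hηd (ζ) : DifferentiableAt ℝ η ζ := hη.differentiable (by simp) ζ
  have hFd (ζ) : DifferentiableAt ℝ F ζ := hF.differentiable (by simp) ζ
  have hne (j) {ζ} (h : ζ ∈ tsupport (dbar j χ)) : ζ ≠ z := fun e => hχz j (e ▸ h)
  have hneη (j) {ζ} (h : ζ ∈ tsupport (dbar j η)) : ζ ≠ z := fun e => hηz j (e ▸ h)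
  have hcs (j) : HasCompactSupport (dbar j χ) :=
    hχc.of_isClosed_subset (isClosed_tsupport _) (tsupport_dbar_subset j)
  have hT0 (j) (ζ) (h : ζ ∉ tsupport (dbar j χ)) : dbar j χ ζ = 0 := image_eq_zero_of_notMem_tsupport h
  -- The form `χ η F` reproduces its value at `z`.
  have hΨ : ContDiff ℝ ∞ fun ζ => χ ζ * (η ζ * F ζ) := hχ.mul (hη.mul hF)
  have hdΨ (j) (ζ) : dbar j (fun ζ => χ ζ * (η ζ * F ζ)) ζ =
      F ζ * (η ζ * dbar j χ ζ + χ ζ * dbar j η ζ) := by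
    rw [dbar_mul j (hχd ζ) ((hηd ζ).fun_mul (hFd ζ)), dbar_mul j (hηd ζ) (hFd ζ)]
    by_cases h1 : ζ ∈ tsupport χ
    · by_cases h2 : ζ ∈ tsupport η
      · rw [hF0 j ζ h1 h2]; ring
      · rw [image_eq_zero_of_notMem_tsupport h2, dbar_eq_zero_of_notMem j h2]; ring
    · rw [image_eq_zero_of_notMem_tsupport h1, dbar_eq_zero_of_notMem j h1]; ring
  have hBM := exists_bochnerMartinelli.choose_spec.2 (fun ζ => χ ζ * (η ζ * F ζ))
    (hΨ.of_le (by simp)) hχc.mul_right z (fun j => by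
      filter_upwards [(isClosed_tsupport _).isOpen_compl.mem_nhds (hχz j),
        (isClosed_tsupport _).isOpen_compl.mem_nhds (hηz j)] with ζ h1 h2
      rw [hdΨ, image_eq_zero_of_notMem_tsupport h1, image_eq_zero_of_notMem_tsupport h2]
      ring)
  -- The exact part.
  have hexact (k) : ContDiff ℝ ∞ fun ζ => F ζ * η ζ * dbar k χ ζ * lerayTransgression N z ζ := by
    refine contDiff_mul_of_contDiffAt (isClosed_tsupport (dbar k χ)) ((hF.mul hη).mul (hχ.dbar k))
      (fun y hy => by rw [hT0 k y hy, mul_zero])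
      fun y hy => contDiffAt_lerayTransgression hN (hne k hy) (hD k y hy)
  have hexc (k) : HasCompactSupport fun ζ => F ζ * η ζ * dbar k χ ζ * lerayTransgression N z ζ :=
    ((hcs k).mul_left).mul_right
  have hexI (j k) : Integrable (dbar j fun ζ => F ζ * η ζ * dbar k χ ζ * lerayTransgression N z ζ) :=
    (((hexact k).dbar j).continuous).integrable_of_hasCompactSupport
      ((hexc k).of_isClosed_subset (isClosed_tsupport _) (tsupport_dbar_subset j))
  have hex0 (j k) : ∫ ζ, dbar j (fun ζ => F ζ * η ζ * dbar k χ ζ * lerayTransgression N z ζ) ζ = 0 :=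
    integral_dbar_eq_zero j ((hexact k).of_le (by simp)) (hexc k)
  have hexd (j k) (ζ) (hζ : ζ ∈ tsupport (dbar k χ)) :
      dbar j (fun ζ => F ζ * η ζ * dbar k χ ζ * lerayTransgression N z ζ) ζ =
      F ζ * (dbar j η ζ * dbar k χ ζ + η ζ * dbar j (dbar k χ) ζ) * lerayTransgression N z ζ +
      F ζ * η ζ * dbar k χ ζ * dbar j (lerayTransgression N z) ζ := by
    have hu : DifferentiableAt ℝ (lerayTransgression N z) ζ :=
      (contDiffAt_lerayTransgression hN (hne k hζ) (hD k ζ hζ)).differentiableAt (by simp)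
    have hk : DifferentiableAt ℝ (dbar k χ) ζ := (hχ.dbar k).differentiable (by simp) ζ
    rw [dbar_mul j (((hFd ζ).fun_mul (hηd ζ)).fun_mul hk) hu,
      dbar_mul j ((hFd ζ).fun_mul (hηd ζ)) hk, dbar_mul j (hFd ζ) (hηd ζ)]
    by_cases h2 : ζ ∈ tsupport η
    · rw [hF0 j ζ (tsupport_dbar_subset k hζ) h2]; ring
    · rw [image_eq_zero_of_notMem_tsupport h2, dbar_eq_zero_of_notMem j h2]; ring
  -- Continuity of the three kernels.
  have c1 : Continuous fun ζ =>
      F ζ * η ζ * (dbar 0 χ ζ * lerayKernel N 1 z ζ - dbar 1 χ ζ * lerayKernel N 0 z ζ) :=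
    (hF.continuous.mul hη.continuous).mul
      ((continuous_mul_of_continuousAt (isClosed_tsupport _) (hχ.dbar 0).continuous (hT0 0)
        fun y hy => continuousAt_lerayKernel hN 1 (hD 0 y hy)).sub
      (continuous_mul_of_continuousAt (isClosed_tsupport _) (hχ.dbar 1).continuous (hT0 1)
        fun y hy => continuousAt_lerayKernel hN 0 (hD 1 y hy)))
  have c2 : Continuous fun ζ => F ζ * (dbar 0 χ ζ * (dbar 1 η ζ * lerayTransgression N z ζ) -
        dbar 1 χ ζ * (dbar 0 η ζ * lerayTransgression N z ζ)) :=
    hF.continuous.mul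
      ((continuous_mul_of_continuousAt (isClosed_tsupport _) (hχ.dbar 0).continuous (hT0 0)
        fun y hy => (hη.dbar 1).continuous.continuousAt.mul
          (contDiffAt_lerayTransgression hN (hne 0 hy) (hD 0 y hy)).continuousAt).sub
      (continuous_mul_of_continuousAt (isClosed_tsupport _) (hχ.dbar 1).continuous (hT0 1)
        fun y hy => (hη.dbar 0).continuous.continuousAt.mul
          (contDiffAt_lerayTransgression hN (hne 1 hy) (hD 1 y hy)).continuousAt))
  have cBM (j k) : Continuous fun ζ => dbar j η ζ * (χ ζ * conj (ζ k - z k) / euclSq (ζ - z) ^ 2) :=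
    continuous_mul_of_continuousAt (isClosed_tsupport (dbar j η)) (hη.dbar j).continuous
      (fun y hy => image_eq_zero_of_notMem_tsupport hy) fun y hy =>
      (hχ.continuous.mul (contDiff_conj_coord_sub k z).continuous).continuousAt.div
        ((contDiff_euclSq_sub z).continuous.continuousAt.pow 2)
        (pow_ne_zero _ (euclSq_ne_zero (sub_ne_zero.2 (hneη j hy))))
  have i1 := c1.integrable_of_hasCompactSupport (μ := volume) (((hcs 0).mul_right.sub (hcs 1).mul_right).mul_left)
  have i2 := c2.integrable_of_hasCompactSupport (μ := volume) (((hcs 0).mul_right.sub (hcs 1).mul_right).mul_left)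
  have i3 : Integrable fun ζ => F ζ * (dbar 0 η ζ * (χ ζ * conj (ζ 0 - z 0) / euclSq (ζ - z) ^ 2) +
        dbar 1 η ζ * (χ ζ * conj (ζ 1 - z 1) / euclSq (ζ - z) ^ 2)) := by
    refine (hF.continuous.mul ((cBM 0 0).add (cBM 1 1))).integrable_of_hasCompactSupport ?_
    simp only [div_eq_mul_inv]
    exact (hχc.mul_right.mul_right.mul_left.add hχc.mul_right.mul_right.mul_left).mul_left
  have hpt (ζ) : (conj (ζ 0 - z 0) * dbar 0 (fun ζ => χ ζ * (η ζ * F ζ)) ζ +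
      conj (ζ 1 - z 1) * dbar 1 (fun ζ => χ ζ * (η ζ * F ζ)) ζ) / euclSq (ζ - z) ^ 2 =
      (F ζ * η ζ * (dbar 0 χ ζ * lerayKernel N 1 z ζ - dbar 1 χ ζ * lerayKernel N 0 z ζ) +
      F ζ * (dbar 0 χ ζ * (dbar 1 η ζ * lerayTransgression N z ζ) -
        dbar 1 χ ζ * (dbar 0 η ζ * lerayTransgression N z ζ)) +
      F ζ * (dbar 0 η ζ * (χ ζ * conj (ζ 0 - z 0) / euclSq (ζ - z) ^ 2) +
        dbar 1 η ζ * (χ ζ * conj (ζ 1 - z 1) / euclSq (ζ - z) ^ 2))) -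
      (dbar 1 (fun ζ => F ζ * η ζ * dbar 0 χ ζ * lerayTransgression N z ζ) ζ -
        dbar 0 (fun ζ => F ζ * η ζ * dbar 1 χ ζ * lerayTransgression N z ζ) ζ) := by
    rw [hdΨ, hdΨ]
    by_cases h0 : ζ ∈ tsupport (dbar 0 χ) <;> by_cases h1 : ζ ∈ tsupport (dbar 1 χ)
    · obtain ⟨e0, e1⟩ := dbar_lerayTransgression hN (hne 0 h0) (hD 0 ζ h0)
      rw [hexd 1 0 ζ h0, hexd 0 1 ζ h1, dbar_comm hχ, e0, e1]
      ring
    · obtain ⟨e0, e1⟩ := dbar_lerayTransgression hN (hne 0 h0) (hD 0 ζ h0)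
      have h1' := dbar_eq_zero_of_notMem 0 h1
      rw [dbar_comm hχ] at h1'
      rw [hexd 1 0 ζ h0, h1', e1, hT0 1 ζ h1, dbar_eq_zero_of_notMem 0 (u := fun ζ => F ζ * η ζ * dbar 1 χ ζ * lerayTransgression N z ζ)]
      · ring
      · exact fun h => h1 (closure_mono (fun y hy => by contrapose! hy; simp [hy]) h)
    · obtain ⟨e0, e1⟩ := dbar_lerayTransgression hN (hne 1 h1) (hD 1 ζ h1)
      have h0' := dbar_eq_zero_of_notMem 1 h0
      rw [← dbar_comm hχ] at h0'
      rw [hexd 0 1 ζ h1, h0', e0, hT0 0 ζ h0, dbar_eq_zero_of_notMem 1 (u := fun ζ => F ζ * η ζ * dbar 0 χ ζ * lerayTransgression N z ζ)]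
      · ring
      · exact fun h => h0 (closure_mono (fun y hy => by contrapose! hy; simp [hy]) h)
    · rw [hT0 1 ζ h1, hT0 0 ζ h0, dbar_eq_zero_of_notMem 1 (u := fun ζ => F ζ * η ζ * dbar 0 χ ζ * lerayTransgression N z ζ),
        dbar_eq_zero_of_notMem 0 (u := fun ζ => F ζ * η ζ * dbar 1 χ ζ * lerayTransgression N z ζ)]
      · ring
      · exact fun h => h1 (closure_mono (fun y hy => by contrapose! hy; simp [hy]) h)
      · exact fun h => h0 (closure_mono (fun y hy => by contrapose! hy; simp [hy]) h)
  rw [integral_congr_ae (Eventually.of_forall hpt), integral_sub ((i1.fun_add i2).fun_add i3)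
    (show Integrable (fun ζ => dbar 1 _ ζ - dbar 0 _ ζ) from (hexI 1 0).sub (hexI 0 1)), integral_add (i1.fun_add i2) i3, integral_add i1 i2,
    integral_sub (hexI 1 0) (hexI 0 1), hex0, hex0, sub_zero, sub_zero, hz, one_mul] at hBM
  exact hBM.symm

/-- Kernels `k(z, ζ)` that are finite sums of products of a smooth function of `ζ` and a holomorphic
polynomial in `z`. -/
inductive SepKernel : ((Fin 2 → ℂ) → (Fin 2 → ℂ) → ℂ) → Prop
  | mul (α : (Fin 2 → ℂ) → ℂ) (hα : ContDiff ℝ ∞ α) (p : MvPolynomial (Fin 2) ℂ) :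
    SepKernel fun z ζ => α ζ * MvPolynomial.eval z p
  | add (k l : (Fin 2 → ℂ) → (Fin 2 → ℂ) → ℂ) (hk : SepKernel k) (hl : SepKernel l) :
    SepKernel fun z ζ => k z ζ + l z ζ

theorem contDiff_eval_mvPolynomial (p : MvPolynomial (Fin 2) ℂ) :
    ContDiff ℂ ∞ fun z : Fin 2 → ℂ => MvPolynomial.eval z p := by
  induction p using MvPolynomial.induction_on with
  | C a => simpa using contDiff_const
  | add p q hp hq => simpa using hp.add hq
  | mul_X p i hp => simpa using hp.mul (contDiff_apply ℂ ℂ i)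

namespace SepKernel

variable {k l : (Fin 2 → ℂ) → (Fin 2 → ℂ) → ℂ}

theorem zero : SepKernel fun _ _ => 0 := by
  simpa using mul (fun _ => 0) contDiff_const 0

theorem mul_left {β : (Fin 2 → ℂ) → ℂ} (hβ : ContDiff ℝ ∞ β) (hk : SepKernel k) :
    SepKernel fun z ζ => β ζ * k z ζ := by
  induction hk with
  | mul α hα p => simpa only [mul_assoc] using mul _ (hβ.mul hα) p
  | add k l _ _ hk hl => simpa only [mul_add] using add _ _ hk hl

theorem sum {ι : Type*} (s : Finset ι) {w : ι → (Fin 2 → ℂ) → (Fin 2 → ℂ) → ℂ}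
    (hw : ∀ i, SepKernel (w i)) : SepKernel fun z ζ => ∑ i ∈ s, w i z ζ := by
  classical
  induction s using Finset.induction_on with
  | empty => simpa using zero
  | insert i s hi ih => simpa only [Finset.sum_insert hi] using add _ _ (hw i) ih

theorem contDiff (hk : SepKernel k) (z : Fin 2 → ℂ) : ContDiff ℝ ∞ (k z) := by
  induction hk with
  | mul α hα p => exact hα.mul contDiff_const
  | add k l _ _ hk hl => exact hk.add hl

theorem dbar (hk : SepKernel k) (j : Fin 2) : SepKernel fun z ζ => dbar j (k z) ζ := by
  induction hk with
  | mul α hα p =>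
    refine (congrArg SepKernel ?_).mp (mul (_root_.dbar j α) (hα.dbar j) p)
    funext z ζ
    rw [dbar_mul j (hα.differentiable (by simp) ζ) (differentiableAt_const _), dbar_const]
    ring
  | add k l h1 h2 hk hl =>
    refine (congrArg SepKernel ?_).mp (add _ _ hk hl)
    funext z ζ
    rw [dbar_add j ((h1.contDiff z).differentiable (by simp) ζ)
      ((h2.contDiff z).differentiable (by simp) ζ)]

theorem continuous (hk : SepKernel k) :
    Continuous fun q : (Fin 2 → ℂ) × (Fin 2 → ℂ) => k q.2 q.1 := by
  induction hk with
  | mul α hα p =>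
    exact (hα.continuous.comp continuous_fst).mul
      ((continuous_eval_mvPolynomial p).comp continuous_snd)
  | add k l _ _ hk hl => exact hk.add hl

theorem unifApprox (hk : SepKernel k) {X : Set (Fin 2 → ℂ)} (hX : IsCompact X) (ζ : Fin 2 → ℂ) :
    UnifApprox X fun z => k z ζ := by
  induction hk with
  | mul α hα p => exact (UnifApprox.eval X p).const_mul hX _
  | add k l _ _ hk hl => exact hk.add hl

end SepKernel

/-- Hefer decomposition of a polynomial. -/
theorem exists_hefer (q : MvPolynomial (Fin 2) ℂ) :
    ∃ h : Fin 2 → (Fin 2 → ℂ) → (Fin 2 → ℂ) → ℂ, (∀ j, SepKernel (h j)) ∧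
      ∀ z ζ, MvPolynomial.eval ζ q - MvPolynomial.eval z q =
        (ζ 0 - z 0) * h 0 z ζ + (ζ 1 - z 1) * h 1 z ζ := by
  induction q using MvPolynomial.induction_on with
  | C a => exact ⟨fun _ _ _ => 0, fun _ => SepKernel.zero, fun z ζ => by simp⟩
  | add p q hp hq =>
    obtain ⟨h, hh, hp⟩ := hp
    obtain ⟨k, hk, hq⟩ := hq
    refine ⟨fun j z ζ => h j z ζ + k j z ζ, fun j => (hh j).add _ _ (hk j), fun z ζ => ?_⟩
    rw [map_add, map_add]
    linear_combination hp z ζ + hq z ζ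
  | mul_X p i hp =>
    obtain ⟨h, hh, hp⟩ := hp
    refine ⟨fun j z ζ => ζ i * h j z ζ + (if j = i then 1 else 0) * MvPolynomial.eval z p,
      fun j => ((hh j).mul_left (contDiff_coord i)).add _ _ (SepKernel.mul _ contDiff_const p),
      fun z ζ => ?_⟩
    rw [map_mul, map_mul, MvPolynomial.eval_X, MvPolynomial.eval_X]
    fin_cases i
    · simp only [Fin.zero_eta, if_true, one_ne_zero, if_false]
      linear_combination ζ 0 * hp z ζ
    · simp only [Fin.mk_one, if_true, zero_ne_one, if_false]
      linear_combination ζ 1 * hp z ζ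

/-- Points off `X` are separated from `X` by polynomials. -/
def PolySep (X : Set (Fin 2 → ℂ)) : Prop :=
  ∀ ζ, ζ ∉ X → ∃ p : MvPolynomial (Fin 2) ℂ, ∀ z ∈ X,
    ‖MvPolynomial.eval z p‖ < ‖MvPolynomial.eval ζ p‖

theorem PolySep.exists_lt_one {X : Set (Fin 2 → ℂ)} (hX : IsCompact X) (h : PolySep X)
    {ζ : Fin 2 → ℂ} (hζ : ζ ∉ X) : ∃ p : MvPolynomial (Fin 2) ℂ,
    1 < ‖MvPolynomial.eval ζ p‖ ∧ ∀ z ∈ X, ‖MvPolynomial.eval z p‖ < 1 := by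
  rcases X.eq_empty_or_nonempty with rfl | hne
  · exact ⟨MvPolynomial.C 2, by simp, by simp⟩
  obtain ⟨p, hp⟩ := h ζ hζ
  obtain ⟨x, hx, hmax⟩ := hX.exists_isMaxOn hne (continuous_eval_mvPolynomial p).norm.continuousOn
  have hlt := hp x hx
  set M := ‖MvPolynomial.eval x p‖ with hM
  set P := ‖MvPolynomial.eval ζ p‖
  have hM0 : 0 ≤ M := norm_nonneg _
  have hpos : 0 < M + P := by linarith
  have e : ∀ w, ‖MvPolynomial.eval w (MvPolynomial.C ((2 / (M + P) : ℝ) : ℂ) * p)‖ =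
      2 * ‖MvPolynomial.eval w p‖ / (M + P) := fun w => by
    rw [map_mul, MvPolynomial.eval_C, norm_mul, Complex.norm_real,
      Real.norm_of_nonneg (by positivity)]
    ring
  refine ⟨MvPolynomial.C ((2 / (M + P) : ℝ) : ℂ) * p, ?_, fun z hz => ?_⟩
  · rw [e, one_lt_div hpos]
    linarith
  · rw [e, div_lt_one hpos]
    have : ‖MvPolynomial.eval z p‖ ≤ M := hmax hz
    linarith

theorem PolySep.exists_finset {X T : Set (Fin 2 → ℂ)} (hX : IsCompact X) (h : PolySep X)
    (hT : IsCompact T) (hd : Disjoint T X) : ∃ (s : Finset (MvPolynomial (Fin 2) ℂ)) (n : ℕ),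
    (∀ ζ ∈ T, 1 ≤ ∑ q ∈ s, ‖MvPolynomial.eval ζ (q ^ n)‖ ^ 2) ∧
    ∀ z ∈ X, ∑ q ∈ s, ‖MvPolynomial.eval z (q ^ n)‖ ^ 2 ≤ 1 / 4 := by
  classical
  obtain ⟨s, hs1, hs2⟩ : ∃ s : Finset (MvPolynomial (Fin 2) ℂ),
      (∀ ζ ∈ T, ∃ q ∈ s, 1 < ‖MvPolynomial.eval ζ q‖) ∧
      ∀ q ∈ s, ∀ z ∈ X, ‖MvPolynomial.eval z q‖ < 1 := by
    refine hT.induction_on (p := fun T => ∃ s : Finset (MvPolynomial (Fin 2) ℂ),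
      (∀ ζ ∈ T, ∃ q ∈ s, 1 < ‖MvPolynomial.eval ζ q‖) ∧
      ∀ q ∈ s, ∀ z ∈ X, ‖MvPolynomial.eval z q‖ < 1) ⟨∅, by simp, by simp⟩ ?_ ?_ ?_
    · rintro A B hAB ⟨s, h1, h2⟩
      exact ⟨s, fun ζ hζ => h1 ζ (hAB hζ), h2⟩
    · rintro A B ⟨s, h1, h2⟩ ⟨t, h3, h4⟩
      refine ⟨s ∪ t, ?_, ?_⟩
      · rintro ζ (hζ | hζ)
        · obtain ⟨q, hq, hq'⟩ := h1 ζ hζ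
          exact ⟨q, by simp [hq], hq'⟩
        · obtain ⟨q, hq, hq'⟩ := h3 ζ hζ
          exact ⟨q, by simp [hq], hq'⟩
      · intro q hq
        rcases Finset.mem_union.1 hq with hq | hq
        exacts [h2 q hq, h4 q hq]
    · intro ζ hζ
      obtain ⟨p, hp1, hp2⟩ := h.exists_lt_one hX (disjoint_left.1 hd hζ)
      refine ⟨{w | 1 < ‖MvPolynomial.eval w p‖}, mem_nhdsWithin_of_mem_nhds
        ((isOpen_lt continuous_const (continuous_eval_mvPolynomial p).norm).mem_nhds hp1), {p}, ?_, ?_⟩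
      · exact fun w hw => ⟨p, by simp, hw⟩
      · simpa using hp2
  have hev : ∀ q ∈ s, ∀ᶠ n : ℕ in atTop, ∀ z ∈ X,
      ‖MvPolynomial.eval z (q ^ n)‖ ^ 2 ≤ 1 / (4 * (s.card + 1)) := by
    intro q hq
    rcases X.eq_empty_or_nonempty with rfl | hne
    · simp
    obtain ⟨x, hx, hmax⟩ := hX.exists_isMaxOn hne (continuous_eval_mvPolynomial q).norm.continuousOn
    have h1 : ‖MvPolynomial.eval x q‖ ^ 2 < 1 :=
      pow_lt_one₀ (norm_nonneg _) (hs2 q hq x hx) two_ne_zero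
    have h2 := (tendsto_pow_atTop_nhds_zero_of_lt_one (sq_nonneg _) h1).eventually_le_const
      (show (0 : ℝ) < 1 / (4 * (s.card + 1)) by positivity)
    filter_upwards [h2] with n hn z hz
    have h3 : ‖MvPolynomial.eval z q‖ ≤ ‖MvPolynomial.eval x q‖ := hmax hz
    calc ‖MvPolynomial.eval z (q ^ n)‖ ^ 2 = (‖MvPolynomial.eval z q‖ ^ 2) ^ n := by
          rw [map_pow, norm_pow, ← pow_mul, ← pow_mul, mul_comm]
      _ ≤ (‖MvPolynomial.eval x q‖ ^ 2) ^ n := by gcongr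
      _ ≤ _ := hn
  obtain ⟨n, hn⟩ := ((eventually_all_finset s).2 hev).exists
  refine ⟨s, n, fun ζ hζ => ?_, fun z hz => ?_⟩
  · obtain ⟨q, hq, hq1⟩ := hs1 ζ hζ
    refine le_trans ?_ (Finset.single_le_sum (f := fun q => ‖MvPolynomial.eval ζ (q ^ n)‖ ^ 2)
      (fun q _ => sq_nonneg _) hq)
    rw [map_pow, norm_pow, ← pow_mul]
    exact one_le_pow₀ hq1.le
  · refine (Finset.sum_le_sum fun q hq => hn q hq z hz).trans ?_
    rw [Finset.sum_const, nsmul_eq_mul, mul_one_div, div_le_iff₀ (by positivity)]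
    linarith

theorem PolySep.exists_leraySection {X T : Set (Fin 2 → ℂ)} (hX : IsCompact X) (h : PolySep X)
    (hT : IsCompact T) (hd : Disjoint T X) :
    ∃ N : Fin 2 → (Fin 2 → ℂ) → (Fin 2 → ℂ) → ℂ, (∀ j, SepKernel (N j)) ∧
      ∀ ζ ∈ T, (∀ z ∈ X, lerayDenom (fun j => N j z) z ζ ≠ 0) ∧
        UnifApprox X fun z => (lerayDenom (fun j => N j z) z ζ)⁻¹ := by
  obtain ⟨s, n, hs1, hs2⟩ := h.exists_finset hX hT hd
  choose H hH hHefer using exists_hefer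
  have hconj (q : MvPolynomial (Fin 2) ℂ) : ContDiff ℝ ∞ fun ζ => conj (MvPolynomial.eval ζ q) :=
    (Complex.conjCLE : ℂ →L[ℝ] ℂ).contDiff.comp ((contDiff_eval_mvPolynomial q).restrict_scalars ℝ)
  refine ⟨fun j z ζ => ∑ q ∈ s, conj (MvPolynomial.eval ζ (q ^ n)) * H (q ^ n) j z ζ,
    fun j => SepKernel.sum s fun q => (hH _ j).mul_left (hconj _), fun ζ hζ => ?_⟩
  set Q : ℝ := ∑ q ∈ s, ‖MvPolynomial.eval ζ (q ^ n)‖ ^ 2 with hQ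
  have hQ1 : 1 ≤ Q := hs1 ζ hζ
  have hQ0 : (Q : ℂ) ≠ 0 := Complex.ofReal_ne_zero.2 (by linarith)
  set u : (Fin 2 → ℂ) → ℂ := fun z =>
    (Q : ℂ)⁻¹ * ∑ q ∈ s, conj (MvPolynomial.eval ζ (q ^ n)) * MvPolynomial.eval z (q ^ n) with hu
  have hden (z) : lerayDenom (fun j ζ => ∑ q ∈ s, conj (MvPolynomial.eval ζ (q ^ n)) *
      H (q ^ n) j z ζ) z ζ = Q * (1 - u z) := by
    have e : (Q : ℂ) = ∑ q ∈ s, conj (MvPolynomial.eval ζ (q ^ n)) * MvPolynomial.eval ζ (q ^ n) := by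
      rw [hQ, Complex.ofReal_sum]
      refine Finset.sum_congr rfl fun q _ => ?_
      rw [Complex.conj_mul', Complex.ofReal_pow]
    rw [mul_sub, hu, mul_one, mul_inv_cancel_left₀ hQ0, e, ← Finset.sum_sub_distrib, lerayDenom,
      Finset.mul_sum, Finset.mul_sum, ← Finset.sum_add_distrib]
    refine Finset.sum_congr rfl fun q _ => ?_
    linear_combination -conj (MvPolynomial.eval ζ (q ^ n)) * hHefer (q ^ n) z ζ
  have hub : ∀ z ∈ X, ‖u z‖ ≤ 5 / 8 := by
    intro z hz
    rw [hu]
    dsimp only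
    rw [norm_mul, norm_inv, Complex.norm_real, Real.norm_of_nonneg (by linarith),
      inv_mul_le_iff₀ (by linarith)]
    calc ‖∑ q ∈ s, conj (MvPolynomial.eval ζ (q ^ n)) * MvPolynomial.eval z (q ^ n)‖
        ≤ ∑ q ∈ s, (‖MvPolynomial.eval ζ (q ^ n)‖ ^ 2 + ‖MvPolynomial.eval z (q ^ n)‖ ^ 2) / 2 := by
          refine norm_sum_le_of_le _ fun q _ => ?_
          rw [norm_mul, RCLike.norm_conj]
          nlinarith [sq_nonneg (‖MvPolynomial.eval ζ (q ^ n)‖ - ‖MvPolynomial.eval z (q ^ n)‖)]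
      _ = (Q + ∑ q ∈ s, ‖MvPolynomial.eval z (q ^ n)‖ ^ 2) / 2 := by
          rw [← Finset.sum_div, Finset.sum_add_distrib]
      _ ≤ _ := by linarith [hs2 z hz]
  refine ⟨fun z hz => ?_, ?_⟩
  · rw [hden]
    refine mul_ne_zero hQ0 fun h0 => ?_
    have h1 := hub z hz
    rw [← sub_eq_zero.1 h0, norm_one] at h1
    norm_num at h1
  · have hua : UnifApprox X u :=
      (UnifApprox.sum s fun q _ => (UnifApprox.eval X (q ^ n)).const_mul hX _).const_mul hX _
    refine ((hua.inv_one_sub hX (by norm_num) hub).const_mul hX (Q : ℂ)⁻¹).congr fun z _ => ?_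
    rw [hden, mul_inv]

section families

variable {N : Fin 2 → (Fin 2 → ℂ) → (Fin 2 → ℂ) → ℂ} {X T : Set (Fin 2 → ℂ)}

theorem continuous_lerayDenom_family (hN : ∀ j, SepKernel (N j)) :
    Continuous fun q : (Fin 2 → ℂ) × (Fin 2 → ℂ) => lerayDenom (fun j => N j q.2) q.2 q.1 := by
  have h0 := (hN 0).continuous
  have h1 := (hN 1).continuous
  exact ((by fun_prop : Continuous fun q : (Fin 2 → ℂ) × (Fin 2 → ℂ) => q.1 0 - q.2 0).mul h0).add
    ((by fun_prop : Continuous fun q : (Fin 2 → ℂ) × (Fin 2 → ℂ) => q.1 1 - q.2 1).mul h1)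

theorem continuousAt_lerayKernel_family (hN : ∀ j, SepKernel (N j)) (k : Fin 2)
    {q : (Fin 2 → ℂ) × (Fin 2 → ℂ)} (hD : lerayDenom (fun j => N j q.2) q.2 q.1 ≠ 0) :
    ContinuousAt (fun q : (Fin 2 → ℂ) × (Fin 2 → ℂ) =>
      lerayKernel (fun j => N j q.2) k q.2 q.1) q :=
  (((hN 0).continuous.mul ((hN 1).dbar k).continuous).sub
    ((hN 1).continuous.mul ((hN 0).dbar k).continuous)).continuousAt.div
    ((continuous_lerayDenom_family hN).continuousAt.pow 2) (pow_ne_zero _ hD)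

theorem continuous_euclSq : Continuous euclSq := by
  unfold euclSq
  exact ((continuous_apply 0).mul (Complex.continuous_conj.comp (continuous_apply 0))).add
    ((continuous_apply 1).mul (Complex.continuous_conj.comp (continuous_apply 1)))

theorem continuousAt_lerayTransgression_family (hN : ∀ j, SepKernel (N j))
    {q : (Fin 2 → ℂ) × (Fin 2 → ℂ)} (hD : lerayDenom (fun j => N j q.2) q.2 q.1 ≠ 0)
    (hq : q.1 ≠ q.2) :
    ContinuousAt (fun q : (Fin 2 → ℂ) × (Fin 2 → ℂ) =>
      lerayTransgression (fun j => N j q.2) q.2 q.1) q := by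
  have hc (k : Fin 2) : Continuous fun q : (Fin 2 → ℂ) × (Fin 2 → ℂ) => conj (q.1 k - q.2 k) :=
    Complex.continuous_conj.comp (by fun_prop)
  exact (((hc 0).mul (hN 1).continuous).sub ((hc 1).mul (hN 0).continuous)).continuousAt.div
    ((continuous_euclSq.comp (continuous_fst.sub continuous_snd)).mul
      (continuous_lerayDenom_family hN)).continuousAt
    (mul_ne_zero (euclSq_ne_zero (sub_ne_zero.2 hq)) hD)

theorem unifApprox_lerayKernel (hX : IsCompact X) (hN : ∀ j, SepKernel (N j)) (k : Fin 2)
    {ζ : Fin 2 → ℂ} (hD : UnifApprox X fun z => (lerayDenom (fun j => N j z) z ζ)⁻¹) :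
    UnifApprox X fun z => lerayKernel (fun j => N j z) k z ζ := by
  refine ((((hN 0).unifApprox hX ζ).mul hX (((hN 1).dbar k).unifApprox hX ζ)).sub hX
    (((hN 1).unifApprox hX ζ).mul hX (((hN 0).dbar k).unifApprox hX ζ))).mul hX (hD.pow hX 2)
    |>.congr fun z _ => ?_
  rw [lerayKernel, div_eq_mul_inv, inv_pow]

theorem unifApprox_integral_lerayKernel {χ G : (Fin 2 → ℂ) → ℂ} (hX : IsCompact X)
    (hN : ∀ j, SepKernel (N j)) (hχ : ContDiff ℝ ∞ χ) (hχc : HasCompactSupport χ)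
    (hG : Continuous G)
    (hD : ∀ j, ∀ ζ ∈ tsupport (dbar j χ), (∀ z ∈ X, lerayDenom (fun j => N j z) z ζ ≠ 0) ∧
        UnifApprox X fun z => (lerayDenom (fun j => N j z) z ζ)⁻¹) :
    UnifApprox X fun z => ∫ ζ, G ζ * (dbar 0 χ ζ * lerayKernel (fun j => N j z) 1 z ζ -
      dbar 1 χ ζ * lerayKernel (fun j => N j z) 0 z ζ) := by
  have hpart (j k : Fin 2) : Continuous fun q : (Fin 2 → ℂ) × X =>
      dbar j χ q.1 * lerayKernel (fun j => N j q.2.1) k q.2.1 q.1 := by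
    refine continuous_mul_of_continuousAt (T := Prod.fst ⁻¹' tsupport (dbar j χ))
      ((isClosed_tsupport _).preimage continuous_fst) ((hχ.dbar j).continuous.comp continuous_fst)
      (fun q hq => image_eq_zero_of_notMem_tsupport hq) fun q hq => ?_
    have hcont : Continuous fun q : (Fin 2 → ℂ) × X => (q.1, q.2.1) := by fun_prop
    exact ContinuousAt.comp (f := fun q : (Fin 2 → ℂ) × X => (q.1, q.2.1)) (x := q)
      (continuousAt_lerayKernel_family (q := (q.1, q.2.1)) hN k ((hD j q.1 hq).1 q.2.1 q.2.2))
      hcont.continuousAt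
  have hua (j k : Fin 2) (ζ) : UnifApprox X fun z =>
      dbar j χ ζ * lerayKernel (fun j => N j z) k z ζ := by
    by_cases h : ζ ∈ tsupport (dbar j χ)
    · exact (unifApprox_lerayKernel hX hN k (hD j ζ h).2).const_mul hX _
    · simpa [image_eq_zero_of_notMem_tsupport h] using UnifApprox.const X 0
  refine UnifApprox.integral hX hχc ?_ ?_ fun ζ => ((hua 0 1 ζ).sub hX (hua 1 0 ζ)).const_mul hX _
  · exact (hG.comp continuous_fst).mul ((hpart 0 1).sub (hpart 1 0))
  · intro ζ hζ z _
    rw [dbar_eq_zero_of_notMem 0 hζ, dbar_eq_zero_of_notMem 1 hζ]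
    ring

/-- Uniform bounds for the error terms of `leray_representation`. -/
theorem exists_error_bound {χ η : (Fin 2 → ℂ) → ℂ} {K : Set (Fin 2 → ℂ)} (hK : IsCompact K)
    (hN : ∀ j, SepKernel (N j)) (hχ : ContDiff ℝ ∞ χ) (hχc : HasCompactSupport χ)
    (hη : ContDiff ℝ ∞ η)
    (hD : ∀ j, ∀ ζ ∈ tsupport (dbar j χ), ∀ z ∈ K, lerayDenom (fun j => N j z) z ζ ≠ 0)
    (hχK : ∀ j, ∀ z ∈ K, z ∉ tsupport (dbar j χ)) (hηK : ∀ j, ∀ z ∈ K, z ∉ tsupport (dbar j η)) :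
    ∃ B : ℝ, ∀ (F : (Fin 2 → ℂ) → ℂ) (R : ℝ),
      (∀ j, ∀ ζ ∈ tsupport χ, ζ ∈ tsupport (dbar j η) → ‖F ζ‖ ≤ R) → 0 ≤ R → ∀ z ∈ K,
      ‖(∫ ζ, F ζ * (dbar 0 χ ζ * (dbar 1 η ζ * lerayTransgression (fun j => N j z) z ζ) -
        dbar 1 χ ζ * (dbar 0 η ζ * lerayTransgression (fun j => N j z) z ζ))) +
      ∫ ζ, F ζ * (dbar 0 η ζ * (χ ζ * conj (ζ 0 - z 0) / euclSq (ζ - z) ^ 2) +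
        dbar 1 η ζ * (χ ζ * conj (ζ 1 - z 1) / euclSq (ζ - z) ^ 2))‖ ≤ R * B := by
  have hcs (j : Fin 2) : HasCompactSupport (dbar j χ) :=
    hχc.of_isClosed_subset (isClosed_tsupport _) (tsupport_dbar_subset j)
  have hB1 (j : Fin 2) : ∃ B, ∀ q ∈ tsupport (dbar j χ) ×ˢ K,
      ‖lerayTransgression (fun j => N j q.2) q.2 q.1‖ ≤ B :=
    ((hcs j).isCompact.prod hK).exists_bound_of_continuousOn fun q hq =>
      (continuousAt_lerayTransgression_family hN (hD j q.1 hq.1 q.2 hq.2)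
        fun h => hχK j q.2 hq.2 (h ▸ hq.1)).continuousWithinAt
  have hB2 (j : Fin 2) : ∃ B, ∀ q ∈ (tsupport χ ∩ tsupport (dbar j η)) ×ˢ K,
      ‖conj (q.1 j - q.2 j) / euclSq (q.1 - q.2) ^ 2‖ ≤ B :=
    ((hχc.isCompact.inter_right (isClosed_tsupport _)).prod hK).exists_bound_of_continuousOn
      fun q hq => by
        have h1 : Continuous fun q : (Fin 2 → ℂ) × (Fin 2 → ℂ) => conj (q.1 j - q.2 j) :=
          Complex.continuous_conj.comp (by fun_prop)
        exact (h1.continuousAt.div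
          ((continuous_euclSq.comp (continuous_fst.sub continuous_snd)).continuousAt.pow 2)
          (pow_ne_zero _ (euclSq_ne_zero (sub_ne_zero.2
            fun h => hηK j q.2 hq.2 (h ▸ hq.1.2))))).continuousWithinAt
  choose B1 hB1 using hB1
  choose B2 hB2 using hB2
  have i1 : Integrable fun ζ => ‖dbar 0 χ ζ‖ * (‖dbar 1 η ζ‖ * B1 0) +
      ‖dbar 1 χ ζ‖ * (‖dbar 0 η ζ‖ * B1 1) := by
    have hw (j k : Fin 2) : Integrable fun ζ => ‖dbar j χ ζ‖ * (‖dbar k η ζ‖ * B1 j) :=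
      ((hχ.dbar j).continuous.norm.mul ((hη.dbar k).continuous.norm.mul
        continuous_const)).integrable_of_hasCompactSupport (hcs j).norm.mul_right
    exact (hw 0 1).add (hw 1 0)
  have i2 : Integrable fun ζ => ‖dbar 0 η ζ‖ * (‖χ ζ‖ * B2 0) + ‖dbar 1 η ζ‖ * (‖χ ζ‖ * B2 1) := by
    have hw (j : Fin 2) : Integrable fun ζ => ‖dbar j η ζ‖ * (‖χ ζ‖ * B2 j) :=
      ((hη.dbar j).continuous.norm.mul (hχ.continuous.norm.mul
        continuous_const)).integrable_of_hasCompactSupport hχc.norm.mul_right.mul_left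
    exact (hw 0).add (hw 1)
  refine ⟨(∫ ζ, ‖dbar 0 χ ζ‖ * (‖dbar 1 η ζ‖ * B1 0) + ‖dbar 1 χ ζ‖ * (‖dbar 0 η ζ‖ * B1 1)) +
    ∫ ζ, ‖dbar 0 η ζ‖ * (‖χ ζ‖ * B2 0) + ‖dbar 1 η ζ‖ * (‖χ ζ‖ * B2 1),
    fun F R hFR hR z hz => ?_⟩
  have hj1 (j k : Fin 2) (ζ : Fin 2 → ℂ) : ‖F ζ * (dbar j χ ζ * (dbar k η ζ *
      lerayTransgression (fun j => N j z) z ζ))‖ ≤ R * (‖dbar j χ ζ‖ * (‖dbar k η ζ‖ * B1 j)) := by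
    rw [norm_mul, norm_mul, norm_mul]
    by_cases h1 : ζ ∈ tsupport (dbar j χ)
    · by_cases h2 : ζ ∈ tsupport (dbar k η)
      · have := hFR k ζ (tsupport_dbar_subset j h1) h2
        have := hB1 j (ζ, z) ⟨h1, hz⟩
        gcongr
      · simp [image_eq_zero_of_notMem_tsupport h2]
    · simp [image_eq_zero_of_notMem_tsupport h1]
  have hj2 (j : Fin 2) (ζ : Fin 2 → ℂ) : ‖F ζ * (dbar j η ζ * (χ ζ * conj (ζ j - z j) / euclSq (ζ - z) ^ 2))‖ ≤
      R * (‖dbar j η ζ‖ * (‖χ ζ‖ * B2 j)) := by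
    rw [norm_mul, norm_mul, mul_div_assoc, norm_mul]
    by_cases h1 : ζ ∈ tsupport χ
    · by_cases h2 : ζ ∈ tsupport (dbar j η)
      · have := hFR j ζ h1 h2
        have := hB2 j (ζ, z) ⟨⟨h1, h2⟩, hz⟩
        gcongr
      · simp [image_eq_zero_of_notMem_tsupport h2]
    · simp [image_eq_zero_of_notMem_tsupport h1]
  refine (norm_add_le _ _).trans ?_
  rw [mul_add]
  refine add_le_add ?_ ?_
  · rw [← integral_const_mul]
    refine norm_integral_le_of_norm_le (i1.const_mul R) (Eventually.of_forall fun ζ => ?_)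
    rw [mul_sub, mul_add]
    exact (norm_sub_le _ _).trans (add_le_add (hj1 0 1 ζ) (hj1 1 0 ζ))
  · rw [← integral_const_mul]
    refine norm_integral_le_of_norm_le (i2.const_mul R) (Eventually.of_forall fun ζ => ?_)
    rw [mul_add, mul_add]
    exact (norm_add_le _ _).trans (add_le_add (hj2 0 ζ) (hj2 1 ζ))

end families

theorem exists_smooth_cutoff {s t : Set (Fin 2 → ℂ)} (hs : IsClosed s) (ht : IsClosed t)
    (hd : Disjoint s t) : ∃ η : (Fin 2 → ℂ) → ℂ, ContDiff ℝ ∞ η ∧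
      (∀ z ∈ s, ∀ᶠ w in 𝓝 z, η w = 0) ∧ (∀ z ∈ t, ∀ᶠ w in 𝓝 z, η w = 1) := by
  obtain ⟨f, h0, h1, -⟩ := exists_contMDiffMap_zero_one_nhds_of_isClosed
    (n := (⊤ : ℕ∞)) (modelWithCornersSelf ℝ (Fin 2 → ℂ)) hs ht hd
  refine ⟨fun z => (f z : ℂ), Complex.ofRealCLM.contDiff.comp f.contMDiff.contDiff,
    fun z hz => ?_, fun z hz => ?_⟩
  · filter_upwards [eventually_nhdsSet_iff_forall.1 h0 z hz] with w hw
    simp [hw]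
  · filter_upwards [eventually_nhdsSet_iff_forall.1 h1 z hz] with w hw
    simp [hw]

theorem notMem_tsupport_dbar {u : (Fin 2 → ℂ) → ℂ} {z : Fin 2 → ℂ} {c : ℂ}
    (h : ∀ᶠ w in 𝓝 z, u w = c) (j : Fin 2) : z ∉ tsupport (dbar j u) := by
  rw [notMem_tsupport_iff_eventuallyEq]
  filter_upwards [eventually_eventually_nhds.2 h] with w hw
  rw [dbar_congr j (v := fun _ => c) hw, dbar_const]
  rfl

/-- A local maximum modulus principle of Rossi type on polynomially convex sets. -/
theorem PolySep.norm_le_of_split {X K S₁ S₂ O : Set (Fin 2 → ℂ)} {f : (Fin 2 → ℂ) → ℂ} {C : ℝ}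
    (hsep : PolySep X) (hX : IsCompact X) (hK : IsCompact K) (hKX : K ⊆ X)
    (hull : ∀ z ∈ X, ∀ p : MvPolynomial (Fin 2) ℂ, ∃ y ∈ K,
      ‖MvPolynomial.eval z p‖ ≤ ‖MvPolynomial.eval y p‖)
    (hS₁ : IsClosed S₁) (hS₂ : IsClosed S₂) (hd : Disjoint S₁ S₂) (hKS : K ⊆ S₁ ∪ S₂)
    (hO : IsOpen O) (hXO : X ⊆ O ∪ S₂) (hf : DifferentiableOn ℂ f O) (hf' : ContDiffOn ℝ ∞ f O)
    (hC : 0 ≤ C) (hfX : ∀ z ∈ X, z ∉ S₁ → z ∉ S₂ → ‖f z‖ ≤ C)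
    (hfK : ∀ z ∈ K, z ∈ S₁ → ‖f z‖ ≤ C) :
    ∀ z ∈ X, z ∈ S₁ → ‖f z‖ ≤ C := by
  intro y₀ hy₀ hy₀S
  by_contra! hlt
  obtain ⟨ρ, hCρ, hρ⟩ := exists_between hlt
  have hρ0 : 0 < ρ := hC.trans_lt hCρ
  obtain ⟨η, hη, hη0, hη1⟩ := exists_smooth_cutoff hS₂ hS₁ hd.symm
  set Z : Set (Fin 2 → ℂ) := tsupport (dbar 0 η) ∪ tsupport (dbar 1 η) with hZdef
  have hZ : IsClosed Z := (isClosed_tsupport _).union (isClosed_tsupport _)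
  have hZj (j) : tsupport (dbar j η) ⊆ Z := by
    fin_cases j
    · exact subset_union_left
    · exact subset_union_right
  have hZ1 : ∀ z ∈ S₁, z ∉ Z := fun z hz h => h.elim (notMem_tsupport_dbar (hη1 z hz) 0)
    (notMem_tsupport_dbar (hη1 z hz) 1)
  have hZ2 : ∀ z ∈ S₂, z ∉ Z := fun z hz h => h.elim (notMem_tsupport_dbar (hη0 z hz) 0)
    (notMem_tsupport_dbar (hη0 z hz) 1)
  have hGo : IsOpen (O ∩ {z | ‖f z‖ < ρ}) :=
    hf.continuousOn.norm.isOpen_inter_preimage hO isOpen_Iio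
  set W : Set (Fin 2 → ℂ) := ((tsupport η)ᶜ ∪ O) ∩ (Zᶜ ∪ (O ∩ {z | ‖f z‖ < ρ})) with hWdef
  have hW : IsOpen W := ((isClosed_tsupport _).isOpen_compl.union hO).inter
    (hZ.isOpen_compl.union hGo)
  have hXW : X ⊆ W := by
    intro x hx
    by_cases h2 : x ∈ S₂
    · exact ⟨Or.inl (notMem_tsupport_iff_eventuallyEq.2 (hη0 x h2)), Or.inl (hZ2 x h2)⟩
    · have hxO := (hXO hx).resolve_right h2
      refine ⟨Or.inr hxO, ?_⟩
      by_cases hxZ : x ∈ Z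
      · exact Or.inr ⟨hxO, (hfX x hx (fun h => hZ1 x h hxZ) h2).trans_lt hCρ⟩
      · exact Or.inl hxZ
  obtain ⟨L, hL, hXL, hLW⟩ := exists_compact_between hX hW hXW
  obtain ⟨χ, hχ, hχ0, hχ1⟩ := exists_smooth_cutoff isOpen_interior.isClosed_compl hX.isClosed
    (disjoint_left.2 fun x hx hxX => hx (hXL hxX))
  have hχL : tsupport χ ⊆ L := fun x hx => by
    by_contra h
    exact notMem_tsupport_iff_eventuallyEq.2 (hχ0 x fun h' => h (interior_subset h')) hx
  have hχc : HasCompactSupport χ := hL.of_isClosed_subset (isClosed_tsupport _) hχL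
  set A : Set (Fin 2 → ℂ) := tsupport χ ∩ tsupport η with hAdef
  have hAO : A ⊆ O := fun x hx => (hLW (hχL hx.1)).1.resolve_left fun h => h hx.2
  obtain ⟨θ, hθ, hθ0, hθ1⟩ := exists_smooth_cutoff hO.isClosed_compl
    ((isClosed_tsupport χ).inter (isClosed_tsupport η))
    (disjoint_left.2 fun x hx hxA => hx (hAO hxA))
  have hft : ContDiff ℝ ∞ fun z => θ z * f z := by
    refine contDiff_mul_of_contDiffAt (isClosed_tsupport θ) hθ
      (fun y hy => image_eq_zero_of_notMem_tsupport hy) fun y hy => hf'.contDiffAt (hO.mem_nhds ?_)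
    by_contra h
    exact notMem_tsupport_iff_eventuallyEq.2 (hθ0 y h) hy
  have hftA : ∀ z ∈ A, (fun z => θ z * f z) =ᶠ[𝓝 z] f := fun z hz => by
    filter_upwards [hθ1 z hz] with w hw
    simp [hw]
  have hdft (j) : ∀ z ∈ A, dbar j (fun z => θ z * f z) z = 0 := fun z hz => by
    rw [dbar_congr j (hftA z hz)]
    exact dbar_of_differentiableAt j (hf.differentiableAt (hO.mem_nhds (hAO hz)))
  have hχX (j) : ∀ z ∈ X, z ∉ tsupport (dbar j χ) := fun z hz => notMem_tsupport_dbar (hχ1 z hz) j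
  obtain ⟨N, hN, hND⟩ := hsep.exists_leraySection hX
    (T := tsupport (dbar 0 χ) ∪ tsupport (dbar 1 χ))
    ((hχc.isCompact.of_isClosed_subset (isClosed_tsupport _) (tsupport_dbar_subset 0)).union
      (hχc.isCompact.of_isClosed_subset (isClosed_tsupport _) (tsupport_dbar_subset 1)))
    (disjoint_left.2 fun x hx hxX => hx.elim (hχX 0 x hxX) (hχX 1 x hxX))
  have hND' (j) : ∀ ζ ∈ tsupport (dbar j χ),
      (∀ z ∈ X, lerayDenom (fun j => N j z) z ζ ≠ 0) ∧
        UnifApprox X fun z => (lerayDenom (fun j => N j z) z ζ)⁻¹ := by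
    intro ζ hζ
    refine hND ζ ?_
    fin_cases j
    · exact Or.inl hζ
    · exact Or.inr hζ
  have hK' : insert y₀ K ⊆ X := insert_subset hy₀ hKX
  have hKS' : insert y₀ K ⊆ S₁ ∪ S₂ := insert_subset (Or.inl hy₀S) hKS
  have hηK (j) : ∀ z ∈ insert y₀ K, z ∉ tsupport (dbar j η) := fun z hz h =>
    (hKS' hz).elim (fun h1 => hZ1 z h1 (hZj j h)) fun h2 => hZ2 z h2 (hZj j h)
  obtain ⟨B, hB⟩ := exists_error_bound (hK.insert y₀) hN hχ hχc hη
    (fun j ζ hζ z hz => (hND' j ζ hζ).1 z (hK' hz)) (fun j z hz => hχX j z (hK' hz)) hηK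
  set c := bochnerMartinelliConst with hc
  have hc0 : 0 < c := bochnerMartinelliConst_pos
  have hval : ∀ z ∈ X, z ∈ S₁ → η z = 1 ∧ θ z * f z = f z := by
    intro z hz hz1
    have e1 : η z = 1 := (hη1 z hz1).self_of_nhds
    have e2 : χ z = 1 := (hχ1 z hz).self_of_nhds
    exact ⟨e1, (hftA z ⟨subset_tsupport _ (by simp [e2]), subset_tsupport _ (by simp [e1])⟩).self_of_nhds⟩
  have key (m : ℕ) : c * ‖f y₀‖ ^ m ≤ (c + 2 * B) * ρ ^ m := by
    have hF : ContDiff ℝ ∞ fun z => (θ z * f z) ^ m := hft.pow m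
    have hrep : ∀ z ∈ insert y₀ K, _ := fun z hz =>
      leray_representation (z := z) hχ hχc hη hF
        (fun j ζ h1 h2 => dbar_pow_eq_zero j (hft.differentiable (by simp) ζ)
          (hdft j ζ ⟨h1, h2⟩) m) (fun j => hχX j z (hK' hz)) (fun j => hηK j z hz)
        (fun j => (hN j).contDiff z) (fun j ζ hζ => (hND' j ζ hζ).1 z (hK' hz))
        (hχ1 z (hK' hz)).self_of_nhds
    have hua := unifApprox_integral_lerayKernel (G := fun z => (θ z * f z) ^ m * η z) hX hN hχ hχc
      (hF.mul hη).continuous hND'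
    have herr := hB (fun z => (θ z * f z) ^ m) (ρ ^ m) (fun j ζ h1 h2 => by
      have hA : ζ ∈ A := ⟨h1, tsupport_dbar_subset j h2⟩
      have h3 : ‖f ζ‖ < ρ := ((hLW (hχL h1)).2.resolve_left fun h => h (hZj j h2)).2
      rw [show θ ζ * f ζ = f ζ from (hftA ζ hA).self_of_nhds, norm_pow]
      gcongr) (by positivity)
    have hΦ := hua.norm_le_of_forall hKX hy₀ (hull y₀ hy₀) (B := (c + B) * ρ ^ m) fun z hz => by
      have e := hrep z (mem_insert_of_mem _ hz)
      have h1 := herr z (mem_insert_of_mem _ hz)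
      have h2 : ‖-((c : ℂ) * (η z * (θ z * f z) ^ m))‖ ≤ c * ρ ^ m := by
        rw [norm_neg, norm_mul, Complex.norm_real, Real.norm_of_nonneg hc0.le]
        gcongr
        rcases hKS hz with hz1 | hz2
        · rw [(hval z (hKX hz) hz1).1, (hval z (hKX hz) hz1).2, one_mul, norm_pow]
          gcongr
          exact (hfK z hz hz1).trans hCρ.le
        · rw [(hη0 z hz2).self_of_nhds, zero_mul, norm_zero]
          positivity
      rw [add_assoc, ← sub_eq_iff_eq_add] at e
      rw [← e]
      refine (norm_sub_le _ _).trans ?_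
      linarith
    have e := hrep y₀ (mem_insert _ _)
    have h1 := herr y₀ (mem_insert _ _)
    have h2 : ‖-((c : ℂ) * (η y₀ * (θ y₀ * f y₀) ^ m))‖ = c * ‖f y₀‖ ^ m := by
      rw [norm_neg, norm_mul, Complex.norm_real, Real.norm_of_nonneg hc0.le,
        (hval y₀ hy₀ hy₀S).1, (hval y₀ hy₀ hy₀S).2, one_mul, norm_pow]
    rw [← h2, e, add_assoc]
    refine (norm_add_le _ _).trans ?_
    linarith
  have hlim := tendsto_pow_atTop_atTop_of_one_lt ((one_lt_div hρ0).2 hρ)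
  obtain ⟨m, hm⟩ := (hlim.eventually_gt_atTop ((c + 2 * B) / c)).exists
  rw [div_pow, div_lt_div_iff₀ hc0 (by positivity)] at hm
  linarith [key m]

theorem DifferentiableOn.continuousAt_fderiv {g : (Fin 2 → ℂ) → ℂ} {Ω : Set (Fin 2 → ℂ)}
    (hg : DifferentiableOn ℂ g Ω) (hΩ : IsOpen Ω) {y : Fin 2 → ℂ} (hy : y ∈ Ω) :
    ContinuousAt (fderiv ℂ g) y := by
  obtain ⟨r, hr, hrΩ⟩ := Metric.nhds_basis_closedBall.mem_iff.1 (hΩ.mem_nhds hy)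
  have huc := (isCompact_closedBall y r).uniformContinuousOn_of_continuous
    (hg.continuousOn.mono hrΩ)
  rw [Metric.continuousAt_iff]
  intro ε hε
  obtain ⟨δ, hδ, hδg⟩ := Metric.uniformContinuousOn_iff.1 huc (ε * r / 8) (by positivity)
  refine ⟨min δ (r / 2), by positivity, fun z hz => ?_⟩
  have hzδ := hz.trans_le (min_le_left _ _)
  have hzr := hz.trans_le (min_le_right _ _)
  have hmem (w : Fin 2 → ℂ) (hw : w ∈ Metric.ball (0 : Fin 2 → ℂ) (r / 2)) :
      z + w ∈ Metric.closedBall y r ∧ y + w ∈ Metric.closedBall y r := by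
    rw [mem_ball_zero_iff] at hw
    rw [dist_eq_norm] at hzr
    constructor
    · rw [mem_closedBall_iff_norm, add_sub_right_comm]
      exact (norm_add_le _ _).trans (by linarith)
    · rw [mem_closedBall_iff_norm, add_sub_cancel_left]
      linarith
  have hd (w : Fin 2 → ℂ) (hw : w ∈ Metric.ball (0 : Fin 2 → ℂ) (r / 2)) :
      DifferentiableAt ℂ g (z + w) ∧ DifferentiableAt ℂ g (y + w) :=
    ⟨hg.differentiableAt (hΩ.mem_nhds (hrΩ (hmem w hw).1)),
      hg.differentiableAt (hΩ.mem_nhds (hrΩ (hmem w hw).2))⟩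
  have hsmall (w : Fin 2 → ℂ) (hw : w ∈ Metric.ball (0 : Fin 2 → ℂ) (r / 2)) :
      ‖g (z + w) - g (y + w)‖ < ε * r / 8 := by
    rw [← dist_eq_norm]
    exact hδg _ (hmem w hw).1 _ (hmem w hw).2 (by simpa using hzδ)
  have h0 : (0 : Fin 2 → ℂ) ∈ Metric.ball (0 : Fin 2 → ℂ) (r / 2) :=
    Metric.mem_ball_self (by positivity)
  have hS := Complex.norm_fderiv_le_div_of_mapsTo_ball (f := fun w => g (z + w) - g (y + w))
    (c := 0) (R₁ := r / 2) (R₂ := ε * r / 4)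
    (fun w hw => (((differentiableAt_comp_add_left z).2 (hd w hw).1).fun_sub
      ((differentiableAt_comp_add_left y).2 (hd w hw).2)).differentiableWithinAt)
    (fun w hw => by
      rw [mem_closedBall_iff_norm]
      refine (norm_sub_le _ _).trans ?_
      linarith [hsmall w hw, hsmall 0 h0]) (by positivity)
  rw [fderiv_fun_sub ((differentiableAt_comp_add_left z).2 (hd 0 h0).1)
    ((differentiableAt_comp_add_left y).2 (hd 0 h0).2), fderiv_comp_add_left,
    fderiv_comp_add_left, add_zero, add_zero] at hS
  rw [dist_eq_norm]
  refine hS.trans_lt ?_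
  rw [div_lt_iff₀ (by positivity)]
  nlinarith

theorem DifferentiableOn.contDiffOn_one_of_isOpen {g : (Fin 2 → ℂ) → ℂ} {Ω : Set (Fin 2 → ℂ)}
    (hg : DifferentiableOn ℂ g Ω) (hΩ : IsOpen Ω) : ContDiffOn ℂ 1 g Ω := by
  rw [show (1 : WithTop ℕ∞) = 0 + 1 by simp, contDiffOn_succ_iff_fderiv_of_isOpen hΩ]
  exact ⟨hg, by simp, contDiffOn_zero.2 fun y hy =>
    (hg.continuousAt_fderiv hΩ hy).continuousWithinAt⟩

/-- `c` parametrizes the level set of `g` through `y` inside `W` by the coordinate `z j`. -/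
structure IsLevelChart (g : (Fin 2 → ℂ) → ℂ) (y : Fin 2 → ℂ) (j : Fin 2) (c : ℂ → Fin 2 → ℂ)
    (W : Set (Fin 2 → ℂ)) (r : ℝ) : Prop where
  isOpen : IsOpen W
  mem : y ∈ W
  pos : 0 < r
  differentiableOn : DifferentiableOn ℂ c (Metric.ball (y j) r)
  mapsTo : ∀ w ∈ Metric.ball (y j) r, c w ∈ W
  coord : ∀ w ∈ Metric.ball (y j) r, c w j = w
  value : ∀ w ∈ Metric.ball (y j) r, g (c w) = g y
  mem_ball : ∀ z ∈ W, g z = g y → z j ∈ Metric.ball (y j) r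
  inv : ∀ z ∈ W, g z = g y → c (z j) = z

theorem exists_levelChart {g : (Fin 2 → ℂ) → ℂ} {Ω : Set (Fin 2 → ℂ)}
    (hg : DifferentiableOn ℂ g Ω) (hΩ : IsOpen Ω) {y : Fin 2 → ℂ} (hy : y ∈ Ω)
    (hd : fderiv ℂ g y ≠ 0) : ∃ j : Fin 2, (∀ v, fderiv ℂ g y v = 0 → v j = 0 → v = 0) ∧
      ∀ V ∈ 𝓝 y, ∃ c W r, IsLevelChart g y j c W r ∧ W ⊆ V ∩ Ω := by
  have hgy := (hg.contDiffOn_one_of_isOpen hΩ).contDiffAt (hΩ.mem_nhds hy)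
  obtain ⟨j, hj⟩ : ∃ j : Fin 2, ∀ v, fderiv ℂ g y v = 0 → v j = 0 → v = 0 := by
    by_contra! h
    refine hd ?_
    obtain ⟨v, hv, hv0, hvn⟩ := h 0
    obtain ⟨w, hw, hw0, hwn⟩ := h 1
    have hv1 : v 1 ≠ 0 := fun h => hvn (by ext i; fin_cases i <;> simp [h, hv0])
    have hw1 : w 0 ≠ 0 := fun h => hwn (by ext i; fin_cases i <;> simp [h, hw0])
    ext u
    have : u = (u 0 / w 0) • w + (u 1 / v 1) • v := by
      ext i; fin_cases i <;> simp [hw0, hv0, hv1, hw1]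
    rw [this, map_add, map_smul, map_smul, hv, hw]
    simp
  refine ⟨j, hj, fun V hV => ?_⟩
  let L : (Fin 2 → ℂ) →L[ℂ] ℂ × ℂ := (ContinuousLinearMap.proj j).prod (fderiv ℂ g y)
  have hLinj : Function.Injective (L : (Fin 2 → ℂ) →ₗ[ℂ] ℂ × ℂ) := by
    refine (injective_iff_map_eq_zero _).2 fun v hv => ?_
    have := Prod.ext_iff.1 hv
    exact hj v this.2 this.1
  let e : (Fin 2 → ℂ) ≃L[ℂ] ℂ × ℂ :=
    (LinearMap.linearEquivOfInjective (L : (Fin 2 → ℂ) →ₗ[ℂ] ℂ × ℂ) hLinj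
      (by simp)).toContinuousLinearEquiv
  have hF : ContDiffAt ℂ 1 (fun z : Fin 2 → ℂ => (z j, g z)) y :=
    (contDiff_apply ℂ ℂ j).contDiffAt.prodMk hgy
  have hF' : HasFDerivAt (fun z : Fin 2 → ℂ => (z j, g z)) (e : (Fin 2 → ℂ) →L[ℂ] ℂ × ℂ) y := by
    have : (e : (Fin 2 → ℂ) →L[ℂ] ℂ × ℂ) = L := by ext v <;> rfl
    rw [this]
    exact (hasFDerivAt_apply j y).prodMk (hgy.differentiableAt (by simp)).hasFDerivAt
  set h := hF.toOpenPartialHomeomorph _ hF' one_ne_zero with hh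
  have hhc (z) : h z = (z j, g z) := rfl
  have hys : y ∈ h.source := hF.mem_toOpenPartialHomeomorph_source hF' one_ne_zero
  have hcd : ContDiffAt ℂ 1 (fun w => h.symm (w, g y)) (y j) :=
    ContDiffAt.comp (y j) (g := h.symm) (f := fun w => (w, g y))
      (hF.to_localInverse hF' one_ne_zero) (contDiffAt_id.prodMk contDiffAt_const)
  have hcy : h.symm (y j, g y) = y := h.left_inv hys
  have hVo : IsOpen (interior V ∩ Ω ∩ h.source) :=
    (isOpen_interior.inter hΩ).inter h.open_source
  have hyV : y ∈ interior V ∩ Ω ∩ h.source := ⟨⟨mem_interior_iff_mem_nhds.2 hV, hy⟩, hys⟩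
  have ev1 : ∀ᶠ w in 𝓝 (y j), h.symm (w, g y) ∈ interior V ∩ Ω ∩ h.source :=
    hcd.continuousAt.eventually_mem (by simpa only [hcy] using hVo.mem_nhds hyV)
  have ev2 : ∀ᶠ w in 𝓝 (y j), (w, g y) ∈ h.target :=
    (by fun_prop : Continuous fun w : ℂ => (w, g y)).continuousAt.eventually_mem
      (h.open_target.mem_nhds (h.map_source hys))
  have ev3 : ∀ᶠ w in 𝓝 (y j), DifferentiableAt ℂ (fun w => h.symm (w, g y)) w :=
    (hcd.eventually (by simp)).mono fun w hw => hw.differentiableAt (by simp)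
  obtain ⟨r, hr, hball⟩ := Metric.eventually_nhds_iff_ball.1 ((ev1.and ev2).and ev3)
  have hright (w) (hw : w ∈ Metric.ball (y j) r) := h.right_inv (hball w hw).1.2
  simp only [hhc] at hright
  refine ⟨fun w => h.symm (w, g y),
    (interior V ∩ Ω ∩ h.source) ∩ {z | z j ∈ Metric.ball (y j) r}, r,
    ⟨hVo.inter (Metric.isOpen_ball.preimage (continuous_apply j)), ⟨hyV, Metric.mem_ball_self hr⟩,
      hr, fun w hw => (hball w hw).2.differentiableWithinAt,
      fun w hw => ⟨(hball w hw).1.1, ?_⟩, fun w hw => (Prod.ext_iff.1 (hright w hw)).1,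
      fun w hw => (Prod.ext_iff.1 (hright w hw)).2, fun z hz _ => hz.2, fun z hz hgz => ?_⟩,
    fun z hz => ⟨interior_subset hz.1.1.1, hz.1.1.2⟩⟩
  · show h.symm (w, g y) j ∈ Metric.ball (y j) r
    rw [show h.symm (w, g y) j = w from (Prod.ext_iff.1 (hright w hw)).1]
    exact hw
  · show h.symm (z j, g y) = z
    rw [← hgz]
    exact h.left_inv hz.1.2

/-- The points at which every polynomial is dominated by one of its values on `Q`. For compact
nonempty `Q` this is the polynomial hull. -/
def attainedHull (Q : Set (Fin 2 → ℂ)) : Set (Fin 2 → ℂ) :=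
  {z | ∀ p : MvPolynomial (Fin 2) ℂ, ∃ y ∈ Q, ‖MvPolynomial.eval z p‖ ≤ ‖MvPolynomial.eval y p‖}

section hull

variable {Q : Set (Fin 2 → ℂ)}

theorem subset_attainedHull : Q ⊆ attainedHull Q := fun z hz _ => ⟨z, hz, le_rfl⟩

theorem polySep_attainedHull : PolySep (attainedHull Q) := by
  intro ζ hζ
  simp only [attainedHull, mem_ofPred_eq, not_forall, not_exists, not_and, not_le] at hζ
  obtain ⟨p, hp⟩ := hζ
  refine ⟨p, fun z hz => ?_⟩
  obtain ⟨y, hy, hzy⟩ := hz p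
  exact hzy.trans_lt (hp y hy)

theorem isCompact_attainedHull (hQ : IsCompact Q) : IsCompact (attainedHull Q) := by
  rcases Q.eq_empty_or_nonempty with rfl | hne
  · simp [attainedHull]
  have hmax (p : MvPolynomial (Fin 2) ℂ) := hQ.exists_isMaxOn hne
    (continuous_eval_mvPolynomial p).norm.continuousOn
  choose y hy hmax using hmax
  have heq : attainedHull Q =
      ⋂ p, {z | ‖MvPolynomial.eval z p‖ ≤ ‖MvPolynomial.eval (y p) p‖} := by
    ext z
    simp only [mem_iInter, mem_ofPred_eq, attainedHull]
    exact forall_congr' fun p => ⟨fun ⟨x, hx, hzx⟩ => hzx.trans (hmax p hx),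
      fun h => ⟨y p, hy p, h⟩⟩
  have hclosed : IsClosed (attainedHull Q) := by
    rw [heq]
    exact isClosed_iInter fun p => isClosed_le (continuous_eval_mvPolynomial p).norm continuous_const
  refine (isCompact_univ_pi fun j : Fin 2 => isCompact_closedBall (0 : ℂ)
    ‖MvPolynomial.eval (y (MvPolynomial.X j)) (MvPolynomial.X j)‖).of_isClosed_subset hclosed ?_
  intro z hz j _
  rw [heq] at hz
  simpa using mem_iInter.1 hz (MvPolynomial.X j)

/-- Off `Q`, the hull of `Q` is open in the level sets of a holomorphic function which is constant
on it. -/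
theorem eventually_mem_attainedHull {g : (Fin 2 → ℂ) → ℂ} {Ω : Set (Fin 2 → ℂ)}
    (hQ : IsCompact Q) (hg : DifferentiableOn ℂ g Ω) (hΩ : IsOpen Ω) {y : Fin 2 → ℂ} (hy : y ∈ Ω)
    (hyX : y ∈ attainedHull Q) (hyQ : y ∉ Q) (hd : fderiv ℂ g y ≠ 0)
    (hval : ∀ z ∈ attainedHull Q, z ∈ Ω → g z = g y) :
    ∀ᶠ z in 𝓝 y, g z = g y → z ∈ attainedHull Q := by
  have hX := isCompact_attainedHull hQ
  obtain ⟨j, -, hchart⟩ := exists_levelChart hg hΩ hy hd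
  obtain ⟨c, W, r, hc, hW⟩ := hchart Qᶜ (hQ.isClosed.isOpen_compl.mem_nhds hyQ)
  by_contra hcon
  have hr4 : 0 < r / 4 := by linarith [hc.pos]
  have ev : ∀ᶠ z in 𝓝 y, z ∈ W ∧ z j ∈ Metric.ball (y j) (r / 4) :=
    (hc.isOpen.eventually_mem hc.mem).and
      ((continuous_apply j).continuousAt.eventually_mem (Metric.ball_mem_nhds _ hr4))
  obtain ⟨z, hz, hzW, hzj⟩ := ((not_eventually.1 hcon).and_eventually ev).exists
  push Not at hz
  obtain ⟨hgz, hzX⟩ := hz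
  set w' := z j with hw'
  have hcw' : c w' = z := hc.inv z hzW hgz
  have hsub : Metric.closedBall w' (r / 2) ⊆ Metric.ball (y j) r := fun w hw => by
    have := dist_triangle w w' (y j)
    simp only [Metric.mem_closedBall, Metric.mem_ball] at *
    linarith [hc.pos]
  have hcc : ContinuousOn c (Metric.closedBall w' (r / 2)) :=
    hc.differentiableOn.continuousOn.mono hsub
  set A : Set ℂ := Metric.closedBall w' (r / 2) ∩ c ⁻¹' attainedHull Q with hA
  have hAc : IsCompact A := (isCompact_closedBall w' (r / 2)).of_isClosed_subset
    (hcc.preimage_isClosed_of_isClosed Metric.isClosed_closedBall hX.isClosed) inter_subset_left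
  have hyA : y j ∈ A := by
    constructor
    · rw [Metric.mem_closedBall, dist_comm]
      exact (Metric.mem_ball.1 hzj).le.trans (by linarith [hc.pos])
    · rw [mem_preimage, hc.inv y hc.mem rfl]
      exact hyX
  obtain ⟨w₀, hw₀, hmin⟩ := hAc.exists_isMinOn ⟨_, hyA⟩
    (by fun_prop : Continuous fun w => dist w w').continuousOn
  have hδ : dist w₀ w' < r / 4 := (hmin hyA).trans_lt (by
    show dist (y j) w' < r / 4
    rw [dist_comm]; exact hzj)
  have hδ0 : 0 < dist w₀ w' := dist_pos.2 fun h => hzX (by rw [← hcw', ← h]; exact hw₀.2)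
  set S₁ := c '' (A ∩ Metric.closedBall w' (r / 4)) with hS₁
  set S₂ := attainedHull Q \ (W ∩ {z | z j ∈ Metric.ball w' (r / 2)}) with hS₂
  have hS₁c : IsCompact S₁ := (hAc.inter_right Metric.isClosed_closedBall).image_of_continuousOn
    (hcc.mono fun w hw => hw.1.1)
  have hS₁W : ∀ z ∈ S₁, z ∈ W ∧ z j ∈ Metric.ball w' (r / 2) := by
    rintro _ ⟨w, hw, rfl⟩
    rw [hc.coord w (hsub hw.1.1)]
    exact ⟨hc.mapsTo w (hsub hw.1.1), Metric.closedBall_subset_ball (by linarith [hc.pos]) hw.2⟩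
  have hzc : ∀ z ∈ attainedHull Q, z ∈ W → c (z j) = z := fun z hz hzW =>
    hc.inv z hzW (hval z hz (hW hzW).2)
  have hO : IsOpen {z : Fin 2 → ℂ | z j - w' ≠ 0} :=
    isOpen_ne.preimage ((continuous_apply j).sub continuous_const)
  have key := polySep_attainedHull.norm_le_of_split hX hQ subset_attainedHull (fun z hz => hz) hS₁c.isClosed
    (S₂ := S₂) (hX.diff (hc.isOpen.inter (Metric.isOpen_ball.preimage
      (continuous_apply j)))).isClosed
    (disjoint_left.2 fun z h1 h2 => h2.2 (hS₁W z h1))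
    (fun z hz => Or.inr ⟨subset_attainedHull hz, fun h => (hW h.1).1 hz⟩) hO
    (fun z hz => by
      by_cases h : z ∈ W ∩ {z | z j ∈ Metric.ball w' (r / 2)}
      · refine Or.inl (sub_ne_zero.2 fun e => hzX ?_)
        rw [← hcw', ← e, hzc z hz h.1]
        exact hz
      · exact Or.inr ⟨hz, h⟩)
    (f := fun z => (z j - w')⁻¹) (fun z hz => (((differentiableAt_apply (𝕜 := ℂ) j z).sub_const
      w').fun_inv hz).differentiableWithinAt)
    (fun z hz => (((contDiff_apply ℝ ℂ j).contDiffAt.sub contDiffAt_const).inv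
      hz).contDiffWithinAt) (C := (r / 4)⁻¹) (by positivity)
    (fun z hz h1 h2 => by
      have h3 : z ∈ W ∩ {z | z j ∈ Metric.ball w' (r / 2)} := by
        by_contra h
        exact h2 ⟨hz, h⟩
      have h4 : z j ∉ Metric.closedBall w' (r / 4) := fun h => h1
        ⟨z j, ⟨⟨Metric.ball_subset_closedBall h3.2, by rw [mem_preimage, hzc z hz h3.1]; exact hz⟩,
          h⟩, hzc z hz h3.1⟩
      rw [Metric.mem_closedBall, not_le, dist_eq_norm] at h4
      rw [norm_inv]
      gcongr)
    (fun z hz h1 => absurd hz (hW (hS₁W z h1).1).1)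
    (c w₀) hw₀.2 ⟨w₀, ⟨hw₀, hδ.le⟩, rfl⟩
  simp only [hc.coord w₀ (hsub hw₀.1), norm_inv, ← dist_eq_norm] at key
  rw [inv_le_inv₀ hδ0 hr4] at key
  linarith

end hull

section level

variable {K : Set (Fin 2 → ℂ)} {g : (Fin 2 → ℂ) → ℂ} {x : Fin 2 → ℂ}

theorem exists_unifApprox_update (hg : UnifApprox K g) (hx : x ∈ attainedHull K) (hxK : x ∉ K) :
    ∃ w : ℂ, UnifApprox (insert x K) (Function.update g x w) := by
  have hpos (n : ℕ) : (0 : ℝ) < 1 / (n + 1) := Nat.one_div_pos_of_nat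
  choose p hp using fun n : ℕ => hg (1 / (n + 1)) (hpos n)
  have hcauchy : CauchySeq fun n => MvPolynomial.eval x (p n) := by
    refine cauchySeq_of_le_tendsto_0 (fun N : ℕ => 2 * (1 / ((N : ℝ) + 1))) (fun n m N hn hm => ?_)
      (by simpa using tendsto_one_div_add_atTop_nhds_zero_nat.const_mul (2 : ℝ))
    obtain ⟨y, hy, hxy⟩ := hx (p n - p m)
    rw [map_sub, map_sub] at hxy
    have h1 : ‖g y - MvPolynomial.eval y (p n)‖ ≤ 1 / ((N : ℝ) + 1) :=
      (hp n y hy).trans (by gcongr)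
    have h2 : ‖g y - MvPolynomial.eval y (p m)‖ ≤ 1 / ((N : ℝ) + 1) :=
      (hp m y hy).trans (by gcongr)
    have h3 := norm_sub_le (g y - MvPolynomial.eval y (p m)) (g y - MvPolynomial.eval y (p n))
    rw [sub_sub_sub_cancel_left] at h3
    rw [dist_eq_norm]
    linarith
  obtain ⟨w, hw⟩ := cauchySeq_tendsto_of_complete hcauchy
  refine ⟨w, fun ε hε => ?_⟩
  obtain ⟨n, h1, h2⟩ := ((Metric.tendsto_nhds.1 hw ε hε).and
    ((tendsto_order.1 tendsto_one_div_add_atTop_nhds_zero_nat).2 ε hε)).exists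
  refine ⟨p n, fun z hz => ?_⟩
  rcases hz with rfl | hz
  · rw [Function.update_self, ← dist_eq_norm, dist_comm]
    exact h1.le
  · rw [Function.update_of_ne (by rintro rfl; exact hxK hz)]
    exact (hp n z hz).trans h2.le

/-- A point of the hull of a compact subset of `{Re g = 0}` lies in the hull of the part of this
set in one level set of `g`. -/
theorem exists_mem_attainedHull_level (hK : IsCompact K) (hgK : ContinuousOn g K)
    (hg : UnifApprox K g) (hre : ∀ z ∈ K, (g z).re = 0) (hx : x ∈ attainedHull K) :
    ∃ w : ℂ, x ∈ attainedHull (K ∩ {z | g z = w}) := by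
  by_cases hxK : x ∈ K
  · exact ⟨g x, subset_attainedHull ⟨hxK, rfl⟩⟩
  obtain ⟨w, hw⟩ := exists_unifApprox_update hg hx hxK
  have hKX : K ⊆ insert x K := subset_insert x K
  have hX : IsCompact (insert x K) := hK.insert x
  have hupd : ∀ y ∈ K, Function.update g x w y = g y := fun y hy =>
    Function.update_of_ne (by rintro rfl; exact hxK hy) _ _
  have hne : K.Nonempty := (hx 0).imp fun y hy => hy.1
  have hwre : w.re = 0 := by
    by_contra h0
    obtain ⟨S, hS⟩ := hK.exists_bound_of_continuousOn hgK
    set R : ℝ := (S ^ 2 + 1) / (2 * w.re) with hR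
    have hRw : 2 * w.re * R = S ^ 2 + 1 := by rw [hR]; field_simp
    have h1 := (hw.add (UnifApprox.const _ (R : ℂ))).norm_le_of_forall hKX (mem_insert x K) hx
      (B := √(S ^ 2 + R ^ 2)) fun y hy => by
        rw [hupd y hy]
        refine Real.le_sqrt_of_sq_le ?_
        have h2 := pow_le_pow_left₀ (norm_nonneg _) (hS y hy) 2
        rw [← Complex.normSq_eq_norm_sq, Complex.normSq_apply] at h2 ⊢
        simp only [Complex.add_re, Complex.add_im, Complex.ofReal_re, Complex.ofReal_im,
          hre y hy] at h2 ⊢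
        nlinarith
    rw [Function.update_self] at h1
    have h2 := pow_le_pow_left₀ (norm_nonneg _) h1 2
    rw [Real.sq_sqrt (by positivity), ← Complex.normSq_eq_norm_sq, Complex.normSq_apply] at h2
    simp only [Complex.add_re, Complex.add_im, Complex.ofReal_re, Complex.ofReal_im] at h2
    nlinarith [sq_nonneg w.re, sq_nonneg w.im]
  obtain ⟨D, hD⟩ := hK.exists_bound_of_continuousOn (hgK.sub (continuousOn_const (c := w)))
  set c : ℝ := D ^ 2 + 1 with hc
  have hc0 : 0 < c := by positivity
  have hform : ∀ y ∈ K, ‖1 + (g y - w) ^ 2 * (c⁻¹ : ℝ)‖ = 1 - ‖g y - w‖ ^ 2 / c := by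
    intro y hy
    have e1 : g y - w = (((g y).im - w.im : ℝ) : ℂ) * Complex.I := by
      apply Complex.ext <;> simp [hre y hy, hwre]
    have e2 : 1 + (g y - w) ^ 2 * (c⁻¹ : ℝ) = ((1 - ‖g y - w‖ ^ 2 / c : ℝ) : ℂ) := by
      rw [e1, norm_mul, Complex.norm_I, mul_one, Complex.norm_real, mul_pow, Complex.I_sq,
        Real.norm_eq_abs, sq_abs]
      push_cast
      ring
    rw [e2, Complex.norm_real, Real.norm_of_nonneg]
    rw [sub_nonneg, div_le_one hc0]
    have : ‖g y - w‖ ^ 2 ≤ D ^ 2 := pow_le_pow_left₀ (norm_nonneg _) (hD y hy) 2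
    linarith
  have hle : ∀ y ∈ K, ‖1 + (g y - w) ^ 2 * (c⁻¹ : ℝ)‖ ≤ 1 := fun y hy => by
    rw [hform y hy]
    have : 0 ≤ ‖g y - w‖ ^ 2 / c := by positivity
    linarith
  have hlt : ∀ y ∈ K, g y ≠ w → ‖1 + (g y - w) ^ 2 * (c⁻¹ : ℝ)‖ < 1 := fun y hy hyw => by
    rw [hform y hy]
    have : 0 < ‖g y - w‖ := norm_pos_iff.2 (sub_ne_zero.2 hyw)
    have : 0 < ‖g y - w‖ ^ 2 / c := by positivity
    linarith
  have hhc : ContinuousOn (fun y => ‖1 + (g y - w) ^ 2 * (c⁻¹ : ℝ)‖) K :=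
    (continuousOn_const.add (((hgK.sub continuousOn_const).pow 2).mul continuousOn_const)).norm
  have main (p : MvPolynomial (Fin 2) ℂ) (hp : MvPolynomial.eval x p ≠ 0) :
      ∃ y ∈ K ∩ {z | g z = w}, ‖MvPolynomial.eval x p‖ ≤ ‖MvPolynomial.eval y p‖ := by
    by_contra! hcon
    have hpc := (continuous_eval_mvPolynomial p).norm
    have hT : IsCompact (K ∩ {y | ‖MvPolynomial.eval x p‖ ≤ ‖MvPolynomial.eval y p‖}) :=
      hK.inter_right (isClosed_le continuous_const hpc)
    obtain ⟨ρ, hρ0, hρ1, hρ⟩ : ∃ ρ : ℝ, 0 ≤ ρ ∧ ρ < 1 ∧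
        ∀ y ∈ K ∩ {y | ‖MvPolynomial.eval x p‖ ≤ ‖MvPolynomial.eval y p‖},
          ‖1 + (g y - w) ^ 2 * (c⁻¹ : ℝ)‖ ≤ ρ := by
      rcases (K ∩ {y | ‖MvPolynomial.eval x p‖ ≤ ‖MvPolynomial.eval y p‖}).eq_empty_or_nonempty
        with he | hTne
      · exact ⟨0, le_rfl, one_pos, by simp [he]⟩
      · obtain ⟨y, hy, hmax⟩ := hT.exists_isMaxOn hTne (hhc.mono inter_subset_left)
        exact ⟨_, norm_nonneg _, hlt y hy.1 fun h => (hcon y ⟨hy.1, h⟩).not_ge hy.2,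
          fun z hz => hmax hz⟩
    obtain ⟨A, hA⟩ := hK.exists_bound_of_continuousOn (continuous_eval_mvPolynomial p).continuousOn
    have hA0 : 0 ≤ A := (norm_nonneg _).trans (hA _ hne.some_mem)
    have hpx : 0 < ‖MvPolynomial.eval x p‖ := norm_pos_iff.2 hp
    obtain ⟨k, hk⟩ := exists_pow_lt_of_lt_one (div_pos hpx (by linarith : 0 < A + 1)) hρ1
    rw [lt_div_iff₀ (by linarith)] at hk
    have hbound : ∀ y ∈ K, ‖MvPolynomial.eval y p‖ * ‖1 + (g y - w) ^ 2 * (c⁻¹ : ℝ)‖ ^ k <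
        ‖MvPolynomial.eval x p‖ := by
      intro y hy
      by_cases hyT : ‖MvPolynomial.eval x p‖ ≤ ‖MvPolynomial.eval y p‖
      · calc ‖MvPolynomial.eval y p‖ * ‖1 + (g y - w) ^ 2 * (c⁻¹ : ℝ)‖ ^ k ≤ A * ρ ^ k := by
              have := hA y hy
              have := hρ y ⟨hy, hyT⟩
              gcongr
          _ ≤ ρ ^ k * (A + 1) := by nlinarith [pow_nonneg hρ0 k]
          _ < _ := hk
      · refine (mul_le_of_le_one_right (norm_nonneg _) ?_).trans_lt (not_le.1 hyT)
        exact pow_le_one₀ (norm_nonneg _) (hle y hy)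
    obtain ⟨y₁, hy₁, hmax⟩ := hK.exists_isMaxOn hne (hpc.continuousOn.mul (hhc.pow k))
    have hu := (UnifApprox.eval (insert x K) p).mul hX (((UnifApprox.const _ 1).add
      (((hw.sub hX (UnifApprox.const _ w)).pow hX 2).mul hX
        (UnifApprox.const _ ((c⁻¹ : ℝ) : ℂ)))).pow hX k)
    have := hu.norm_le_of_forall hKX (mem_insert x K) hx (B := ‖MvPolynomial.eval y₁ p‖ *
      ‖1 + (g y₁ - w) ^ 2 * (c⁻¹ : ℝ)‖ ^ k) fun y hy => by
        rw [hupd y hy, norm_mul, norm_pow]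
        exact hmax hy
    rw [Function.update_self] at this
    simp only [sub_self, ne_eq, OfNat.ofNat_ne_zero, not_false_eq_true, zero_pow, zero_mul,
      add_zero, one_pow, mul_one] at this
    exact (this.trans_lt (hbound y₁ hy₁)).false
  refine ⟨w, fun p => ?_⟩
  by_cases hp : MvPolynomial.eval x p = 0
  · obtain ⟨y, hy, -⟩ := main 1 (by simp)
    exact ⟨y, hy, by simp [hp]⟩
  · exact main p hp

theorem eq_of_mem_attainedHull (hg : UnifApprox (insert x K) g) (hK : IsCompact K) {w : ℂ}
    (hw : ∀ z ∈ K, g z = w) (hx : x ∈ attainedHull K) : g x = w := by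
  have h := (hg.sub (hK.insert x) (UnifApprox.const _ w)).norm_le_of_forall (subset_insert x K)
    (mem_insert x K) hx (B := 0) fun y hy => by rw [hw y hy, sub_self, norm_zero]
  exact sub_eq_zero.1 (norm_le_zero_iff.1 h)

end level

theorem norm_toLp_le_of_forall_polynomial {T : Set (Fin 2 → ℂ)} {y : Fin 2 → ℂ} {R : ℝ}
    (hR : ∀ z ∈ T, ‖WithLp.toLp 2 z‖ ≤ R) (hR0 : 0 ≤ R)
    (hy : ∀ (p : MvPolynomial (Fin 2) ℂ) (C : ℝ), 0 ≤ C → (∀ z ∈ T, ‖MvPolynomial.eval z p‖ ≤ C) →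
      ‖MvPolynomial.eval y p‖ ≤ C) : ‖WithLp.toLp 2 y‖ ≤ R := by
  have hev (z : Fin 2 → ℂ) : MvPolynomial.eval z
      (∑ i, MvPolynomial.C (conj (y i)) * MvPolynomial.X i) =
        inner ℂ (WithLp.toLp 2 y) (WithLp.toLp 2 z) := by
    simp [PiLp.inner_apply, mul_comm]
  have h := hy (∑ i, MvPolynomial.C (conj (y i)) * MvPolynomial.X i) (‖WithLp.toLp 2 y‖ * R)
    (by positivity) fun z hz => by
      rw [hev]
      refine (norm_inner_le_norm _ _).trans ?_
      gcongr
      exact hR z hz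
  rw [hev, inner_self_eq_norm_sq_to_K, norm_pow, RCLike.norm_ofReal, abs_norm, sq] at h
  by_contra! hlt
  have : 0 < ‖WithLp.toLp 2 y‖ := hR0.trans_lt hlt
  exact (le_of_mul_le_mul_left h this).not_gt hlt

/-- If near every point of `Q` the hull of `Q` either reduces to `Q` or fills the level set, then
`Q` is polynomially convex. -/
theorem attainedHull_subset_of_dichotomy {g : (Fin 2 → ℂ) → ℂ} {Ω Q : Set (Fin 2 → ℂ)} {t : ℂ}
    (hQ : IsCompact Q) (hg : DifferentiableOn ℂ g Ω) (hΩ : IsOpen Ω) (hQΩ : Q ⊆ Ω)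
    (hd : ∀ z ∈ Q, fderiv ℂ g z ≠ 0) (hgQ : ∀ z ∈ Q, g z = t)
    (hacc : ∀ z ∈ Q, ∃ᶠ u in 𝓝 z, g u = t ∧ u ∉ Q)
    (hdich : ∀ z ∈ Q, (∀ᶠ u in 𝓝 z, u ∈ attainedHull Q → u ∈ Q) ∨
      ∀ᶠ u in 𝓝 z, g u = t → u ∈ attainedHull Q) : attainedHull Q ⊆ Q := by
  have hX := isCompact_attainedHull hQ
  set X := attainedHull Q with hXdef
  set T₀ := {z | ∀ᶠ u in 𝓝 z, u ∈ X → u ∈ Q} with hT₀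
  set T₂ := {z | ∀ᶠ u in 𝓝 z, g u = t → u ∈ X} with hT₂
  have hT₀o : IsOpen T₀ := isOpen_setOfPred_eventually_nhds
  have hT₂o : IsOpen T₂ := isOpen_setOfPred_eventually_nhds
  have hexcl : ∀ z ∈ Q, z ∈ T₀ → z ∉ T₂ := by
    intro z hz h0 h2
    obtain ⟨u, hu, h0, h2⟩ := ((hacc z hz).and_eventually (h0.and h2)).exists
    exact hu.2 (h0 (h2 hu.1))
  have hsplit (p : MvPolynomial (Fin 2) ℂ) (C : ℝ) (hC : 0 ≤ C)
      (hp : ∀ z ∈ Q \ T₀, ‖MvPolynomial.eval z p‖ ≤ C) :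
      ∀ z ∈ X, z ∉ T₀ → ‖MvPolynomial.eval z p‖ ≤ C := by
    intro z hz hz0
    refine polySep_attainedHull.norm_le_of_split hX hQ subset_attainedHull (fun z hz => hz)
      (S₁ := X \ T₀) (S₂ := Q \ T₂) (O := univ) (f := fun z => MvPolynomial.eval z p)
      (hX.diff hT₀o).isClosed (hQ.diff hT₂o).isClosed
      (disjoint_left.2 fun z h1 h2 => (hdich z h2.1).elim h1.2 h2.2) (fun z hz => ?_) isOpen_univ
      (fun z _ => Or.inl (mem_univ z))
      ((contDiff_eval_mvPolynomial p).differentiable (by simp)).differentiableOn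
      ((contDiff_eval_mvPolynomial p).restrict_scalars ℝ).contDiffOn hC (fun z hz h1 h2 => ?_)
      (fun z hz h1 => hp z ⟨hz, h1.2⟩) z hz ⟨hz, hz0⟩
    · by_cases h : z ∈ T₀
      · exact Or.inr ⟨hz, hexcl z hz h⟩
      · exact Or.inl ⟨subset_attainedHull hz, h⟩
    · have h0 : z ∈ T₀ := by
        by_contra h
        exact h1 ⟨hz, h⟩
      have hzQ : z ∈ Q := h0.self_of_nhds hz
      exact absurd ⟨hzQ, hexcl z hzQ h0⟩ h2
  have hT : IsCompact (Q \ T₀) := hQ.diff hT₀o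
  rcases (Q \ T₀).eq_empty_or_nonempty with he | hne
  · intro z hz
    by_cases h : z ∈ T₀
    · exact h.self_of_nhds hz
    · have := hsplit 1 0 le_rfl (by simp [he]) z hz h
      simp only [map_one, norm_one] at this
      linarith
  exfalso
  obtain ⟨κ, hκ, hmax⟩ := hT.exists_isMaxOn hne
    (PiLp.continuous_toLp 2 (fun _ : Fin 2 => ℂ)).norm.continuousOn
  have hκ2 : κ ∈ T₂ := (hdich κ hκ.1).resolve_left hκ.2
  have hnorm : ∀ z ∈ X, z ∉ T₀ → ‖WithLp.toLp 2 z‖ ≤ ‖WithLp.toLp 2 κ‖ := fun z hz hz0 =>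
    norm_toLp_le_of_forall_polynomial (fun y hy => hmax hy) (norm_nonneg _)
      fun p C hC hp => hsplit p C hC hp z hz hz0
  obtain ⟨j, -, hchart⟩ := exists_levelChart hg hΩ (hQΩ hκ.1) (hd κ hκ.1)
  obtain ⟨c, W, r, hc, -⟩ := hchart univ univ_mem
  have hball := Metric.ball_mem_nhds (κ j) hc.pos
  have hcd : ∀ᶠ w in 𝓝 (κ j), DifferentiableAt ℂ c w :=
    (hc.differentiableOn.eventually_differentiableAt hball)
  have hcκ : c (κ j) = κ := hc.inv κ hc.mem rfl
  have hct : Tendsto c (𝓝 (κ j)) (𝓝 κ) := by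
    have := hcd.self_of_nhds.continuousAt
    rwa [ContinuousAt, hcκ] at this
  have hT₂c : ∀ᶠ u in 𝓝 κ, u ∈ T₂ := hT₂o.mem_nhds hκ2
  have hloc : IsLocalMax (norm ∘ fun w => WithLp.toLp 2 (c w)) (κ j) := by
    filter_upwards [hct.eventually hT₂c, hball] with w h2 hw
    have hwX : c w ∈ X := h2.self_of_nhds (by rw [hc.value w hw, hgQ κ hκ.1])
    simp only [Function.comp, hcκ]
    refine hnorm _ hwX fun h0 => ?_
    exact hexcl _ (h0.self_of_nhds hwX) h0 h2
  have hconst := Complex.eventually_eq_of_isLocalMax_norm (hcd.mono fun w hw =>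
    ((PiLp.continuousLinearEquiv 2 ℂ (fun _ : Fin 2 => ℂ)).symm.differentiableAt.comp w hw)) hloc
  have hid : ∀ᶠ w in 𝓝 (κ j), w = κ j := by
    filter_upwards [hconst, hball] with w hw hwb
    have : c w = c (κ j) := (WithLp.toLp_injective 2) hw
    rw [← hc.coord w hwb, this, hcκ]
  obtain ⟨w, h1, h2⟩ := ((hid.filter_mono
    (nhdsWithin_le_nhds (s := ({κ j}ᶜ : Set ℂ)))).and self_mem_nhdsWithin).exists
  exact h2 h1

theorem exists_continuous_lift_addCircle {E : ℝ × ℝ → AddCircle (1 : ℝ)} (hE : Continuous E) :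
    ∃ e : ℝ × ℝ → ℝ, Continuous e ∧ ∀ x, (e x : AddCircle (1 : ℝ)) = E x := by
  obtain ⟨e₀, he₀⟩ := QuotientAddGroup.mk_surjective (E 0)
  obtain ⟨F, ⟨-, hF⟩, -⟩ := (AddCircle.isCoveringMap_coe (1 : ℝ)).existsUnique_continuousMap_lifts
    ⟨E, hE⟩ 0 e₀ he₀
  exact ⟨F, F.continuous, fun x => congrFun hF x⟩

theorem isPreconnected_compl_closedBall_zero :
    IsPreconnected (Metric.closedBall (0 : ℝ × ℝ) 1)ᶜ := by
  have h1 : 1 < Module.rank ℝ (ℝ × ℝ) := by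
    rw [rank_prod', Module.rank_self]
    norm_num
  have hs := (isConnected_sphere h1 (0 : ℝ × ℝ) zero_le_one).isPreconnected
  have himg : (Metric.closedBall (0 : ℝ × ℝ) 1)ᶜ =
      (fun q : ℝ × (ℝ × ℝ) => q.1 • q.2) '' (Ioi (1 : ℝ) ×ˢ Metric.sphere (0 : ℝ × ℝ) 1) := by
    ext x
    simp only [mem_compl_iff, mem_closedBall_zero_iff, not_le, mem_image, mem_prod, mem_Ioi,
      mem_sphere_zero_iff_norm, Prod.exists]
    constructor
    · intro hx
      have hx0 : ‖x‖ ≠ 0 := by linarith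
      refine ⟨‖x‖, (‖x‖⁻¹ • x).1, (‖x‖⁻¹ • x).2, ⟨hx, ?_⟩, ?_⟩
      · rw [Prod.mk.eta, norm_smul, norm_inv, norm_norm, inv_mul_cancel₀ hx0]
      · rw [Prod.mk.eta, smul_smul, mul_inv_cancel₀ hx0, one_smul]
    · rintro ⟨a, b, c, ⟨ha, hbc⟩, rfl⟩
      rw [norm_smul, hbc, mul_one, Real.norm_eq_abs]
      exact ha.trans_le (le_abs_self a)
  rw [himg]
  exact (isPreconnected_Ioi.prod hs).image _ (by fun_prop)

/-- A submersion on a neighbourhood of a compact set with connected complement has no compact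
relatively open piece of a level curve inside that set. -/
theorem eq_empty_of_isCompact_of_relOpen_zeroLocus {f : ℝ × ℝ → ℝ} {U S C : Set (ℝ × ℝ)}
    (hU : IsOpen U) (hS : IsCompact S) (hSU : S ⊆ U) (hSc : IsPreconnected Sᶜ)
    (hf : ContinuousOn f U) (hd : ∀ x ∈ U, fderiv ℝ f x ≠ 0) (hC : IsCompact C) (hCS : C ⊆ S)
    (hzero : ∀ x ∈ C, f x = 0) (hopen : ∀ x ∈ C, ∀ᶠ y in 𝓝 x, f y = 0 → y ∈ C) : C = ∅ := by
  by_contra hne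
  obtain ⟨c, hcC⟩ := nonempty_iff_ne_empty.2 hne
  have hfa : ∀ x ∈ U, ContinuousAt f x := fun x hx => hf.continuousAt (hU.mem_nhds hx)
  set V := {x | ∀ᶠ y in 𝓝 x, f y = 0 → y ∈ C} with hV
  have hVo : IsOpen V := isOpen_setOfPred_eventually_nhds
  have hVC : ∀ x ∈ V, f x = 0 → x ∈ C := fun x hx h0 => hx.self_of_nhds h0
  obtain ⟨L, hL, hCL, hLV⟩ := exists_compact_between hC (hVo.inter hU)
    fun x hx => ⟨hopen x hx, hSU (hCS hx)⟩
  set N := interior L with hN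
  have hNo : IsOpen N := isOpen_interior
  have hNL : N ⊆ L := interior_subset
  obtain ⟨δ, hδ, hfδ⟩ : ∃ δ : ℝ, 0 < δ ∧ ∀ x ∈ L \ N, δ < |f x| := by
    rcases (L \ N).eq_empty_or_nonempty with he | hn
    · exact ⟨1, one_pos, by simp [he]⟩
    · obtain ⟨y, hy, hmin⟩ := (hL.diff hNo).exists_isMinOn hn (f := fun x => |f x|)
        (fun x hx => ((hfa x (hLV hx.1).2).abs).continuousWithinAt)
      have hy0 : 0 < |f y| := abs_pos.2 fun h0 => hy.2 (hCL (hVC y (hLV hy.1).1 h0))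
      exact ⟨|f y| / 2, by positivity, fun x hx => by
        have : |f y| ≤ |f x| := hmin hx
        linarith⟩
  set ρ : ℝ → ℝ := fun s => max 0 (min 1 ((s / δ + 1) / 2)) with hρ
  have hρc : Continuous ρ := by fun_prop
  have hρ1 : ∀ s, δ < s → ρ s = 1 := by
    intro s hs
    have : 1 < s / δ := (one_lt_div hδ).2 hs
    simp only [hρ]
    rw [min_eq_left (by linarith), max_eq_right zero_le_one]
  have hρ0 : ∀ s, s < -δ → ρ s = 0 := by
    intro s hs
    have : s / δ < -1 := by rw [div_lt_iff₀ hδ]; linarith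
    simp only [hρ]
    exact max_eq_left ((min_le_right _ _).trans (by linarith))
  set H : ℝ → ℝ := fun s => if 0 < s then 1 else 0 with hH
  have hHint : ∀ s, ((H s : ℝ) : AddCircle (1 : ℝ)) = 0 := by
    intro s
    simp only [hH]
    split_ifs
    · exact AddCircle.coe_period 1
    · rfl
  have hρH : ∀ s, δ < |s| → ρ s = H s := by
    intro s hs
    rcases lt_abs.1 hs with h | h
    · rw [hρ1 s h]
      simp only [hH]
      rw [if_pos (hδ.trans h)]
    · rw [hρ0 s (by linarith)]
      simp only [hH]
      rw [if_neg (by linarith)]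
  have hHev : ∀ x ∈ U, f x ≠ 0 → ∀ᶠ y in 𝓝 x, H (f y) = H (f x) := by
    intro x hx h0
    rcases h0.lt_or_gt with h | h
    · filter_upwards [(hfa x hx).eventually_lt_const h] with y hy
      simp only [hH]
      rw [if_neg (by linarith), if_neg (by linarith)]
    · filter_upwards [(hfa x hx).eventually_const_lt h] with y hy
      simp only [hH]
      rw [if_pos hy, if_pos h]
  have hout : ∀ x ∉ N, ∀ᶠ y in 𝓝 x, y ∈ N → δ < |f y| := by
    intro x hx
    by_cases hxL : x ∈ L
    · filter_upwards [(hfa x (hLV hxL).2).abs.eventually_const_lt (hfδ x ⟨hxL, hx⟩)] with y hy _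
      exact hy
    · filter_upwards [hL.isClosed.isOpen_compl.mem_nhds hxL] with y hy hyN
      exact absurd (hNL hyN) hy
  classical
  set E : ℝ × ℝ → AddCircle (1 : ℝ) := fun x => if x ∈ N then ((ρ (f x) : ℝ) : AddCircle (1 : ℝ)) else 0
    with hE
  have hEc : Continuous E := by
    rw [continuous_iff_continuousAt]
    intro x
    by_cases hx : x ∈ N
    · have : ContinuousAt (fun y => ((ρ (f y) : ℝ) : AddCircle (1 : ℝ))) x :=
        (AddCircle.continuous_mk' (1 : ℝ)).continuousAt.comp
          (hρc.continuousAt.comp (hfa x (hLV (hNL hx)).2))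
      refine this.congr ?_
      filter_upwards [hNo.mem_nhds hx] with y hy
      simp only [hE]
      rw [if_pos hy]
    · refine (continuousAt_const (y := (0 : AddCircle (1 : ℝ)))).congr ?_
      filter_upwards [hout x hx] with y hy
      simp only [hE]
      split_ifs with h
      · rw [hρH _ (hy h), hHint]
      · rfl
  obtain ⟨e, hec, he⟩ := exists_continuous_lift_addCircle hEc
  set d : ℝ × ℝ → ℝ := fun x => if x ∈ N then ρ (f x) - H (f x) else 0 with hd'
  have hdc : ∀ x ∉ C, ContinuousAt d x := by
    intro x hxC
    by_cases hx : x ∈ N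
    · have hxU := (hLV (hNL hx)).2
      have h0 : f x ≠ 0 := fun h0 => hxC (hVC x (hLV (hNL hx)).1 h0)
      have : ContinuousAt (fun y => ρ (f y) - H (f x)) x :=
        (hρc.continuousAt.comp (hfa x hxU)).sub continuousAt_const
      refine this.congr ?_
      filter_upwards [hNo.mem_nhds hx, hHev x hxU h0] with y hy hyH
      simp only [hd']
      rw [if_pos hy, hyH]
    · refine (continuousAt_const (y := (0 : ℝ))).congr ?_
      filter_upwards [hout x hx] with y hy
      simp only [hd']
      split_ifs with h
      · rw [hρH _ (hy h), sub_self]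
      · rfl
  set k : ℝ × ℝ → ℝ := fun x => e x - d x with hk
  have hkint : ∀ x, ∃ n : ℤ, k x = n := by
    intro x
    have h0 : ((k x : ℝ) : AddCircle (1 : ℝ)) = 0 := by
      simp only [hk, AddCircle.coe_sub, he, hE, hd']
      split_ifs
      · rw [AddCircle.coe_sub, hHint, sub_zero, sub_self]
      · simp
    obtain ⟨n, hn⟩ := AddCircle.coe_eq_zero_iff (1 : ℝ) |>.1 h0
    exact ⟨n, by simpa using hn.symm⟩
  have hkeq : ∀ x y, |k x - k y| < 1 → k x = k y := by
    intro x y h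
    obtain ⟨n, hn⟩ := hkint x
    obtain ⟨m, hm⟩ := hkint y
    rw [hn, hm] at h ⊢
    have : |n - m| < 1 := by exact_mod_cast h
    rw [Int.abs_lt_one_iff, sub_eq_zero] at this
    rw [this]
  have hkc : ∀ x ∉ C, ContinuousAt k x := fun x hx => hec.continuousAt.sub (hdc x hx)
  have hkev : ∀ x ∉ C, ∀ᶠ y in 𝓝 x, k y = k x := by
    intro x hx
    filter_upwards [(hkc x hx).eventually (Metric.ball_mem_nhds (k x) one_pos)] with y hy
    exact hkeq y x hy
  have hScC : Sᶜ ⊆ Cᶜ := compl_subset_compl.2 hCS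
  obtain ⟨k₀, hk₀⟩ : ∃ k₀ : ℝ, ∀ x ∈ Sᶜ, k x = k₀ := by
    rcases (Sᶜ).eq_empty_or_nonempty with hemp | ⟨x₀, hx₀⟩
    · exact ⟨0, by simp [hemp]⟩
    · refine ⟨k x₀, fun x hx => ?_⟩
      exact hSc.constant_of_mapsTo Int.isClosedEmbedding_coe_real.isInducing.isDiscrete_range
        (f := k) (fun y hy => (hkc y (hScC hy)).continuousWithinAt)
        (fun y _ => (hkint y).imp fun n hn => hn.symm) hx hx₀
  have hcU := hSU (hCS hcC)
  obtain ⟨x₁, hx₁C, hx₁⟩ : ∃ x ∉ C, k x ≠ k₀ := by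
    have hu : ContinuousAt (fun y => e y - ρ (f y)) c :=
      hec.continuousAt.sub (hρc.continuousAt.comp (hfa c hcU))
    have hev : ∀ᶠ y in 𝓝 c, |(e y - ρ (f y)) - (e c - ρ (f c))| < 1 / 2 ∧ y ∈ N :=
      (hu.eventually (Metric.ball_mem_nhds _ (by norm_num))).and (hNo.eventually_mem (hCL hcC))
    obtain ⟨p, hp, hpf⟩ : ∃ p, (|(e p - ρ (f p)) - (e c - ρ (f c))| < 1 / 2 ∧ p ∈ N) ∧ 0 < f p := by
      by_contra! hcon
      have : IsLocalMax f c := by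
        filter_upwards [hev] with y hy
        rw [hzero c hcC]
        exact hcon y hy
      exact hd c hcU this.fderiv_eq_zero
    obtain ⟨q, hq, hqf⟩ : ∃ q, (|(e q - ρ (f q)) - (e c - ρ (f c))| < 1 / 2 ∧ q ∈ N) ∧ f q < 0 := by
      by_contra! hcon
      have : IsLocalMin f c := by
        filter_upwards [hev] with y hy
        rw [hzero c hcC]
        exact hcon y hy
      exact hd c hcU this.fderiv_eq_zero
    have hkp : k p = e p - ρ (f p) + 1 := by
      simp only [hk, hd', hH]
      rw [if_pos hp.2, if_pos hpf]
      ring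
    have hkq : k q = e q - ρ (f q) := by
      simp only [hk, hd', hH]
      rw [if_pos hq.2, if_neg hqf.not_gt]
      ring
    by_contra! hcon
    have h1 := hcon p fun h => hpf.ne' (hzero p h)
    have h2 := hcon q fun h => hqf.ne (hzero q h)
    have := abs_lt.1 hp.1
    have := abs_lt.1 hq.1
    linarith
  set O := {x | x ∉ C ∧ k x ≠ k₀} with hO
  have hOo : IsOpen O := by
    rw [isOpen_iff_mem_nhds]
    rintro x ⟨hx, hxk⟩
    filter_upwards [hC.isClosed.isOpen_compl.mem_nhds hx, hkev x hx] with y hy hyk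
    exact ⟨hy, hyk ▸ hxk⟩
  have hOS : O ⊆ S := fun x hx => by
    by_contra h
    exact hx.2 (hk₀ x h)
  have hclS : closure O ⊆ S := closure_minimal hOS hS.isClosed
  have hcl : ∀ x ∈ closure O, x ∈ O ∨ f x = 0 := by
    intro x hx
    by_cases hxC : x ∈ C
    · exact Or.inr (hzero x hxC)
    · obtain ⟨y, hyO, hyk⟩ := (mem_closure_iff_frequently.1 hx).and_eventually (hkev x hxC) |>.exists
      exact Or.inl ⟨hxC, hyk ▸ hyO.2⟩
  have hcomp : IsCompact (closure O) := hS.of_isClosed_subset isClosed_closure hclS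
  have hneO : (closure O).Nonempty := ⟨x₁, subset_closure ⟨hx₁C, hx₁⟩⟩
  have hfcl : ContinuousOn f (closure O) := hf.mono (hclS.trans hSU)
  obtain ⟨a, ha, hamax⟩ := hcomp.exists_isMaxOn hneO hfcl
  obtain ⟨b, hb, hbmin⟩ := hcomp.exists_isMinOn hneO hfcl
  have hcrit : ∀ x ∈ O, ¬ IsLocalExtr f x := fun x hx h =>
    hd x (hSU (hOS hx)) h.fderiv_eq_zero
  have ha0 : f a = 0 := (hcl a ha).resolve_left fun h => hcrit a h (Or.inr (by
    filter_upwards [hOo.mem_nhds h] with y hy using hamax (subset_closure hy)))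
  have hb0 : f b = 0 := (hcl b hb).resolve_left fun h => hcrit b h (Or.inl (by
    filter_upwards [hOo.mem_nhds h] with y hy using hbmin (subset_closure hy)))
  have hO0 : ∀ x ∈ O, f x = 0 := fun x hx =>
    le_antisymm (ha0 ▸ hamax (subset_closure hx)) (hb0 ▸ hbmin (subset_closure hx))
  refine hcrit x₁ ⟨hx₁C, hx₁⟩ (Or.inr ?_)
  filter_upwards [hOo.mem_nhds ⟨hx₁C, hx₁⟩] with y hy
  rw [hO0 y hy, hO0 x₁ ⟨hx₁C, hx₁⟩]

theorem exists_smul_eq_of_apply_eq_zero {θ : ℝ × ℝ →L[ℝ] ℝ} (hθ : θ ≠ 0) :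
    ∃ (v₀ : ℝ × ℝ) (v₁ : ℝ × ℝ) (l : ℝ × ℝ →L[ℝ] ℝ), v₀ ≠ 0 ∧ θ v₀ = 0 ∧ θ v₁ = 1 ∧
      ∀ v, v = l v • v₀ + θ v • v₁ := by
  set a := θ (1, 0) with ha
  set b := θ (0, 1) with hb
  have hθv : ∀ v : ℝ × ℝ, θ v = v.1 * a + v.2 * b := by
    intro v
    have : v = v.1 • ((1 : ℝ), (0 : ℝ)) + v.2 • ((0 : ℝ), (1 : ℝ)) := by ext <;> simp
    conv_lhs => rw [this]
    rw [map_add, map_smul, map_smul, smul_eq_mul, smul_eq_mul]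
  have hab : a ^ 2 + b ^ 2 ≠ 0 := by
    intro h
    have h1 : a = 0 := by nlinarith [sq_nonneg a, sq_nonneg b]
    have h2 : b = 0 := by nlinarith [sq_nonneg a, sq_nonneg b]
    exact hθ (by ext <;> simp [hθv, h1, h2])
  refine ⟨(-b, a), (a ^ 2 + b ^ 2)⁻¹ • (a, b), (a ^ 2 + b ^ 2)⁻¹ •
    (a • ContinuousLinearMap.snd ℝ ℝ ℝ - b • ContinuousLinearMap.fst ℝ ℝ ℝ), ?_, ?_, ?_, ?_⟩
  · intro h
    rw [Prod.mk_eq_zero, neg_eq_zero] at h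
    exact hab (by rw [h.1, h.2]; ring)
  · rw [hθv]; ring
  · rw [hθv]
    simp only [Prod.smul_mk, smul_eq_mul]
    field_simp
  · intro v
    rw [hθv]
    ext
    · simp
      field_simp
      ring
    · simp
      field_simp
      ring

theorem apply_ne_zero_of_totallyReal {A : ℝ × ℝ →L[ℝ] (Fin 2 → ℂ)} {D : (Fin 2 → ℂ) →L[ℂ] ℂ}
    {j : Fin 2} {θ : ℝ × ℝ →L[ℝ] ℝ} (hA : Function.Injective A)
    (htr : ∀ v w, A v = Complex.I • A w → A v = 0) (hj : ∀ v, D v = 0 → v j = 0 → v = 0)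
    (hθ : ∀ v, D (A v) = θ v * Complex.I) : θ ≠ 0 := by
  rintro rfl
  have hker : ∀ v, D (A v) = 0 := fun v => by simp [hθ]
  let B : ℝ × ℝ →ₗ[ℝ] ℂ :=
    ((ContinuousLinearMap.proj (R := ℝ) (φ := fun _ : Fin 2 => ℂ) j).comp A : ℝ × ℝ →L[ℝ] ℂ)
  have hBv : ∀ v, B v = A v j := fun v => rfl
  have hB : Function.Injective B := by
    rw [injective_iff_map_eq_zero]
    intro v hv
    exact hA (by rw [hj _ (hker v) hv, map_zero])
  have hsurj : Function.Surjective B :=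
    (LinearMap.injective_iff_surjective_of_finrank_eq_finrank (by simp)).1 hB
  obtain ⟨v, hv⟩ := hsurj (Complex.I * A (1, 0) j)
  have h : A v = Complex.I • A (1, 0) := by
    rw [← sub_eq_zero]
    refine hj _ (by rw [map_sub, map_smul, hker, hker]; simp) ?_
    rw [← hBv] at hv
    rw [Pi.sub_apply, ← hBv, hv, Pi.smul_apply, smul_eq_mul, hBv, sub_self]
  have h0 := htr v _ h
  rw [h0] at h
  have : A (1, 0) = A 0 := by
    rw [map_zero]
    exact (smul_eq_zero.1 h.symm).resolve_left Complex.I_ne_zero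
  simpa using hA this

theorem exists_injective_add_smul {A : ℝ × ℝ →L[ℝ] (Fin 2 → ℂ)} {D : (Fin 2 → ℂ) →L[ℂ] ℂ}
    {j : Fin 2} {θ : ℝ × ℝ →L[ℝ] ℝ} (hA : Function.Injective A) (hθ0 : θ ≠ 0)
    (hj : ∀ v, D v = 0 → v j = 0 → v = 0)
    (hθ : ∀ v, D (A v) = θ v * Complex.I) :
    ∃ ξ : ℂ, ∀ v, A v j + θ v * ξ = 0 → v = 0 := by
  obtain ⟨v₀, v₁, l, hv₀, hθ₀, hθ₁, hdec⟩ := exists_smul_eq_of_apply_eq_zero hθ0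
  have hα : A v₀ j ≠ 0 := fun h => hv₀ (hA (by
    rw [map_zero]
    exact hj _ (by rw [hθ, hθ₀]; simp) h))
  refine ⟨Complex.I * A v₀ j - A v₁ j, fun v hv => ?_⟩
  have hAv : A v j = l v * A v₀ j + θ v * A v₁ j := by
    conv_lhs => rw [hdec v]
    simp
  have h : A v₀ j * (l v + θ v * Complex.I) = 0 := by
    rw [← hv, hAv]
    ring
  have h2 := (mul_eq_zero.1 h).resolve_left hα
  have hl : l v = 0 := by simpa using congrArg Complex.re h2
  have ht : θ v = 0 := by simpa using congrArg Complex.im h2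
  rw [hdec v, hl, ht]
  simp

/-- A map between planes with injective derivative is a local homeomorphism. -/
theorem ContDiffAt.exists_openPartialHomeomorph {F : Type*} [NormedAddCommGroup F]
    [NormedSpace ℝ F] [FiniteDimensional ℝ F] (hF : Module.finrank ℝ F = 2) {Ψ : ℝ × ℝ → F}
    {x₀ : ℝ × ℝ} (hΨ : ContDiffAt ℝ 1 Ψ x₀) (hinj : ∀ v, fderiv ℝ Ψ x₀ v = 0 → v = 0) :
    ∃ e : OpenPartialHomeomorph (ℝ × ℝ) F, x₀ ∈ e.source ∧ ∀ x, e x = Ψ x := by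
  have hinj' : Function.Injective (fderiv ℝ Ψ x₀ : ℝ × ℝ →ₗ[ℝ] F) :=
    (injective_iff_map_eq_zero _).2 hinj
  let L : (ℝ × ℝ) ≃L[ℝ] F :=
    (LinearEquiv.ofInjectiveOfFinrankEq _ hinj' (by simp [hF])).toContinuousLinearEquiv
  have hL : HasStrictFDerivAt Ψ (L : ℝ × ℝ →L[ℝ] F) x₀ := by
    have hLe : (L : ℝ × ℝ →L[ℝ] F) = fderiv ℝ Ψ x₀ := ContinuousLinearMap.ext fun _ => rfl
    rw [hLe]
    exact hΨ.hasStrictFDerivAt one_ne_zero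
  exact ⟨hL.toOpenPartialHomeomorph Ψ, hL.mem_toOpenPartialHomeomorph_source, fun x => rfl⟩

/-- A submersion to the line divides small neighbourhoods into two connected halves. -/
theorem exists_nhds_preconnected_halves {f : ℝ × ℝ → ℝ} {x₀ : ℝ × ℝ} (hf : ContDiffAt ℝ 1 f x₀)
    (hd : fderiv ℝ f x₀ ≠ 0) {V : Set (ℝ × ℝ)} (hV : V ∈ 𝓝 x₀) :
    ∃ B : Set (ℝ × ℝ), IsOpen B ∧ x₀ ∈ B ∧ B ⊆ V ∧ IsPreconnected (B ∩ {x | 0 < f x}) ∧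
      IsPreconnected (B ∩ {x | f x < 0}) ∧
      ∀ x ∈ B, f x = 0 → x ∈ closure (B ∩ {x | 0 < f x}) ∧ x ∈ closure (B ∩ {x | f x < 0}) := by
  obtain ⟨v₀, v₁, l, hv₀, hθ₀, hθ₁, hdec⟩ := exists_smul_eq_of_apply_eq_zero hd
  have hΨ : ContDiffAt ℝ 1 (fun x => (f x, l x)) x₀ := hf.prodMk l.contDiff.contDiffAt
  have hder : fderiv ℝ (fun x => (f x, l x)) x₀ = (fderiv ℝ f x₀).prod l :=
    ((hf.differentiableAt one_ne_zero).hasFDerivAt.prodMk l.hasFDerivAt).fderiv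
  obtain ⟨e, hx₀, he⟩ := hΨ.exists_openPartialHomeomorph (by simp) fun v hv => by
    rw [hder, ContinuousLinearMap.prod_apply, Prod.mk_eq_zero] at hv
    rw [hdec v, hv.1, hv.2]
    simp
  have hV' : e.symm ⁻¹' V ∩ e.target ∈ 𝓝 (e x₀) := by
    refine inter_mem ((e.symm.continuousAt (e.map_source hx₀)).preimage_mem_nhds ?_)
      (e.open_target.mem_nhds (e.map_source hx₀))
    rwa [e.left_inv hx₀]
  obtain ⟨ε, hε, hball⟩ := Metric.mem_nhds_iff.1 hV'
  set P := Metric.ball (e x₀) ε with hP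
  have hPt : P ⊆ e.target := fun y hy => (hball hy).2
  have hPc : Convex ℝ P := convex_ball _ _
  have hfe : ∀ y ∈ P, f (e.symm y) = y.1 := by
    intro y hy
    have := he (e.symm y)
    rw [e.right_inv (hPt hy)] at this
    exact (congrArg Prod.fst this).symm
  have hcont : ContinuousOn e.symm P := e.continuousOn_symm.mono hPt
  have key (T : Set ℝ) (hT : Convex ℝ T) :
      (e.symm '' P) ∩ {x | f x ∈ T} = e.symm '' (P ∩ Prod.fst ⁻¹' T) := by
    ext x
    constructor
    · rintro ⟨⟨y, hy, rfl⟩, hx⟩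
      exact ⟨y, ⟨hy, by simpa [hfe y hy] using hx⟩, rfl⟩
    · rintro ⟨y, ⟨hy, hyT⟩, rfl⟩
      exact ⟨⟨y, hy, rfl⟩, by simpa [hfe y hy] using hyT⟩
  have hpre (T : Set ℝ) (hT : Convex ℝ T) : IsPreconnected ((e.symm '' P) ∩ {x | f x ∈ T}) := by
    rw [key T hT]
    exact (hPc.inter (hT.linear_preimage (LinearMap.fst ℝ ℝ ℝ))).isPreconnected.image _
      (hcont.mono inter_subset_left)
  have hline (y : ℝ × ℝ) (hy : y ∈ P) (s : ℝ) (hs : y.1 = 0) (T : Set ℝ) (hT : Convex ℝ T)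
      (hsT : ∀ᶠ a in 𝓝[>] (0 : ℝ), a * s ∈ T) :
      e.symm y ∈ closure ((e.symm '' P) ∩ {x | f x ∈ T}) := by
    rw [key T hT]
    have hlim : Tendsto (fun a : ℝ => y + (a * s, (0 : ℝ))) (𝓝[>] (0 : ℝ)) (𝓝 y) := by
      have : Continuous fun a : ℝ => y + (a * s, (0 : ℝ)) := by fun_prop
      have h := this.tendsto 0
      simp only [zero_mul] at h
      rw [show y + ((0 : ℝ), (0 : ℝ)) = y by ext <;> simp] at h
      exact h.mono_left nhdsWithin_le_nhds
    have hlim2 := ((e.symm.continuousAt (hPt hy)).tendsto.comp hlim)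
    refine mem_closure_of_tendsto hlim2 ?_
    filter_upwards [hlim.eventually (Metric.isOpen_ball.mem_nhds hy), hsT] with a ha haT
    exact ⟨_, ⟨ha, by simpa [hs] using haT⟩, rfl⟩
  refine ⟨e.symm '' P, ?_, ⟨e x₀, Metric.mem_ball_self hε, e.left_inv hx₀⟩, ?_,
    hpre (Ioi 0) (convex_Ioi 0), hpre (Iio 0) (convex_Iio 0), ?_⟩
  · exact e.symm.isOpen_image_of_subset_source Metric.isOpen_ball hPt
  · rintro _ ⟨y, hy, rfl⟩
    exact (hball hy).1
  · rintro _ ⟨y, hy, rfl⟩ hfy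
    rw [hfe y hy] at hfy
    refine ⟨hline y hy 1 hfy (Ioi 0) (convex_Ioi 0) ?_, hline y hy (-1) hfy (Iio 0) (convex_Iio 0) ?_⟩
    · filter_upwards [self_mem_nhdsWithin] with a ha
      simpa using ha
    · filter_upwards [self_mem_nhdsWithin] with a ha
      simpa using ha

/-- Near a point of a totally real disc lying in `Re g = 0`, the level set of `g` is parametrized by
the disc parameter in such a way that the parametrization agrees with `φ` on the slice. -/
theorem exists_level_parametrization {g : (Fin 2 → ℂ) → ℂ} {Ω : Set (Fin 2 → ℂ)}
    (hg : DifferentiableOn ℂ g Ω) (hΩ : IsOpen Ω) {φ : ℝ × ℝ → (Fin 2 → ℂ)} {τ : ℝ × ℝ → ℝ}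
    {S : Set (ℝ × ℝ)} (hS : IsCompact S) (hφ : ContinuousOn φ S) (hφi : InjOn φ S)
    (hφΩ : ∀ x ∈ S, φ x ∈ Ω) (hgφ : ∀ x ∈ S, g (φ x) = τ x * Complex.I) {x₀ : ℝ × ℝ}
    (hx₀ : x₀ ∈ S) (hφ₀ : ContDiffAt ℝ 1 φ x₀) (hτ₀ : ContDiffAt ℝ 1 τ x₀)
    (hdg : fderiv ℂ g (φ x₀) ≠ 0) (hinj : Function.Injective (fderiv ℝ φ x₀))
    (hθ0 : fderiv ℝ τ x₀ ≠ 0)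
    (hθ : ∀ v, fderiv ℂ g (φ x₀) (fderiv ℝ φ x₀ v) = fderiv ℝ τ x₀ v * Complex.I) :
    ∃ (m : ℝ × ℝ → (Fin 2 → ℂ)) (B₀ : Set (ℝ × ℝ)), IsOpen B₀ ∧ x₀ ∈ B₀ ∧ ContinuousOn m B₀ ∧
      (∀ x ∈ B₀, m x ∈ Ω ∧ g (m x) = τ x₀ * Complex.I) ∧
      (∀ x ∈ B₀, x ∈ S → τ x = τ x₀ → m x = φ x) ∧
      (∀ x ∈ B₀, ∀ y ∈ S, τ y = τ x₀ → m x = φ y → x = y) ∧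
      ∀ B ∈ 𝓝 x₀, ∀ᶠ u in 𝓝 (φ x₀), g u = τ x₀ * Complex.I → ∃ x ∈ B, m x = u := by
  obtain ⟨j, hj, hchart⟩ := exists_levelChart hg hΩ (hφΩ x₀ hx₀) hdg
  obtain ⟨ξ, hξ⟩ := exists_injective_add_smul hinj hθ0 hj hθ
  have hφj : ContDiffAt ℝ 1 (fun x => φ x j) x₀ := (contDiffAt_pi.1 hφ₀) j
  set Ψ : ℝ × ℝ → ℂ := fun x => φ x j + (τ x - τ x₀) • ξ with hΨdef
  have hΨ : ContDiffAt ℝ 1 Ψ x₀ := hφj.add ((hτ₀.sub contDiffAt_const).smul contDiffAt_const)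
  have hder : ∀ v, fderiv ℝ Ψ x₀ v = fderiv ℝ φ x₀ v j + fderiv ℝ τ x₀ v * ξ := by
    intro v
    have h1 : HasFDerivAt (fun x => φ x j) ((ContinuousLinearMap.proj (R := ℝ)
        (φ := fun _ : Fin 2 => ℂ) j).comp (fderiv ℝ φ x₀)) x₀ :=
      (hasFDerivAt_pi'.1 (hφ₀.differentiableAt one_ne_zero).hasFDerivAt) j
    have h2 := ((hτ₀.differentiableAt one_ne_zero).hasFDerivAt.sub_const (τ x₀)).smul_const ξ
    have h3 := (h1.fun_add h2).fderiv
    simp only [hΨdef]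
    rw [h3]
    simp
  obtain ⟨e, hxe, he⟩ := hΨ.exists_openPartialHomeomorph (by simp) fun v hv =>
    hξ v (by rw [← hder, hv])
  have hΨS : ∀ x, τ x = τ x₀ → Ψ x = φ x j := fun x hx => by simp [hΨdef, hx]
  have hφx₀ : φ x₀ ∉ φ '' (S \ e.source) := by
    rintro ⟨y, hy, hyx⟩
    exact hy.2 (hφi hy.1 hx₀ hyx ▸ hxe)
  have hclosed : IsClosed (φ '' (S \ e.source)) :=
    ((hS.diff e.open_source).image_of_continuousOn (hφ.mono sdiff_subset)).isClosed
  obtain ⟨c, W, r, hc, hW⟩ := hchart _ (hclosed.isOpen_compl.mem_nhds hφx₀)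
  have hgx₀ := hgφ x₀ hx₀
  have hmem : ∀ᶠ x in 𝓝 x₀, x ∈ e.source ∧ e x ∈ Metric.ball (φ x₀ j) r ∧ φ x ∈ W := by
    refine (e.open_source.eventually_mem hxe).and (((e.continuousAt hxe).eventually_mem ?_).and
      (hφ₀.continuousAt.eventually_mem (hc.isOpen.mem_nhds hc.mem)))
    rw [he, hΨS x₀ rfl]
    exact Metric.ball_mem_nhds _ hc.pos
  obtain ⟨B₀, hB₀, hB₀o, hxB₀⟩ := eventually_nhds_iff.1 hmem
  refine ⟨fun x => c (e x), B₀, hB₀o, hxB₀, ?_, fun x hx => ?_, fun x hx hxS hτx => ?_,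
    fun x hx y hy hτy hxy => ?_, fun B hB => ?_⟩
  · exact hc.differentiableOn.continuousOn.comp (e.continuousOn.mono fun x hx => (hB₀ x hx).1)
      fun x hx => (hB₀ x hx).2.1
  · exact ⟨(hW (hc.mapsTo _ (hB₀ x hx).2.1)).2, by rw [hc.value _ (hB₀ x hx).2.1, hgx₀]⟩
  · show c (e x) = φ x
    rw [he, hΨS x hτx]
    exact hc.inv _ (hB₀ x hx).2.2 (by rw [hgφ x hxS, hgx₀, hτx])
  · have hyW : φ y ∈ W := hxy ▸ hc.mapsTo _ (hB₀ x hx).2.1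
    have hye : y ∈ e.source := by
      by_contra h
      exact (hW hyW).1 ⟨y, ⟨hy, h⟩, rfl⟩
    refine e.injOn (hB₀ x hx).1 hye ?_
    rw [he y, hΨS y hτy, ← hxy]
    exact (hc.coord _ (hB₀ x hx).2.1).symm
  · have hx₀t := e.map_source hxe
    have hex₀ : e x₀ = φ x₀ j := by rw [he, hΨS x₀ rfl]
    have hproj : ContinuousAt (fun u : Fin 2 → ℂ => u j) (φ x₀) := (continuous_apply j).continuousAt
    have h1 : ∀ᶠ w in 𝓝 (e x₀), e.symm w ∈ B ∧ w ∈ e.target := by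
      refine ((e.symm.continuousAt hx₀t).eventually_mem ?_).and (e.open_target.eventually_mem hx₀t)
      rwa [e.left_inv hxe]
    rw [hex₀] at h1
    filter_upwards [hproj.eventually h1, hc.isOpen.eventually_mem hc.mem] with u hu huW hgu
    refine ⟨e.symm (u j), hu.1, ?_⟩
    show c (e (e.symm (u j))) = u
    rw [e.right_inv hu.2]
    exact hc.inv u huW (by rw [hgu, hgx₀])

/-- The hull near a point of the slice of a disc: it is either the slice itself, or the whole level
set, or one of the two sides; the last case is stable along the slice. -/
theorem attainedHull_local_trichotomy {g : (Fin 2 → ℂ) → ℂ} {Ω : Set (Fin 2 → ℂ)}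
    (hg : DifferentiableOn ℂ g Ω) (hΩ : IsOpen Ω)
    (hdg : ∀ z ∈ Ω, (g z).re = 0 → fderiv ℂ g z ≠ 0) {φ : ℝ × ℝ → (Fin 2 → ℂ)} {τ : ℝ × ℝ → ℝ}
    {S : Set (ℝ × ℝ)} (hS : IsCompact S) (hφ : ContinuousOn φ S) (hφi : InjOn φ S)
    (hφΩ : ∀ x ∈ S, φ x ∈ Ω) (hgφ : ∀ x ∈ S, g (φ x) = τ x * Complex.I) {x₀ : ℝ × ℝ}
    (hx₀ : x₀ ∈ S) (hφ₀ : ContDiffAt ℝ 1 φ x₀) (hτ₀ : ContDiffAt ℝ 1 τ x₀)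
    (hinj : Function.Injective (fderiv ℝ φ x₀)) (hθ0 : fderiv ℝ τ x₀ ≠ 0)
    (hθ : ∀ v, fderiv ℂ g (φ x₀) (fderiv ℝ φ x₀ v) = fderiv ℝ τ x₀ v * Complex.I)
    {Q : Set (Fin 2 → ℂ)} (hQ : IsCompact Q) (hQφ : Q = φ '' (S ∩ {x | τ x = τ x₀}))
    (hX : ∀ z ∈ attainedHull Q, z ∈ Ω → g z = τ x₀ * Complex.I) :
    (∃ᶠ u in 𝓝 (φ x₀), g u = τ x₀ * Complex.I ∧ u ∉ Q) ∧
    ((∀ᶠ u in 𝓝 (φ x₀), u ∈ attainedHull Q → u ∈ Q) ∨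
      (∀ᶠ u in 𝓝 (φ x₀), g u = τ x₀ * Complex.I → u ∈ attainedHull Q) ∨
      ∀ᶠ x in 𝓝 x₀, τ x = τ x₀ → x ∈ S ∧ (¬ ∀ᶠ u in 𝓝 (φ x), u ∈ attainedHull Q → u ∈ Q) ∧
        ¬ ∀ᶠ u in 𝓝 (φ x), g u = τ x₀ * Complex.I → u ∈ attainedHull Q) := by
  have hre (z : Fin 2 → ℂ) (h : g z = τ x₀ * Complex.I) : (g z).re = 0 := by simp [h]
  obtain ⟨m, B₀, hB₀, hxB₀, hmc, hmg, hmφ, hmi, hmn⟩ := exists_level_parametrization hg hΩ hS hφ hφi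
    hφΩ hgφ hx₀ hφ₀ hτ₀ (hdg _ (hφΩ x₀ hx₀) (hre _ (hgφ x₀ hx₀))) hinj hθ0 hθ
  have hmQ : ∀ x ∈ B₀, m x ∈ Q → x ∈ S ∧ τ x = τ x₀ ∧ m x = φ x := by
    intro x hx hxQ
    rw [hQφ] at hxQ
    obtain ⟨y, ⟨hyS, hy⟩, hyx⟩ := hxQ
    obtain rfl := hmi x hx y hyS hy hyx.symm
    exact ⟨hyS, hy, hyx.symm⟩
  obtain ⟨B, hB, hxB, hBB₀, hpos, hneg, hcl⟩ := exists_nhds_preconnected_halves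
    (f := fun x => τ x - τ x₀) (hτ₀.sub contDiffAt_const)
    (by rwa [fderiv_sub_const]) (hB₀.mem_nhds hxB₀)
  have hmB : ∀ x ∈ B, ContinuousAt m x := fun x hx => hmc.continuousAt (hB₀.mem_nhds (hBB₀ hx))
  set X := attainedHull Q with hXdef
  have hXc : IsClosed X := (isCompact_attainedHull hQ).isClosed
  have hXopen : ∀ x ∈ B, m x ∈ X → m x ∉ Q → ∀ᶠ y in 𝓝 x, m y ∈ X := by
    intro x hx hxX hxQ
    obtain ⟨hxΩ, hgx⟩ := hmg x (hBB₀ hx)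
    have h := eventually_mem_attainedHull hQ hg hΩ hxΩ hxX hxQ (hdg _ hxΩ (hre _ hgx))
      fun z hz hzΩ => (hX z hz hzΩ).trans hgx.symm
    filter_upwards [(hmB x hx).eventually h, hB.mem_nhds hx] with y hy hyB
    exact hy ((hmg y (hBB₀ hyB)).2.trans hgx.symm)
  set P := B ∩ {x | 0 < τ x - τ x₀} with hP
  set N := B ∩ {x | τ x - τ x₀ < 0} with hN
  have hPQ : ∀ x ∈ P, m x ∉ Q := fun x hx hxQ => by
    have h1 : 0 < τ x - τ x₀ := hx.2
    have := (hmQ x (hBB₀ hx.1) hxQ).2.1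
    linarith
  have hNQ : ∀ x ∈ N, m x ∉ Q := fun x hx hxQ => by
    have h1 : τ x - τ x₀ < 0 := hx.2
    have := (hmQ x (hBB₀ hx.1) hxQ).2.1
    linarith
  have halt (H : Set (ℝ × ℝ)) (hH : IsPreconnected H) (hHB : H ⊆ B) (hHQ : ∀ x ∈ H, m x ∉ Q) :
      (∀ x ∈ H, m x ∈ X) ∨ ∀ x ∈ H, m x ∉ X := by
    by_contra! hcon
    obtain ⟨⟨a, ha, haX⟩, b, hb, hbX⟩ := hcon
    obtain ⟨x, hx, h1, h2⟩ := hH {x | x ∈ B ∧ m x ∉ X} {x | ∀ᶠ y in 𝓝 x, m y ∈ X}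
      (isOpen_iff_mem_nhds.2 fun x hx => by
        filter_upwards [hB.mem_nhds hx.1,
          (hmB x hx.1).eventually (hXc.isOpen_compl.mem_nhds hx.2)] with y h1 h2
        exact ⟨h1, h2⟩)
      isOpen_setOfPred_eventually_nhds
      (fun x hx => by
        by_cases h : m x ∈ X
        · exact Or.inr (hXopen x (hHB hx) h (hHQ x hx))
        · exact Or.inl ⟨hHB hx, h⟩)
      ⟨a, ha, hHB ha, haX⟩ ⟨b, hb, hXopen b (hHB hb) hbX (hHQ b hb)⟩
    exact h1.2 h2.self_of_nhds
  have hclX (H : Set (ℝ × ℝ)) (hH : ∀ x ∈ H, m x ∈ X) (x : ℝ × ℝ) (hx : x ∈ B)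
      (hxH : x ∈ closure H) : m x ∈ X :=
    hXc.closure_subset_iff.2 (by rintro _ ⟨y, hy, rfl⟩; exact hH y hy)
      (mem_closure_image (hmB x hx) hxH)
  have hfreq (H : Set (ℝ × ℝ)) (x : ℝ × ℝ) (hx : x ∈ B) (hxH : x ∈ closure H) :
      ∃ᶠ u in 𝓝 (m x), u ∈ m '' H :=
    mem_closure_iff_frequently.1 (mem_closure_image (hmB x hx) hxH)
  have hx₀cl := hcl x₀ hxB (sub_self _)
  have hmx₀ : m x₀ = φ x₀ := hmφ x₀ hxB₀ hx₀ rfl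
  refine ⟨?_, ?_⟩
  · rw [← hmx₀]
    refine (hfreq P x₀ hxB hx₀cl.1).mono ?_
    rintro _ ⟨y, hy, rfl⟩
    exact ⟨(hmg y (hBB₀ hy.1)).2, hPQ y hy⟩
  have hsame (H H' : Set (ℝ × ℝ)) (hH : ∀ x ∈ H, m x ∈ X) (hH' : ∀ x ∈ H', m x ∉ X)
      (hHB : H ⊆ B) (hH'B : H' ⊆ B) (hHQ : ∀ x ∈ H, m x ∉ Q)
      (hc : ∀ x ∈ B, τ x - τ x₀ = 0 → x ∈ closure H ∧ x ∈ closure H') :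
      ∀ᶠ x in 𝓝 x₀, τ x = τ x₀ → x ∈ S ∧ (¬ ∀ᶠ u in 𝓝 (φ x), u ∈ X → u ∈ Q) ∧
        ¬ ∀ᶠ u in 𝓝 (φ x), g u = τ x₀ * Complex.I → u ∈ X := by
    filter_upwards [hB.mem_nhds hxB] with x hx hτx
    obtain ⟨hxH, hxH'⟩ := hc x hx (sub_eq_zero.2 hτx)
    have hxX := hclX H hH x hx hxH
    have hxQ : m x ∈ Q := by
      by_contra h
      obtain ⟨y, hy, hyX⟩ := ((mem_closure_iff_frequently.1 hxH').and_eventually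
        (hXopen x hx hxX h)).exists
      exact hH' y hy hyX
    obtain ⟨hxS, -, hmx⟩ := hmQ x (hBB₀ hx) hxQ
    rw [← hmx]
    refine ⟨hxS, fun h => ?_, fun h => ?_⟩
    · obtain ⟨_, ⟨y, hy, rfl⟩, hyX⟩ := ((hfreq H x hx hxH).and_eventually h).exists
      exact hHQ y hy (hyX (hH y hy))
    · obtain ⟨_, ⟨y, hy, rfl⟩, hyX⟩ := ((hfreq H' x hx hxH').and_eventually h).exists
      exact hH' y hy (hyX (hmg y (hBB₀ (hH'B hy))).2)
  have hPB : P ⊆ B := inter_subset_left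
  have hNB : N ⊆ B := inter_subset_left
  rcases halt P hpos hPB hPQ with hPX | hPX <;> rcases halt N hneg hNB hNQ with hNX | hNX
  · refine Or.inr (Or.inl ?_)
    filter_upwards [hmn B (hB.mem_nhds hxB)] with u hu hgu
    obtain ⟨x, hx, rfl⟩ := hu hgu
    rcases lt_trichotomy (τ x - τ x₀) 0 with h | h | h
    · exact hNX x ⟨hx, h⟩
    · exact hclX P hPX x hx (hcl x hx h).1
    · exact hPX x ⟨hx, h⟩
  · exact Or.inr (Or.inr (hsame P N hPX hNX hPB hNB hPQ hcl))
  · exact Or.inr (Or.inr (hsame N P hNX hPX hNB hPB hNQ fun x hx h => (hcl x hx h).symm))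
  · refine Or.inl ?_
    filter_upwards [hmn B (hB.mem_nhds hxB), hΩ.mem_nhds (hφΩ x₀ hx₀)] with u hu huΩ huX
    obtain ⟨x, hx, rfl⟩ := hu (hX u huX huΩ)
    by_contra hxQ
    rcases lt_trichotomy (τ x - τ x₀) 0 with h | h | h
    · exact hNX x ⟨hx, h⟩ huX
    · obtain ⟨y, hy, hyX⟩ := ((mem_closure_iff_frequently.1 (hcl x hx h).1).and_eventually
        (hXopen x hx huX hxQ)).exists
      exact hPX y hy hyX
    · exact hPX x ⟨hx, h⟩ huX

theorem fderiv_eq_zero_of_eq_zero_on_closedBall {U : Set (ℝ × ℝ)} {ρ : ℝ × ℝ → ℝ}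
    (hU : IsOpen U) (hSU : Metric.closedBall 0 1 ⊆ U) (hρ : ContDiffOn ℝ 1 ρ U)
    (h0 : ∀ x ∈ Metric.closedBall 0 1, ρ x = 0) {x : ℝ × ℝ} (hx : x ∈ Metric.closedBall 0 1) :
    fderiv ℝ ρ x = 0 := by
  have hcont : ContinuousAt (fderiv ℝ ρ) x :=
    (hρ.continuousOn_fderiv_of_isOpen hU le_rfl).continuousAt (hU.mem_nhds (hSU hx))
  rw [← closure_ball (0 : ℝ × ℝ) one_ne_zero] at hx
  have hsub : fderiv ℝ ρ '' Metric.ball 0 1 ⊆ {0} := by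
    rintro _ ⟨y, hy, rfl⟩
    have : ρ =ᶠ[𝓝 y] fun _ => 0 := by
      filter_upwards [Metric.isOpen_ball.mem_nhds hy] with z hz
      exact h0 z (Metric.ball_subset_closedBall hz)
    rw [mem_singleton_iff, this.fderiv_eq, fderiv_const_apply]
  exact closure_minimal hsub isClosed_singleton (mem_closure_image hcont hx)

/-- A level slice of a totally real disc contained in `Re g = 0` is polynomially convex. -/
theorem attainedHull_slice_subset {g : (Fin 2 → ℂ) → ℂ} {Ω : Set (Fin 2 → ℂ)}
    (hg : DifferentiableOn ℂ g Ω) (hΩ : IsOpen Ω)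
    (hdg : ∀ z ∈ Ω, (g z).re = 0 → fderiv ℂ g z ≠ 0) {U : Set (ℝ × ℝ)}
    {φ : ℝ × ℝ → (Fin 2 → ℂ)} (hU : IsOpen U) (hSU : Metric.closedBall 0 1 ⊆ U)
    (hφ : ContDiffOn ℝ 1 φ U) (hφi : InjOn φ U)
    (hinj : ∀ x ∈ U, Function.Injective (fderiv ℝ φ x))
    (htr : ∀ x ∈ U, ∀ v w, fderiv ℝ φ x v = Complex.I • fderiv ℝ φ x w → fderiv ℝ φ x v = 0)
    (hφΩ : ∀ x ∈ Metric.closedBall 0 1, φ x ∈ Ω)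
    (hre : ∀ x ∈ Metric.closedBall 0 1, (g (φ x)).re = 0) {w : ℂ} {Q : Set (Fin 2 → ℂ)}
    (hQw : Q = φ '' Metric.closedBall 0 1 ∩ {z | g z = w})
    (hX : ∀ z ∈ attainedHull Q, z ∈ Ω → g z = w) : attainedHull Q ⊆ Q := by
  set S := Metric.closedBall (0 : ℝ × ℝ) 1 with hSdef
  have hS : IsCompact S := isCompact_closedBall 0 1
  set U₁ := U ∩ φ ⁻¹' Ω with hU₁def
  have hU₁ : IsOpen U₁ := hφ.continuousOn.isOpen_inter_preimage hU hΩ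
  have hSU₁ : S ⊆ U₁ := fun x hx => ⟨hSU hx, hφΩ x hx⟩
  have hγ : ContDiffOn ℝ 1 (fun x => g (φ x)) U₁ :=
    ((hg.contDiffOn_one_of_isOpen hΩ).restrict_scalars ℝ).comp (hφ.mono inter_subset_left)
      fun x hx => hx.2
  have hρ : ContDiffOn ℝ 1 (fun x => (g (φ x)).re) U₁ :=
    Complex.reCLM.contDiff.comp_contDiffOn hγ
  set τ : ℝ × ℝ → ℝ := fun x => (g (φ x)).im with hτdef
  have hτ : ContDiffOn ℝ 1 τ U₁ := Complex.imCLM.contDiff.comp_contDiffOn hγ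
  have hgφ : ∀ x ∈ S, g (φ x) = τ x * Complex.I := fun x hx => by
    apply Complex.ext <;> simp [hτdef, hre x hx]
  have hφS : ContinuousOn φ S := hφ.continuousOn.mono hSU
  have hφiS : InjOn φ S := hφi.mono hSU
  have hφ1 : ∀ x ∈ S, ContDiffAt ℝ 1 φ x := fun x hx => hφ.contDiffAt (hU.mem_nhds (hSU hx))
  have hτ1 : ∀ x ∈ U₁, ContDiffAt ℝ 1 τ x := fun x hx => hτ.contDiffAt (hU₁.mem_nhds hx)
  have hθ : ∀ x ∈ S, ∀ v, fderiv ℂ g (φ x) (fderiv ℝ φ x v) = fderiv ℝ τ x v * Complex.I := by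
    intro x hx v
    have hgx : HasFDerivAt g ((fderiv ℂ g (φ x)).restrictScalars ℝ) (φ x) :=
      ((hg.differentiableAt (hΩ.mem_nhds (hφΩ x hx))).hasFDerivAt).restrictScalars ℝ
    have hc := hgx.comp x ((hφ1 x hx).differentiableAt one_ne_zero).hasFDerivAt
    have h1 := (Complex.reCLM.hasFDerivAt.comp x hc).fderiv
    have h2 := (Complex.imCLM.hasFDerivAt.comp x hc).fderiv
    have h3 := fderiv_eq_zero_of_eq_zero_on_closedBall hU₁ hSU₁ hρ hre hx
    have h1' := h3.symm.trans h1
    have h2' : fderiv ℝ τ x = _ := h2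
    apply Complex.ext
    · simpa using (DFunLike.congr_fun h1' v).symm
    · simpa using (DFunLike.congr_fun h2' v).symm
  have hθ0 : ∀ x ∈ S, fderiv ℝ τ x ≠ 0 := by
    intro x hx
    obtain ⟨j, hj, -⟩ := exists_levelChart hg hΩ (hφΩ x hx) (hdg _ (hφΩ x hx) (hre x hx))
    exact apply_ne_zero_of_totallyReal (hinj x (hSU hx)) (htr x (hSU hx)) hj (hθ x hx)
  have hQ : IsCompact Q := by
    have hKc := hS.image_of_continuousOn hφS
    have hgK : ContinuousOn g (φ '' S) := hg.continuousOn.mono (by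
      rintro _ ⟨x, hx, rfl⟩
      exact hφΩ x hx)
    rw [hQw]
    exact hKc.of_isClosed_subset (hgK.preimage_isClosed_of_isClosed hKc.isClosed
      (isClosed_singleton (x := w))) inter_subset_left
  have hslice : ∀ x₀ ∈ S, g (φ x₀) = w → Q = φ '' (S ∩ {x | τ x = τ x₀}) := by
    intro x₀ hx₀ hx₀w
    rw [hQw]
    ext z
    constructor
    · rintro ⟨⟨x, hx, rfl⟩, hxw⟩
      refine ⟨x, ⟨hx, ?_⟩, rfl⟩
      show (g (φ x)).im = (g (φ x₀)).im
      rw [hx₀w, show g (φ x) = w from hxw]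
    · rintro ⟨x, ⟨hx, hxτ⟩, rfl⟩
      refine ⟨⟨x, hx, rfl⟩, ?_⟩
      show g (φ x) = w
      rw [hgφ x hx, show τ x = τ x₀ from hxτ, ← hgφ x₀ hx₀, hx₀w]
  have htri (x₀ : ℝ × ℝ) (hx₀ : x₀ ∈ S) (hx₀w : g (φ x₀) = w) :=
    attainedHull_local_trichotomy hg hΩ hdg hS hφS hφiS hφΩ hgφ hx₀ (hφ1 x₀ hx₀)
      (hτ1 x₀ (hSU₁ hx₀)) (hinj x₀ (hSU hx₀)) (hθ0 x₀ hx₀) (hθ x₀ hx₀) hQ (hslice x₀ hx₀ hx₀w)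
      fun z hz hzΩ => (hX z hz hzΩ).trans (hx₀w.symm.trans (hgφ x₀ hx₀))
  have hQmem : ∀ z ∈ Q, ∃ x ∈ S, g (φ x) = w ∧ φ x = z := by
    intro z hz
    rw [hQw] at hz
    obtain ⟨⟨x, hx, rfl⟩, hxw⟩ := hz
    exact ⟨x, hx, hxw, rfl⟩
  have hgQ : ∀ z ∈ Q, g z = w := fun z hz => by
    obtain ⟨x, hx, hxw, rfl⟩ := hQmem z hz
    exact hxw
  have hQΩ : Q ⊆ Ω := fun z hz => by
    obtain ⟨x, hx, hxw, rfl⟩ := hQmem z hz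
    exact hφΩ x hx
  have hiw : ∀ x ∈ S, g (φ x) = w → (τ x : ℂ) * Complex.I = w := fun x hx hxw =>
    (hgφ x hx).symm.trans hxw
  set T₀ : Set (Fin 2 → ℂ) := {z | ∀ᶠ u in 𝓝 z, u ∈ attainedHull Q → u ∈ Q} with hT₀
  set T₂ : Set (Fin 2 → ℂ) := {z | ∀ᶠ u in 𝓝 z, g u = w → u ∈ attainedHull Q} with hT₂
  have hT : IsClosed (T₀ᶜ ∩ T₂ᶜ) :=
    (isOpen_setOfPred_eventually_nhds.isClosed_compl).inter
      (isOpen_setOfPred_eventually_nhds.isClosed_compl)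
  set C : Set (ℝ × ℝ) := (S ∩ τ ⁻¹' {w.im}) ∩ (S ∩ φ ⁻¹' (T₀ᶜ ∩ T₂ᶜ)) with hCdef
  have hτw : ∀ x ∈ S, Q.Nonempty → τ x = w.im → g (φ x) = w := by
    rintro x hx ⟨z, hz⟩ hxτ
    obtain ⟨y, hy, hyw, -⟩ := hQmem z hz
    rw [hgφ x hx, hxτ, ← hiw y hy hyw]
    simp
  rcases Q.eq_empty_or_nonempty with hemp | hneQ
  · intro z hz
    obtain ⟨y, hy, -⟩ := hz 0
    simp [hemp] at hy
  have hCclosed : IsClosed C :=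
    ((hτ.continuousOn.mono hSU₁).preimage_isClosed_of_isClosed hS.isClosed
      isClosed_singleton).inter (hφS.preimage_isClosed_of_isClosed hS.isClosed hT)
  have hCS : C ⊆ S := fun x hx => hx.1.1
  have hC0 : C = ∅ := by
    refine eq_empty_of_isCompact_of_relOpen_zeroLocus (f := fun x => τ x - w.im)
      (U := U₁ ∩ {x | fderiv ℝ τ x ≠ 0}) (S := S) ?_ hS (fun x hx => ⟨hSU₁ hx, hθ0 x hx⟩)
      isPreconnected_compl_closedBall_zero
      ((hτ.continuousOn.mono inter_subset_left).sub continuousOn_const) (fun x hx => ?_)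
      (hS.of_isClosed_subset hCclosed hCS) hCS (fun x hx => sub_eq_zero.2 hx.1.2) fun x hx => ?_
    · exact (hτ.continuousOn_fderiv_of_isOpen hU₁ le_rfl).isOpen_inter_preimage hU₁
        isOpen_compl_singleton
    · rw [fderiv_sub_const]
      exact hx.2
    · have hxτ : τ x = w.im := hx.1.2
      have hxw := hτw x hx.1.1 hneQ hxτ
      have h := (htri x hx.1.1 hxw).2
      rw [hiw x hx.1.1 hxw] at h
      have h' := (h.resolve_left hx.2.2.1).resolve_left hx.2.2.2
      filter_upwards [h'] with y hy hyτ
      have hyτ' : τ y = w.im := sub_eq_zero.1 hyτ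
      obtain ⟨hyS, h1, h2⟩ := hy (hyτ'.trans hxτ.symm)
      exact ⟨⟨hyS, hyτ'⟩, hyS, h1, h2⟩
  refine attainedHull_subset_of_dichotomy hQ hg hΩ hQΩ (fun z hz => ?_) hgQ (fun z hz => ?_)
    fun z hz => ?_
  · obtain ⟨x, hx, hxw, rfl⟩ := hQmem z hz
    exact hdg _ (hφΩ x hx) (hre x hx)
  · obtain ⟨x, hx, hxw, rfl⟩ := hQmem z hz
    have h := (htri x hx hxw).1
    rwa [hiw x hx hxw] at h
  · obtain ⟨x, hx, hxw, rfl⟩ := hQmem z hz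
    by_contra hcon
    rw [not_or] at hcon
    have : x ∈ C := ⟨⟨hx, by
      show (g (φ x)).im = w.im
      rw [hxw]⟩, hx, hcon.1, hcon.2⟩
    simp [hC0] at this

/-- Let `Ω` be a Runge domain in `ℂ²` and `g` holomorphic on `Ω`.
Let `M := {z ∈ Ω : Re g(z) = 0}` with `dg(z) ≠ 0` for all `z ∈ M`. Then every
totally real `C²`-smooth disc contained in `M` is polynomially convex. -/
theorem totallyRealDisc_in_re_zero_levelSet_polyConvex
    (Ω : Set (Fin 2 → ℂ)) (hΩ : RungeDomain 2 Ω)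
    (g : (Fin 2 → ℂ) → ℂ) (ghol : DifferentiableOn ℂ g Ω)
    (M : Set (Fin 2 → ℂ)) (hM : M = {z ∈ Ω | (g z).re = 0})
    (hdg : ∀ z ∈ M, fderiv ℂ g z ≠ 0)
    (K : Set (Fin 2 → ℂ)) (hK : TotallyRealDisc 2 K) (hKM : K ⊆ M) :
    PolyConvex 2 K := by
  obtain ⟨hΩo, -, hrunge⟩ := hΩ
  obtain ⟨U, φ, hU, hSU, hφ, hφi, hinj, htr, rfl⟩ := hK
  subst hM
  have happrox : ∀ X : Set (Fin 2 → ℂ), IsCompact X → X ⊆ Ω → UnifApprox X g :=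
    fun X hX hXΩ ε hε => hrunge g ghol X hXΩ hX ε hε
  set S := Metric.closedBall (0 : ℝ × ℝ) 1 with hS
  set K := φ '' S with hKdef
  have hKc : IsCompact K :=
    (isCompact_closedBall 0 1).image_of_continuousOn (hφ.continuousOn.mono hSU)
  have hne : K.Nonempty := ⟨φ 0, 0, Metric.mem_closedBall_self zero_le_one, rfl⟩
  have hKΩ : K ⊆ Ω := fun z hz => (hKM hz).1
  refine Subset.antisymm (fun x hx => ?_) fun x hx p =>
    le_csSup (hKc.image (continuous_eval_mvPolynomial p).norm).bddAbove ⟨x, hx, rfl⟩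
  have hxK : x ∈ attainedHull K := by
    intro p
    obtain ⟨y, hy, hmax⟩ := hKc.exists_isMaxOn hne (continuous_eval_mvPolynomial p).norm.continuousOn
    refine ⟨y, hy, (hx p).trans (csSup_le (hne.image _) ?_)⟩
    rintro _ ⟨u, hu, rfl⟩
    exact hmax hu
  have hgK : ContinuousOn g K := ghol.continuousOn.mono hKΩ
  obtain ⟨w, hw⟩ := exists_mem_attainedHull_level hKc hgK (happrox K hKc hKΩ)
    (fun z hz => (hKM hz).2) hxK
  have hQc : IsCompact (K ∩ {z | g z = w}) :=
    hKc.of_isClosed_subset (hgK.preimage_isClosed_of_isClosed hKc.isClosed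
      (isClosed_singleton (x := w))) inter_subset_left
  refine (attainedHull_slice_subset ghol hΩo (fun z hz hre => hdg z ⟨hz, hre⟩) hU hSU
    (hφ.of_le one_le_two) hφi hinj htr (fun y hy => hKΩ ⟨y, hy, rfl⟩)
    (fun y hy => (hKM ⟨y, hy, rfl⟩).2) rfl (fun z hz hzΩ => ?_) hw).1
  exact eq_of_mem_attainedHull (happrox _ (hQc.insert z)
    (insert_subset hzΩ (inter_subset_left.trans hKΩ))) hQc (fun y hy => hy.2) hz
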